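/- arXiv:2104.01362 — 2 statements merged into one kernel-verified Lean document; each statement's English description precedes it below -/
import Mathlib

section
/- Let F : V ∪ J → ℝ×ℝ_{≥0} be a C^∞-lifted strongly billiard-like map. Then there exists a domain W ⊆ V adjacent to J and a C^∞-smooth F-invariant function h̃ : W ∪ J → ℝ_{≥0} such that h̃ vanishes identically on J and ∂h̃/∂y > 0 on W ∪ J. -/
open Set

/-- `J = (a,b) × {0} ⊂ ℝ²`. -/
def Jset (a b : ℝ) : Set (ℝ × ℝ) := Set.Ioo a b ×ˢ ({0} : Set ℝ)

/-- A domain (connected open set) in the upper half-plane adjacent to the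
interval `J = (a,b) × {0}`. -/
def IsAdjDomain (a b : ℝ) (V : Set (ℝ × ℝ)) : Prop :=
  IsOpen V ∧ IsConnected V ∧ (∀ p ∈ V, 0 < p.2) ∧
    ∀ s ∈ Set.Ioo a b, ∃ ε > 0, Set.Ioo (s - ε) (s + ε) ×ˢ Set.Ioo (0 : ℝ) ε ⊆ V

/-- A function `f` on `S` (typically `S = V ∪ J`) is `y`-flat: it vanishes on `J`,
and it tends to `0` together with each of its partial derivatives of every order,
as the second coordinate tends to `0`, uniformly on compact subsets of `(a,b)`. -/
def FlatOn (a b : ℝ) (S : Set (ℝ × ℝ)) (f : ℝ × ℝ → ℝ) : Prop :=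
  (∀ s ∈ Set.Ioo a b, f (s, 0) = 0) ∧
  ∀ (n : ℕ) (K : Set ℝ), IsCompact K → K ⊆ Set.Ioo a b →
    ∀ ε > 0, ∃ δ > 0, ∀ p ∈ S, p.1 ∈ K → p.2 < δ →
      ‖iteratedFDerivWithin ℝ n f S p‖ < ε

/-- A `C^∞`-lifted strongly billiard-like map `F` on `V ∪ J`, `J = (a,b) × {0}`,
with asymptotic coefficient `w`:
(i) `F` is a homeomorphism onto its image fixing the points of `J`;
(ii) `F|_V` is a `C^∞` diffeomorphism preserving the standard area form `ds ∧ dy`;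
(iii) `F(s,y) = (s + w(s)√y + O(y), y + O(y^{3/2}))` as `y → 0`, uniformly on compact
subsets of `(a,b)`, with `w` continuous and positive;
(iv) in the coordinates `(s,z)`, `z = √y > 0`, the map `F` lifts to `F̃ = I ∘ β`,
where `I(s,z) = (s,−z)` and `β` is a `C^∞`-smooth involution on a neighborhood `N` of `J`
fixing the points of `{z = 0}`, of the form `β(s,z) = (s + w(s)z + O(z²), −z + O(z²))`. -/
structure IsBilliardLike (a b : ℝ) (w : ℝ → ℝ) (V : Set (ℝ × ℝ))
    (F : ℝ × ℝ → ℝ × ℝ) : Prop where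
  adj : IsAdjDomain a b V
  wCont : ContinuousOn w (Set.Ioo a b)
  wPos : ∀ s ∈ Set.Ioo a b, 0 < w s
  -- (i): homeomorphism onto the image, fixing the points of `J`
  fixJ : ∀ s ∈ Set.Ioo a b, F (s, 0) = (s, 0)
  mapsUpper : ∀ p ∈ V ∪ Jset a b, 0 ≤ (F p).2
  contF : ContinuousOn F (V ∪ Jset a b)
  injF : Set.InjOn F (V ∪ Jset a b)
  contInv : ∃ G : ℝ × ℝ → ℝ × ℝ, ContinuousOn G (F '' (V ∪ Jset a b)) ∧
      ∀ p ∈ V ∪ Jset a b, G (F p) = p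
  -- (ii): `F|_V` is a `C^∞` diffeomorphism preserving the area form
  smoothV : ContDiffOn ℝ (⊤ : ℕ∞) F V
  openImage : IsOpen (F '' V)
  smoothInv : ∃ G : ℝ × ℝ → ℝ × ℝ, ContDiffOn ℝ (⊤ : ℕ∞) G (F '' V) ∧
      ∀ p ∈ V, G (F p) = p
  areaPres : ∀ p ∈ V, (fderiv ℝ F p).det = 1
  -- (iii): asymptotics `F(s,y) = (s + w(s)√y + O(y), y + O(y^{3/2}))`
  asymp : ∀ K : Set ℝ, IsCompact K → K ⊆ Set.Ioo a b →
      ∃ C > 0, ∃ δ > 0, ∀ p ∈ V, p.1 ∈ K → p.2 < δ →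
        |(F p).1 - p.1 - w p.1 * Real.sqrt p.2| ≤ C * p.2 ∧
        |(F p).2 - p.2| ≤ C * p.2 ^ ((3:ℝ)/2)
  -- (iv): `C^∞`-smooth lifting `F̃ = I ∘ β` in the coordinates `(s, z)`, `z = √y`
  lifted : ∃ N : Set (ℝ × ℝ), IsOpen N ∧ Jset a b ⊆ N ∧
      ∃ β : ℝ × ℝ → ℝ × ℝ, ContDiffOn ℝ (⊤ : ℕ∞) β N ∧
        (∀ p ∈ N, β p ∈ N ∧ β (β p) = p) ∧
        (∀ s ∈ Set.Ioo a b, β (s, 0) = (s, 0)) ∧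
        (∀ K : Set ℝ, IsCompact K → K ⊆ Set.Ioo a b →
          ∃ C > 0, ∃ δ > 0, ∀ p ∈ N, p.1 ∈ K → |p.2| < δ →
            |(β p).1 - p.1 - w p.1 * p.2| ≤ C * p.2 ^ 2 ∧
            |(β p).2 + p.2| ≤ C * p.2 ^ 2) ∧
        (∀ p ∈ N, 0 < p.2 → (p.1, p.2 ^ 2) ∈ V →
          (F (p.1, p.2 ^ 2)).1 = (β p).1 ∧
          Real.sqrt (F (p.1, p.2 ^ 2)).2 = -(β p).2)

open scoped ContDiff Topology

theorem contDiff_intervalIntegral_param {E : Type} [NormedAddCommGroup E] [NormedSpace ℝ E]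
    [ProperSpace E] (n : ℕ) : ∀ {F : Type} [NormedAddCommGroup F] [NormedSpace ℝ F]
    [CompleteSpace F] {Φ : E × ℝ → F}, ContDiff ℝ n Φ →
    ContDiff ℝ n (fun x => ∫ t in (0:ℝ)..1, Φ (x, t)) := by
  induction n with
  | zero =>
    intro F _ _ _ Φ h
    simp only [Nat.cast_zero, contDiff_zero] at h ⊢
    exact intervalIntegral.continuous_parametric_intervalIntegral_of_continuous' (by exact h) 0 1
  | succ n ih =>
    intro F _ _ _ Φ h
    have hn : ((n + 1 : ℕ) : ℕ∞ω) ≠ 0 := by simp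
    have hd : ContDiff ℝ n (fun q : E × ℝ => (fderiv ℝ Φ q).comp (ContinuousLinearMap.inl ℝ E ℝ)) :=
      (h.fderiv_right (by norm_cast)).clm_comp contDiff_const
    have key : ∀ x, HasFDerivAt (fun x => ∫ t in (0:ℝ)..1, Φ (x, t))
        (∫ t in (0:ℝ)..1, (fderiv ℝ Φ (x, t)).comp (ContinuousLinearMap.inl ℝ E ℝ)) x := by
      intro x
      obtain ⟨C, hC⟩ := ((isCompact_closedBall x 1).prod
        (isCompact_Icc (a := (0:ℝ)) (b := 1))).exists_bound_of_continuousOn hd.continuous.continuousOn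
      refine intervalIntegral.hasFDerivAt_integral_of_dominated_of_fderiv_le
        (F' := fun x t => (fderiv ℝ Φ (x, t)).comp (ContinuousLinearMap.inl ℝ E ℝ))
        (bound := fun _ => C) (Metric.ball_mem_nhds x one_pos) ?_ ?_ ?_ ?_ ?_ ?_
      · exact Filter.Eventually.of_forall fun y =>
          (h.continuous.comp (by fun_prop : Continuous fun t : ℝ => (y, t))).aestronglyMeasurable
      · exact (h.continuous.comp (by fun_prop : Continuous fun t : ℝ => (x, t))).intervalIntegrable _ _
      · exact (hd.continuous.comp
          (by fun_prop : Continuous fun t : ℝ => (x, t))).aestronglyMeasurable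
      · refine Filter.Eventually.of_forall fun t ht y hy => hC (y, t) ⟨Metric.ball_subset_closedBall hy, ?_⟩
        rw [uIoc_of_le zero_le_one] at ht
        exact ⟨ht.1.le, ht.2⟩
      · exact intervalIntegrable_const
      · refine Filter.Eventually.of_forall fun t _ y _ => ?_
        exact ((h.differentiable hn) (y, t)).hasFDerivAt.comp y (hasFDerivAt_prodMk_left y t)
    rw [Nat.cast_add, Nat.cast_one, contDiff_succ_iff_hasFDerivAt]
    exact ⟨_, ih hd, key⟩

theorem exists_contDiff_div_snd {R : ℝ × ℝ → ℝ} (hR : ContDiff ℝ ∞ R) :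
    ∃ Q : ℝ × ℝ → ℝ, ContDiff ℝ ∞ Q ∧ ∀ p, R p = R (p.1, 0) + p.2 * Q p := by
  have hΦ : ContDiff ℝ ∞ (fun q : (ℝ × ℝ) × ℝ =>
      fderiv ℝ R (q.1.1, q.2 * q.1.2) ((0 : ℝ), (1 : ℝ))) := by
    have : ContDiff ℝ ∞ (fderiv ℝ R) := hR.fderiv_right (by simp)
    exact (this.comp (by fun_prop)).clm_apply contDiff_const
  refine ⟨fun p => ∫ t in (0:ℝ)..1, fderiv ℝ R (p.1, t * p.2) ((0 : ℝ), (1 : ℝ)), ?_, ?_⟩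
  · rw [contDiff_infty]
    intro n
    exact contDiff_intervalIntegral_param n (contDiff_infty.1 hΦ n)
  · rintro ⟨s, z⟩
    have hd : ∀ t : ℝ, HasDerivAt (fun t : ℝ => R (s, t * z))
        (z * fderiv ℝ R (s, t * z) ((0 : ℝ), (1 : ℝ))) t := by
      intro t
      have h1 : HasDerivAt (fun t : ℝ => (s, t * z)) ((0 : ℝ), z) t := by
        simpa using (hasDerivAt_const t s).prodMk ((hasDerivAt_id t).mul_const z)
      have := ((hR.differentiable (by simp)) (s, t * z)).hasFDerivAt.comp_hasDerivAt t h1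
      have e : fderiv ℝ R (s, t * z) ((0 : ℝ), z) =
          z * fderiv ℝ R (s, t * z) ((0 : ℝ), (1 : ℝ)) := by
        simpa using (fderiv ℝ R (s, t * z)).map_smul z ((0 : ℝ), (1 : ℝ))
      rw [← e]
      exact this
    have := intervalIntegral.integral_eq_sub_of_hasDerivAt (a := 0) (b := 1) (fun t _ => hd t) ?_
    · simp only [intervalIntegral.integral_const_mul, one_mul, zero_mul] at this
      simp only
      linarith
    · refine Continuous.intervalIntegrable ?_ _ _
      exact continuous_const.mul (hΦ.continuous.comp
        (by fun_prop : Continuous fun t : ℝ => ((s, z), t)))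

theorem hasDerivAt_of_eq_snd_mul {N : Set (ℝ × ℝ)} (hN : IsOpen N) {r q : ℝ × ℝ → ℝ} {s : ℝ}
    (hs : (s, (0 : ℝ)) ∈ N) (hq : ContinuousOn q N) (h : ∀ p ∈ N, r p = p.2 * q p) :
    HasDerivAt (fun z => r (s, z)) (q (s, 0)) 0 := by
  have hq0 : ContinuousAt q (s, 0) := hq.continuousAt (hN.mem_nhds hs)
  have hc : Filter.Tendsto (fun z : ℝ => q (s, z)) (𝓝 0) (𝓝 (q (s, 0))) :=
    hq0.tendsto.comp (by fun_prop : Continuous fun z : ℝ => (s, z)).continuousAt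
  have hev : ∀ᶠ z : ℝ in 𝓝 0, (s, z) ∈ N :=
    (by fun_prop : Continuous fun z : ℝ => (s, z)).continuousAt.eventually_mem (hN.mem_nhds hs)
  rw [hasDerivAt_iff_tendsto_slope]
  refine (hc.mono_left nhdsWithin_le_nhds).congr' ?_
  filter_upwards [self_mem_nhdsWithin, nhdsWithin_le_nhds hev] with z hz hzN
  have hz' : z ≠ 0 := hz
  rw [slope_def_field, h _ hzN, h _ hs]
  field_simp
  simp

/-- Hadamard's lemma: a smooth function vanishing on the axis `z = 0` is smoothly divisible
by `z`. -/
theorem exists_contDiffOn_div_snd {N : Set (ℝ × ℝ)} (hN : IsOpen N) {r : ℝ × ℝ → ℝ}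
    (hr : ContDiffOn ℝ ∞ r N) (h0 : ∀ s, (s, (0 : ℝ)) ∈ N → r (s, 0) = 0) :
    ∃ q : ℝ × ℝ → ℝ, ContDiffOn ℝ ∞ q N ∧ ∀ p ∈ N, r p = p.2 * q p := by
  classical
  refine ⟨fun p => if p.2 = 0 then deriv (fun z => r (p.1, z)) 0 else r p / p.2, ?_, ?_⟩
  swap
  · rintro ⟨s, z⟩ hp
    by_cases hz : z = 0
    · subst hz; simp [h0 s hp]
    · simp only [hz, if_false]; field_simp
  rintro ⟨s, z⟩ hp
  refine ContDiffAt.contDiffWithinAt ?_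
  by_cases hz : z = 0
  · subst hz
    obtain ⟨ε, hε, hball⟩ := Metric.isOpen_iff.1 hN _ hp
    let ρ : ContDiffBump ((s, (0 : ℝ)) : ℝ × ℝ) := ⟨ε / 4, ε / 2, by positivity, by linarith⟩
    have hsupp : tsupport ρ ⊆ N := by
      rw [ρ.tsupport_eq]
      exact (Metric.closedBall_subset_ball (by change ε / 2 < ε; linarith)).trans hball
    have hR : ContDiff ℝ ∞ (fun p => ρ p * r p) := by
      rw [contDiff_iff_contDiffAt]
      intro p
      by_cases hpN : p ∈ N
      · exact ρ.contDiff.contDiffAt.mul (hr.contDiffAt (hN.mem_nhds hpN))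
      · have hp' : p ∉ tsupport ρ := fun h => hpN (hsupp h)
        have : (fun p => ρ p * r p) =ᶠ[𝓝 p] fun _ => 0 := by
          filter_upwards [notMem_tsupport_iff_eventuallyEq.1 hp'] with x hx
          simp [hx]
        exact contDiffAt_const.congr_of_eventuallyEq this
    obtain ⟨Q, hQ, hRQ⟩ := exists_contDiff_div_snd hR
    have hmem : Metric.ball ((s, (0 : ℝ)) : ℝ × ℝ) (ε / 4) ∈ 𝓝 ((s, (0 : ℝ)) : ℝ × ℝ) :=
      Metric.ball_mem_nhds _ (by positivity)
    have hrQ : ∀ p ∈ Metric.ball ((s, (0 : ℝ)) : ℝ × ℝ) (ε / 4), r p = p.2 * Q p := by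
      intro p hpb
      have h1 : ρ p = 1 := ρ.one_of_mem_closedBall (Metric.ball_subset_closedBall hpb)
      have hp0 : (p.1, (0 : ℝ)) ∈ N := by
        apply hball
        rw [Metric.mem_ball, Prod.dist_eq, max_lt_iff] at hpb ⊢
        refine ⟨by linarith [hpb.1], by simpa using hε⟩
      have := hRQ p
      simp only [h1, one_mul, h0 _ hp0, mul_zero, zero_add] at this
      exact this
    refine hQ.contDiffAt.congr_of_eventuallyEq ?_
    filter_upwards [hmem] with p hpb
    by_cases hpz : p.2 = 0
    · have hp' : (p.1, (0 : ℝ)) ∈ Metric.ball ((s, (0 : ℝ)) : ℝ × ℝ) (ε / 4) := by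
        rw [show (p.1, (0 : ℝ)) = p from Prod.ext rfl hpz.symm]; exact hpb
      have := (hasDerivAt_of_eq_snd_mul Metric.isOpen_ball hp' hQ.continuous.continuousOn hrQ).deriv
      simp only [hpz, if_true, this]
      rw [← hpz]
    · simp only [hpz, if_false, hrQ p hpb]; field_simp
  · have : ContDiffAt ℝ ∞ (fun p : ℝ × ℝ => r p / p.2) (s, z) :=
      (hr.contDiffAt (hN.mem_nhds hp)).div contDiffAt_snd hz
    refine this.congr_of_eventuallyEq ?_
    have : ∀ᶠ p : ℝ × ℝ in 𝓝 (s, z), p.2 ≠ 0 := continuous_snd.continuousAt.eventually_ne hz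
    filter_upwards [this] with p hp'
    simp [hp']

theorem exists_forall_ge_norm_iteratedFDeriv_scaled_le {e χ : ℝ → ℝ} (he : ContDiff ℝ ∞ e)
    (hec : HasCompactSupport e) (hχ : ContDiff ℝ ∞ χ) (hχc : HasCompactSupport χ)
    {p j : ℕ} (hj : j < p) {ε : ℝ} (hε : 0 < ε) :
    ∃ T₀ : ℝ, ∀ T ≥ T₀, ∀ x : ℝ × ℝ,
      ‖iteratedFDeriv ℝ j (fun x : ℝ × ℝ => e x.1 * x.2 ^ p * χ (T * x.2)) x‖ ≤ ε := by
  set Q : ℝ × ℝ → ℝ := fun x => e x.1 * x.2 ^ p * χ x.2 with hQ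
  have hQs : ContDiff ℝ ∞ Q := by
    have := he.comp (contDiff_fst (𝕜 := ℝ) (E := ℝ) (F := ℝ))
    have h2 := hχ.comp (contDiff_snd (𝕜 := ℝ) (E := ℝ) (F := ℝ))
    exact (this.mul (contDiff_snd.pow p)).mul h2
  have hQc : HasCompactSupport Q := by
    refine HasCompactSupport.intro (hec.isCompact.prod hχc.isCompact) ?_
    intro x hx
    simp only [mem_prod, not_and_or] at hx
    rcases hx with hx | hx
    · simp [hQ, image_eq_zero_of_notMem_tsupport hx]
    · simp [hQ, image_eq_zero_of_notMem_tsupport hx]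
  have hjs : ContDiff ℝ j Q := contDiff_infty.1 hQs j
  obtain ⟨M, hM⟩ := (hQc.iteratedFDeriv (𝕜 := ℝ) j).exists_bound_of_continuous
    (hjs.continuous_iteratedFDeriv le_rfl)
  have hM0 : 0 ≤ M := (norm_nonneg _).trans (hM 0)
  refine ⟨max 1 (M / ε), fun T hT x => ?_⟩
  have hT1 : 1 ≤ T := (le_max_left _ _).trans hT
  have hT0 : 0 < T := by linarith
  have hTM : M ≤ ε * T := by
    have := (le_max_right _ _).trans hT
    rwa [div_le_iff₀ hε, mul_comm] at this
  let L : ℝ × ℝ →L[ℝ] ℝ × ℝ :=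
    (ContinuousLinearMap.fst ℝ ℝ ℝ).prod (T • ContinuousLinearMap.snd ℝ ℝ ℝ)
  have hL : ‖L‖ ≤ T := by
    refine L.opNorm_le_bound hT0.le fun x => ?_
    change ‖(x.1, T * x.2)‖ ≤ T * ‖x‖
    rw [Prod.norm_def, Prod.norm_def]
    refine max_le ?_ ?_
    · calc ‖x.1‖ ≤ max ‖x.1‖ ‖x.2‖ := le_max_left _ _
        _ ≤ T * max ‖x.1‖ ‖x.2‖ := le_mul_of_one_le_left (by positivity) hT1
    · rw [norm_mul, Real.norm_of_nonneg hT0.le]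
      gcongr
      exact le_max_right _ _
  have hfun : (fun x : ℝ × ℝ => e x.1 * x.2 ^ p * χ (T * x.2)) =
      fun x => (T⁻¹ ^ p) • (Q ∘ L) x := by
    funext x
    change _ = T⁻¹ ^ p * (e x.1 * (T * x.2) ^ p * χ (T * x.2))
    rw [mul_pow, inv_pow]
    field_simp
  rw [hfun, iteratedFDeriv_const_smul_apply' (hjs.comp L.contDiff).contDiffAt,
    L.iteratedFDeriv_comp_right hjs x le_rfl, norm_smul]
  have h1 : ‖(iteratedFDeriv ℝ j Q (L x)).compContinuousLinearMap fun _ => L‖ ≤ M * T ^ j := by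
    refine (ContinuousMultilinearMap.norm_compContinuousLinearMap_le _ _).trans ?_
    rw [Finset.prod_const, Finset.card_univ, Fintype.card_fin]
    gcongr
    exact hM _
  calc _ ≤ ‖T⁻¹ ^ p‖ * (M * T ^ j) := by gcongr
    _ = M * T ^ j / T ^ p := by
      rw [norm_pow, norm_inv, Real.norm_of_nonneg hT0.le, inv_pow]; ring
    _ ≤ ε := by
      rw [div_le_iff₀ (by positivity)]
      calc M * T ^ j ≤ ε * T * T ^ j := by gcongr
        _ = ε * T ^ (j + 1) := by ring
        _ ≤ ε * T ^ p := by gcongr; omega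

theorem contDiff_div_pow_of_eventuallyEq_zero {g : ℝ → ℝ} (hg : ContDiff ℝ ∞ g)
    (h0 : g =ᶠ[𝓝 0] 0) (m : ℕ) : ContDiff ℝ ∞ (fun y => g y / y ^ m) := by
  rw [contDiff_iff_contDiffAt]
  intro y
  by_cases hy : y = 0
  · subst hy
    refine (contDiffAt_const (c := (0 : ℝ))).congr_of_eventuallyEq ?_
    filter_upwards [h0] with y hy
    simp [hy]
  · exact hg.contDiffAt.div (contDiffAt_id.pow m) (pow_ne_zero _ hy)

/-- Borel's lemma with a parameter: there is a smooth function with prescribed Taylor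
coefficients along the axis. -/
theorem exists_smooth_with_taylor_coeff {a b : ℝ} (hab : a < b) {c : ℕ → ℝ → ℝ}
    (hc : ∀ k, ContDiffOn ℝ ∞ (c k) (Ioo a b)) :
    ∃ H : ℝ × ℝ → ℝ, ∀ m : ℕ, ∃ S : ℝ × ℝ → ℝ, ContDiffOn ℝ ∞ S (Ioo a b ×ˢ univ) ∧
      ∀ p ∈ Ioo a b ×ˢ (univ : Set ℝ),
        H p = ∑ k ∈ Finset.range m, c k p.1 * p.2 ^ k + p.2 ^ m * S p := by
  let χ : ContDiffBump (0 : ℝ) := ⟨1, 2, one_pos, one_lt_two⟩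
  have hχ : ContDiff ℝ ∞ χ := χ.contDiff
  have hfrac : ∀ i : ℕ, (1 : ℝ) / (i + 3) < 1 / (i + 2) := fun i =>
    one_div_lt_one_div_of_lt (by positivity) (by linarith)
  have hfrac1 : ∀ i : ℕ, (1 : ℝ) / (i + 2) < 1 := fun i => by
    rw [div_lt_one (by positivity)]; linarith [(Nat.cast_nonneg i : (0 : ℝ) ≤ i)]
  let ρ : ∀ i : ℕ, ContDiffBump ((a + b) / 2) := fun i =>
    ⟨(b - a) / 2 * (1 - 1 / (i + 2)), (b - a) / 2 * (1 - 1 / (i + 3)),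
      mul_pos (by linarith) (by linarith [hfrac1 i]),
      mul_lt_mul_of_pos_left (by linarith [hfrac i]) (by linarith)⟩
  have hρsupp : ∀ i, tsupport (ρ i) ⊆ Ioo a b := by
    intro i x hx
    rw [(ρ i).tsupport_eq, Metric.mem_closedBall, Real.dist_eq] at hx
    have h3 : (0 : ℝ) < 1 / (i + 3) := by positivity
    have h2 : |x - (a + b) / 2| < (b - a) / 2 := by
      refine lt_of_le_of_lt hx ?_
      change (b - a) / 2 * (1 - 1 / (i + 3)) < (b - a) / 2
      nlinarith
    rw [abs_lt] at h2
    constructor <;> linarith [h2.1, h2.2]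
  have he : ∀ i k, ContDiff ℝ ∞ (fun s => ρ i s * c k s) := by
    intro i k
    rw [contDiff_iff_contDiffAt]
    intro s
    by_cases hs : s ∈ Ioo a b
    · exact (ρ i).contDiff.contDiffAt.mul ((hc k).contDiffAt (isOpen_Ioo.mem_nhds hs))
    · have hs' : s ∉ tsupport (ρ i) := fun h => hs (hρsupp i h)
      refine (contDiffAt_const (c := (0 : ℝ))).congr_of_eventuallyEq ?_
      filter_upwards [notMem_tsupport_iff_eventuallyEq.1 hs'] with x hx
      simp [hx]
  have hec : ∀ i k, HasCompactSupport (fun s => ρ i s * c k s) := fun i k =>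
    (ρ i).hasCompactSupport.mul_right
  have hT : ∀ k : ℕ, ∃ T : ℝ, ∀ i ≤ k, ∀ p ≤ k, ∀ j < p, ∀ x : ℝ × ℝ,
      ‖iteratedFDeriv ℝ j (fun x : ℝ × ℝ => ρ i x.1 * c k x.1 * x.2 ^ p * χ (T * x.2)) x‖
        ≤ (1 / 2) ^ k := by
    intro k
    have hev : ∀ᶠ T : ℝ in Filter.atTop, ∀ i ∈ Finset.range (k + 1), ∀ p ∈ Finset.range (k + 1),
        ∀ j ∈ Finset.range p, ∀ x : ℝ × ℝ,
        ‖iteratedFDeriv ℝ j (fun x : ℝ × ℝ => ρ i x.1 * c k x.1 * x.2 ^ p * χ (T * x.2)) x‖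
          ≤ (1 / 2) ^ k := by
      simp only [Filter.eventually_all_finset]
      intro i _ p _ j hj
      obtain ⟨T₀, h⟩ := exists_forall_ge_norm_iteratedFDeriv_scaled_le (he i k) (hec i k) hχ
        χ.hasCompactSupport (Finset.mem_range.1 hj) (ε := (1 / 2) ^ k) (by positivity)
      exact Filter.eventually_atTop.2 ⟨T₀, h⟩
    obtain ⟨T, h1⟩ := hev.exists
    exact ⟨T, fun i hi p hp j hj => h1 i (Finset.mem_range.2 (by omega)) p
      (Finset.mem_range.2 (by omega)) j (Finset.mem_range.2 hj)⟩
  choose T hTb using hT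
  have hone : ∀ s ∈ Ioo a b, ∃ i, ∀ᶠ x in 𝓝 s, ρ i x = 1 := by
    intro s hs
    have hd : 0 < 1 - |s - (a + b) / 2| / ((b - a) / 2) := by
      rw [sub_pos, div_lt_one (by linarith), abs_lt]
      constructor <;> linarith [hs.1, hs.2]
    obtain ⟨i, hi⟩ := exists_nat_one_div_lt hd
    refine ⟨i, (ρ i).eventuallyEq_one_of_mem_ball ?_⟩
    rw [Metric.mem_ball, Real.dist_eq]
    change _ < (b - a) / 2 * (1 - 1 / (i + 2))
    have h4 : (1 : ℝ) / (i + 2) < 1 / (i + 1) :=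
      one_div_lt_one_div_of_lt (by positivity) (by linarith)
    have h5 : |s - (a + b) / 2| / ((b - a) / 2) < 1 - 1 / (i + 2) := by linarith
    rw [div_lt_iff₀ (by linarith)] at h5
    linarith
  have hsum : ∀ p ∈ Ioo a b ×ˢ (univ : Set ℝ),
      Summable fun k => c k p.1 * p.2 ^ k * χ (T k * p.2) := by
    rintro ⟨s, y⟩ hp
    obtain ⟨i, hi⟩ := hone s hp.1
    refine Summable.of_norm_bounded_eventually_nat (g := fun k => (1 / 2 : ℝ) ^ k)
      (summable_geometric_of_lt_one (by norm_num) (by norm_num)) ?_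
    filter_upwards [Filter.eventually_ge_atTop (i + 1)] with k hk
    have := hTb k i (by omega) k le_rfl 0 (by omega) (s, y)
    rw [norm_iteratedFDeriv_zero] at this
    simpa [hi.self_of_nhds] using this
  refine ⟨fun p => ∑' k, c k p.1 * p.2 ^ k * χ (T k * p.2), fun m => ?_⟩
  refine ⟨fun p => ∑ k ∈ Finset.range m,
      c k p.1 * ((p.2 ^ k * (χ (T k * p.2) - 1)) / p.2 ^ m) +
      ∑' k, c (k + m) p.1 * p.2 ^ k * χ (T (k + m) * p.2), ?_, ?_⟩
  · refine ContDiffOn.add ?_ ?_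
    · refine ContDiffOn.sum fun k _ => ?_
      refine ((hc k).comp contDiffOn_fst fun p hp => hp.1).mul ?_
      have hg : ContDiff ℝ ∞ fun y : ℝ => y ^ k * (χ (T k * y) - 1) := by
        have : ContDiff ℝ ∞ fun y : ℝ => χ (T k * y) := hχ.comp (contDiff_const.mul contDiff_id)
        exact (contDiff_id.pow k).mul (this.sub contDiff_const)
      have h0 : (fun y : ℝ => y ^ k * (χ (T k * y) - 1)) =ᶠ[𝓝 0] 0 := by
        have h1 : ∀ᶠ z in 𝓝 (0 : ℝ), χ z = 1 := χ.eventuallyEq_one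
        have h2 : Filter.Tendsto (fun y : ℝ => T k * y) (𝓝 0) (𝓝 0) := by
          have : Continuous fun y : ℝ => T k * y := by fun_prop
          simpa using this.tendsto 0
        filter_upwards [h2.eventually h1] with y hy
        simp [hy]
      exact ((contDiff_div_pow_of_eventuallyEq_zero hg h0 m).comp contDiff_snd).contDiffOn
    · rintro ⟨s, y⟩ hp
      refine ContDiffAt.contDiffWithinAt ?_
      obtain ⟨i, hi⟩ := hone s hp.1
      have hG : ContDiff ℝ ∞ fun p : ℝ × ℝ =>
          ∑' k, ρ i p.1 * c (k + m) p.1 * p.2 ^ k * χ (T (k + m) * p.2) := by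
        refine contDiff_tsum_of_eventually (N := ⊤) (v := fun _ k => (1 / 2 : ℝ) ^ (k + m))
          (fun k => ?_) (fun _ _ => ?_) (fun j _ => ?_)
        · have h1 := (he i (k + m)).comp (contDiff_fst (𝕜 := ℝ) (E := ℝ) (F := ℝ))
          have h2 : ContDiff ℝ ∞ fun p : ℝ × ℝ => χ (T (k + m) * p.2) :=
            hχ.comp (contDiff_const.mul contDiff_snd)
          exact (h1.mul (contDiff_snd.pow k)).mul h2
        · exact (summable_nat_add_iff m).2
            (summable_geometric_of_lt_one (by norm_num) (by norm_num))
        · rw [Nat.cofinite_eq_atTop]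
          filter_upwards [Filter.eventually_ge_atTop (i + j + 1)] with k hk x
          exact hTb (k + m) i (by omega) k (by omega) j (by omega) x
      refine hG.contDiffAt.congr_of_eventuallyEq ?_
      have : ∀ᶠ p : ℝ × ℝ in 𝓝 (s, y), ρ i p.1 = 1 :=
        (continuous_fst.tendsto ((s, y) : ℝ × ℝ)).eventually hi
      filter_upwards [this] with p hp'
      simp [hp']
  · rintro ⟨s, y⟩ hp
    have h1 := (hsum _ hp).sum_add_tsum_nat_add m
    simp only at h1 ⊢
    rw [← h1, mul_add, ← add_assoc, Finset.mul_sum, ← Finset.sum_add_distrib, ← tsum_mul_left]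
    congr 1
    · refine Finset.sum_congr rfl fun k hk => ?_
      by_cases hy : y = 0
      · subst hy
        have : χ 0 = 1 := χ.eventuallyEq_one.self_of_nhds
        simp [this]
      · field_simp
        ring
    · refine tsum_congr fun k => ?_
      rw [pow_add]; ring

theorem exists_smooth_primitive {a b : ℝ} {h : ℝ → ℝ} (hh : ContDiffOn ℝ ∞ h (Ioo a b)) :
    ∃ A : ℝ → ℝ, ContDiffOn ℝ ∞ A (Ioo a b) ∧ ∀ s ∈ Ioo a b, HasDerivAt A (h s) s := by
  have hd : ∀ s ∈ Ioo a b, HasDerivAt (fun x => ∫ t in ((a + b) / 2)..x, h t) (h s) s := by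
    intro s hs
    have hsub : uIcc ((a + b) / 2) s ⊆ Ioo a b :=
      ordConnected_Ioo.uIcc_subset ⟨by linarith [hs.1, hs.2], by linarith [hs.1, hs.2]⟩ hs
    exact intervalIntegral.integral_hasDerivAt_right (hh.continuousOn.mono hsub).intervalIntegrable
      (hh.continuousOn.stronglyMeasurableAtFilter isOpen_Ioo s hs)
      (hh.continuousOn.continuousAt (isOpen_Ioo.mem_nhds hs))
  refine ⟨_, ?_, hd⟩
  rw [contDiffOn_infty_iff_deriv_of_isOpen isOpen_Ioo]
  exact ⟨fun s hs => (hd s hs).differentiableAt.differentiableWithinAt,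
    hh.congr fun s hs => (hd s hs).deriv⟩

theorem exists_pos_solution_linear_ode {a b : ℝ} {w g : ℝ → ℝ} (hw : ContDiffOn ℝ ∞ w (Ioo a b))
    (hg : ContDiffOn ℝ ∞ g (Ioo a b)) (hpos : ∀ s ∈ Ioo a b, 0 < w s) (μ : ℝ) :
    ∃ e : ℝ → ℝ, ContDiffOn ℝ ∞ e (Ioo a b) ∧ (∀ s, 0 < e s) ∧
      ∀ s ∈ Ioo a b, w s * deriv e s + μ * g s * e s = 0 := by
  obtain ⟨A, hA, hAd⟩ := exists_smooth_primitive
    (h := fun s => -(μ * g s) / w s) ((contDiffOn_const.mul hg).neg.div hw fun s hs => (hpos s hs).ne')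
  refine ⟨fun s => Real.exp (A s), hA.exp, fun s => Real.exp_pos _, fun s hs => ?_⟩
  rw [(hAd s hs).exp.deriv]
  have := (hpos s hs).ne'
  field_simp
  ring

theorem exists_solution_linear_ode {a b : ℝ} {w g ρ : ℝ → ℝ} (hw : ContDiffOn ℝ ∞ w (Ioo a b))
    (hg : ContDiffOn ℝ ∞ g (Ioo a b)) (hρ : ContDiffOn ℝ ∞ ρ (Ioo a b))
    (hpos : ∀ s ∈ Ioo a b, 0 < w s) (μ : ℝ) :
    ∃ c : ℝ → ℝ, ContDiffOn ℝ ∞ c (Ioo a b) ∧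
      ∀ s ∈ Ioo a b, w s * deriv c s + μ * g s * c s + ρ s = 0 := by
  obtain ⟨e, he, hepos, hed⟩ := exists_pos_solution_linear_ode hw hg hpos μ
  obtain ⟨D, hD, hDd⟩ := exists_smooth_primitive (h := fun s => -ρ s / (w s * e s))
    (hρ.neg.div (hw.mul he) fun s hs => (mul_pos (hpos s hs) (hepos s)).ne')
  refine ⟨fun s => e s * D s, he.mul hD, fun s hs => ?_⟩
  have hes : DifferentiableAt ℝ e s :=
    (he.contDiffAt (isOpen_Ioo.mem_nhds hs)).differentiableAt (by simp)
  have h1 : deriv (fun s => e s * D s) s = _ := (hes.hasDerivAt.mul (hDd s hs)).deriv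
  rw [h1]
  have h2 := hed s hs
  have h3 := (hpos s hs).ne'
  have h4 := (hepos s).ne'
  have h5 : w s * (e s * (-ρ s / (w s * e s))) = -ρ s := by field_simp
  linear_combination D s * h2 + h5

/-- The map `(s, z) ↦ (s + z f, z exp (z g))`. -/
noncomputable def axisMap (f g : ℝ × ℝ → ℝ) (p : ℝ × ℝ) : ℝ × ℝ :=
  (p.1 + p.2 * f p, p.2 * Real.exp (p.2 * g p))

/-- The data of a smooth map near the axis `z = 0`, moving points in the positive direction. -/
structure IsAxisData (a b : ℝ) (N : Set (ℝ × ℝ)) (f g : ℝ × ℝ → ℝ) : Prop where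
  isOpen : IsOpen N
  axis : ∀ s ∈ Ioo a b, (s, (0 : ℝ)) ∈ N
  fst_mem : ∀ p ∈ N, p.1 ∈ Ioo a b
  smooth_f : ContDiffOn ℝ ∞ f N
  smooth_g : ContDiffOn ℝ ∞ g N
  pos : ∀ s ∈ Ioo a b, 0 < f (s, 0)

/-- The reflection in the axis. -/
def reflAxis (p : ℝ × ℝ) : ℝ × ℝ := (p.1, -p.2)

/-- Increment along the axis map of a function of `(s, y)`, `y = z ^ 2`. -/
noncomputable def axisIncr (f g H : ℝ × ℝ → ℝ) (p : ℝ × ℝ) : ℝ :=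
  H ((axisMap f g p).1, (axisMap f g p).2 ^ 2) - H (p.1, p.2 ^ 2)

section Formal

variable {a b : ℝ} {N : Set (ℝ × ℝ)} {f g : ℝ × ℝ → ℝ}

theorem IsAxisData.smooth_map_fst (h : IsAxisData a b N f g) :
    ContDiffOn ℝ ∞ (fun p => (axisMap f g p).1) N :=
  contDiffOn_fst.add (contDiffOn_snd.mul h.smooth_f)

theorem IsAxisData.smooth_map_snd (h : IsAxisData a b N f g) :
    ContDiffOn ℝ ∞ (fun p => (axisMap f g p).2) N :=
  contDiffOn_snd.mul (contDiffOn_snd.mul h.smooth_g).exp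

theorem IsAxisData.restrict (h : IsAxisData a b N f g) {q : ℝ × ℝ → ℝ}
    (hq : ContDiffOn ℝ ∞ q N) : ContDiffOn ℝ ∞ (fun s => q (s, 0)) (Ioo a b) :=
  hq.comp (by fun_prop) fun s hs => h.axis s hs

theorem IsAxisData.incr_monomial (h : IsAxisData a b N f g)
    (hG : ∀ p ∈ N, (axisMap f g p).1 ∈ Ioo a b) {c : ℝ → ℝ} (hc : ContDiffOn ℝ ∞ c (Ioo a b))
    (m : ℕ) : ∃ B : ℝ × ℝ → ℝ, ContDiffOn ℝ ∞ B N ∧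
      (∀ p ∈ N, axisIncr f g (fun q => c q.1 * q.2 ^ m) p = p.2 ^ (2 * m + 1) * B p) ∧
      ∀ s ∈ Ioo a b, B (s, 0) = f (s, 0) * deriv c s + (2 * m) * g (s, 0) * c s := by
  set B₀ : ℝ × ℝ → ℝ := fun p =>
    c (axisMap f g p).1 * Real.exp (2 * m * (p.2 * g p)) - c p.1 with hB₀
  have hB₀s : ContDiffOn ℝ ∞ B₀ N := by
    refine ((hc.comp h.smooth_map_fst hG).mul ?_).sub (hc.comp contDiffOn_fst h.fst_mem)
    exact (contDiffOn_const.mul (contDiffOn_snd.mul h.smooth_g)).exp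
  obtain ⟨B, hB, hBe⟩ := exists_contDiffOn_div_snd h.isOpen hB₀s (fun s _ => by
    simp [hB₀, axisMap])
  refine ⟨B, hB, fun p hp => ?_, fun s hs => ?_⟩
  · have h1 : (Real.exp (p.2 * g p) ^ 2) ^ m = Real.exp (2 * m * (p.2 * g p)) := by
      rw [← pow_mul, ← Real.exp_nat_mul]; push_cast; rfl
    have h2 := hBe p hp
    simp only [hB₀, axisMap] at h2
    simp only [axisIncr, axisMap, mul_pow]
    rw [h1, pow_succ _ (2 * m), mul_assoc (p.2 ^ (2 * m)), ← h2, pow_mul]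
    ring
  · have h1 := hasDerivAt_of_eq_snd_mul h.isOpen (h.axis s hs) hB.continuousOn hBe
    have hf := hasDerivAt_of_eq_snd_mul (r := fun p => p.2 * f p) h.isOpen (h.axis s hs)
      h.smooth_f.continuousOn (fun _ _ => rfl)
    have hg := hasDerivAt_of_eq_snd_mul (r := fun p => p.2 * g p) h.isOpen (h.axis s hs)
      h.smooth_g.continuousOn (fun _ _ => rfl)
    have hcs : HasDerivAt c (deriv c s) s :=
      ((hc.contDiffAt (isOpen_Ioo.mem_nhds hs)).differentiableAt (by simp)).hasDerivAt
    have hcs' : HasDerivAt c (deriv c s) (s + 0 * f (s, 0)) := by simpa using hcs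
    have h2 : HasDerivAt (fun z => B₀ (s, z)) _ 0 :=
      ((hcs'.comp (0 : ℝ) (hf.const_add s)).mul (hg.const_mul (2 * (m : ℝ))).exp).sub_const (c s)
    rw [h1.unique h2]
    simp
    ring

theorem IsAxisData.even_coeff_eq_zero (h : IsAxisData a b N f g)
    (hrev : ∀ p ∈ N, reflAxis (axisMap f g p) ∈ N →
      axisMap f g (reflAxis (axisMap f g p)) = reflAxis p)
    {H r : ℝ × ℝ → ℝ} (hr : ContDiffOn ℝ ∞ r N) {m : ℕ}
    (hE : ∀ p ∈ N, axisIncr f g H p = p.2 ^ (2 * m) * r p) {s : ℝ} (hs : s ∈ Ioo a b) :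
    r (s, 0) = 0 := by
  have hsN := h.axis s hs
  have hline : Filter.Tendsto (fun z : ℝ => (s, z)) (𝓝 0) (𝓝 (s, 0)) :=
    (by fun_prop : Continuous fun z : ℝ => (s, z)).tendsto 0
  have hpc : ContinuousAt (fun p => reflAxis (axisMap f g p)) (s, 0) := by
    have h1 := h.smooth_map_fst.continuousOn.continuousAt (h.isOpen.mem_nhds hsN)
    have h2 := h.smooth_map_snd.continuousOn.continuousAt (h.isOpen.mem_nhds hsN)
    exact h1.prodMk h2.neg
  have hpt : Filter.Tendsto (fun z : ℝ => reflAxis (axisMap f g (s, z))) (𝓝 0) (𝓝 (s, 0)) := by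
    have := hpc.tendsto.comp hline
    simpa [Function.comp_def, reflAxis, axisMap] using this
  have hrc : ContinuousAt r (s, 0) := hr.continuousOn.continuousAt (h.isOpen.mem_nhds hsN)
  have hgc : ContinuousAt g (s, 0) := h.smooth_g.continuousOn.continuousAt (h.isOpen.mem_nhds hsN)
  have hlim1 : Filter.Tendsto (fun z : ℝ => Real.exp (z * g (s, z)) ^ (2 * m) *
      r (reflAxis (axisMap f g (s, z)))) (𝓝[≠] 0) (𝓝 (r (s, 0))) := by
    have h1 : Filter.Tendsto (fun z : ℝ => Real.exp (z * g (s, z)) ^ (2 * m)) (𝓝 0) (𝓝 1) := by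
      have := ((Real.continuous_exp.tendsto _).comp
        (Filter.tendsto_id.mul (hgc.tendsto.comp hline))).pow (2 * m)
      simpa using this
    simpa using (h1.mul (hrc.tendsto.comp hpt)).mono_left nhdsWithin_le_nhds
  have hlim2 : Filter.Tendsto (fun z : ℝ => -r (s, z)) (𝓝[≠] 0) (𝓝 (-r (s, 0))) :=
    (hrc.tendsto.comp hline).neg.mono_left nhdsWithin_le_nhds
  have hev : ∀ᶠ z : ℝ in 𝓝[≠] 0, Real.exp (z * g (s, z)) ^ (2 * m) *
      r (reflAxis (axisMap f g (s, z))) = -r (s, z) := by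
    filter_upwards [self_mem_nhdsWithin,
      nhdsWithin_le_nhds (hline.eventually_mem (h.isOpen.mem_nhds hsN)),
      nhdsWithin_le_nhds (hpt.eventually_mem (h.isOpen.mem_nhds hsN))] with z hz hzN hzN'
    have hz' : z ^ (2 * m) ≠ 0 := pow_ne_zero _ hz
    have e1 := hE _ hzN
    have e2 := hE _ hzN'
    have e3 : axisIncr f g H (reflAxis (axisMap f g (s, z))) = -axisIncr f g H (s, z) := by
      rw [axisIncr, hrev _ hzN hzN']
      simp [axisIncr, reflAxis]
    rw [e3, e1] at e2
    have e4 : (reflAxis (axisMap f g (s, z))).2 ^ (2 * m) =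
        z ^ (2 * m) * Real.exp (z * g (s, z)) ^ (2 * m) := by
      simp only [reflAxis, axisMap]
      rw [Even.neg_pow (even_two_mul m), mul_pow]
    rw [e4] at e2
    apply mul_left_cancel₀ hz'
    linear_combination -e2
  have := tendsto_nhds_unique (hlim1.congr' hev) hlim2
  linarith

theorem IsAxisData.exists_correction (h : IsAxisData a b N f g)
    (hG : ∀ p ∈ N, (axisMap f g p).1 ∈ Ioo a b)
    (hrev : ∀ p ∈ N, reflAxis (axisMap f g p) ∈ N →
      axisMap f g (reflAxis (axisMap f g p)) = reflAxis p)
    {H r : ℝ × ℝ → ℝ} (hr : ContDiffOn ℝ ∞ r N) {m : ℕ}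
    (hE : ∀ p ∈ N, axisIncr f g H p = p.2 ^ (2 * m) * r p) :
    ∃ c : ℝ → ℝ, ContDiffOn ℝ ∞ c (Ioo a b) ∧ ∃ r' : ℝ × ℝ → ℝ, ContDiffOn ℝ ∞ r' N ∧
      ∀ p ∈ N, axisIncr f g (fun q => H q + c q.1 * q.2 ^ m) p = p.2 ^ (2 * (m + 1)) * r' p := by
  obtain ⟨r₁, hr₁, hrr₁⟩ := exists_contDiffOn_div_snd h.isOpen hr
    (fun s hs => h.even_coeff_eq_zero hrev hr hE (h.fst_mem _ hs))
  obtain ⟨c, hc, hcode⟩ := exists_solution_linear_ode (h.restrict h.smooth_f)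
    (h.restrict h.smooth_g) (h.restrict hr₁) h.pos (2 * m)
  obtain ⟨B, hB, hBe, hB0⟩ := h.incr_monomial hG hc m
  obtain ⟨r', hr', hrr'⟩ := exists_contDiffOn_div_snd h.isOpen (hr₁.add hB) (fun s hs => by
    change r₁ (s, 0) + B (s, 0) = 0
    rw [hB0 s (h.fst_mem _ hs)]
    linear_combination hcode s (h.fst_mem _ hs))
  refine ⟨c, hc, r', hr', fun p hp => ?_⟩
  have e1 := hE p hp
  have e2 := hBe p hp
  have e3 : r₁ p + B p = p.2 * r' p := hrr' p hp
  rw [hrr₁ p hp] at e1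
  have e4 : axisIncr f g (fun q => H q + c q.1 * q.2 ^ m) p =
      axisIncr f g H p + axisIncr f g (fun q => c q.1 * q.2 ^ m) p := by
    simp only [axisIncr]; ring
  rw [e4, e1, e2, show 2 * (m + 1) = 2 * m + 1 + 1 by ring, pow_succ _ (2 * m + 1), mul_assoc _ p.2,
    ← e3, pow_succ]
  ring

theorem IsAxisData.exists_formal_coeff (h : IsAxisData a b N f g)
    (hG : ∀ p ∈ N, (axisMap f g p).1 ∈ Ioo a b)
    (hrev : ∀ p ∈ N, reflAxis (axisMap f g p) ∈ N →
      axisMap f g (reflAxis (axisMap f g p)) = reflAxis p) :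
    ∃ c : ℕ → ℝ → ℝ, (∀ k, ContDiffOn ℝ ∞ (c k) (Ioo a b)) ∧ c 0 = 0 ∧ (∀ s, 0 < c 1 s) ∧
      ∀ m, 2 ≤ m → ∃ r : ℝ × ℝ → ℝ, ContDiffOn ℝ ∞ r N ∧ ∀ p ∈ N,
        axisIncr f g (fun q => ∑ k ∈ Finset.range m, c k q.1 * q.2 ^ k) p =
          p.2 ^ (2 * m) * r p := by
  obtain ⟨e, he, hepos, heode⟩ := exists_pos_solution_linear_ode (h.restrict h.smooth_f)
    (h.restrict h.smooth_g) h.pos (2 * (1 : ℕ))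
  let Q : ℕ → (ℝ × ℝ → ℝ) → Prop := fun m H => ∃ r : ℝ × ℝ → ℝ, ContDiffOn ℝ ∞ r N ∧
    ∀ p ∈ N, axisIncr f g H p = p.2 ^ (2 * m) * r p
  have hbase : Q 2 (fun q => e q.1 * q.2 ^ 1) := by
    obtain ⟨B, hB, hBe, hB0⟩ := h.incr_monomial hG he 1
    obtain ⟨r', hr', hrr'⟩ := exists_contDiffOn_div_snd h.isOpen hB (fun s hs => by
      rw [hB0 s (h.fst_mem _ hs)]
      exact heode s (h.fst_mem _ hs))
    refine ⟨r', hr', fun p hp => ?_⟩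
    rw [hBe p hp, hrr' p hp]
    ring
  have hstep : ∀ m H, Q m H → ∃ c : ℝ → ℝ, ContDiffOn ℝ ∞ c (Ioo a b) ∧
      Q (m + 1) (fun q => H q + c q.1 * q.2 ^ m) := by
    rintro m H ⟨r, hr, hE⟩
    exact h.exists_correction hG hrev hr hE
  choose! C hC hCQ using hstep
  let X : ℕ → (ℝ × ℝ → ℝ) := fun n => Nat.rec (fun q => e q.1 * q.2 ^ 1)
    (fun n H => fun q => H q + C (n + 2) H q.1 * q.2 ^ (n + 2)) n
  have hX : ∀ n, Q (n + 2) (X n) := by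
    intro n
    induction n with
    | zero => exact hbase
    | succ n ih => exact hCQ _ _ ih
  let c : ℕ → ℝ → ℝ := fun k => match k with
    | 0 => 0
    | 1 => e
    | n + 2 => C (n + 2) (X n)
  have hsum : ∀ n, (fun q : ℝ × ℝ => ∑ k ∈ Finset.range (n + 2), c k q.1 * q.2 ^ k) = X n := by
    intro n
    induction n with
    | zero =>
      funext q
      simp [Finset.sum_range_succ, c, X]
    | succ n ih =>
      funext q
      rw [Finset.sum_range_succ, show ∑ k ∈ Finset.range (n + 2), c k q.1 * q.2 ^ k = X n q from
        congrFun ih q]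
  refine ⟨c, fun k => ?_, rfl, hepos, fun m hm => ?_⟩
  · match k with
    | 0 => exact contDiffOn_const
    | 1 => exact he
    | n + 2 => exact hC _ _ (hX n)
  · obtain ⟨n, rfl⟩ := Nat.exists_eq_add_of_le' hm
    rw [hsum n]
    exact hX n

theorem IsAxisData.exists_formal_integral (hab : a < b) (h : IsAxisData a b N f g)
    (hG : ∀ p ∈ N, (axisMap f g p).1 ∈ Ioo a b)
    (hrev : ∀ p ∈ N, reflAxis (axisMap f g p) ∈ N →
      axisMap f g (reflAxis (axisMap f g p)) = reflAxis p) :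
    ∃ H : ℝ × ℝ → ℝ, ContDiffOn ℝ ∞ H (Ioo a b ×ˢ univ) ∧
      (∀ s ∈ Ioo a b, H (s, 0) = 0) ∧ (∀ s ∈ Ioo a b, ∃ d > 0, HasDerivAt (fun y => H (s, y)) d 0) ∧
      ∀ m : ℕ, ∃ S : ℝ × ℝ → ℝ, ContDiffOn ℝ ∞ S N ∧
        ∀ p ∈ N, axisIncr f g H p = p.2 ^ m * S p := by
  obtain ⟨c, hc, hc0, hc1, hcE⟩ := h.exists_formal_coeff hG hrev
  obtain ⟨H, hH⟩ := exists_smooth_with_taylor_coeff hab hc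
  have hopen : IsOpen (Ioo a b ×ˢ (univ : Set ℝ)) := isOpen_Ioo.prod isOpen_univ
  have hdiv : ∃ S : ℝ × ℝ → ℝ, ContDiffOn ℝ ∞ S (Ioo a b ×ˢ univ) ∧
      ∀ p ∈ Ioo a b ×ˢ (univ : Set ℝ), H p = p.2 * S p ∧ S (p.1, 0) = c 1 p.1 := by
    obtain ⟨S, hS, hHS⟩ := hH 2
    refine ⟨fun p => c 1 p.1 + p.2 * S p,
      ((hc 1).comp contDiffOn_fst fun p hp => hp.1).add (contDiffOn_snd.mul hS), fun p hp => ⟨?_, ?_⟩⟩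
    · rw [hHS p hp]
      simp [Finset.sum_range_succ, hc0]
      ring
    · simp
  obtain ⟨S, hS, hHS⟩ := hdiv
  refine ⟨H, ?_, fun s hs => ?_, fun s hs => ⟨c 1 s, hc1 s, ?_⟩, fun m => ?_⟩
  · exact (contDiffOn_snd.mul hS).congr fun p hp => (hHS p hp).1
  · simpa using (hHS (s, 0) ⟨hs, mem_univ _⟩).1
  · have hs' : (s, (0 : ℝ)) ∈ Ioo a b ×ˢ (univ : Set ℝ) := ⟨hs, mem_univ _⟩
    have := hasDerivAt_of_eq_snd_mul hopen hs' hS.continuousOn fun p hp => (hHS p hp).1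
    rwa [(hHS _ hs').2] at this
  · obtain ⟨r, hr, hrE⟩ := hcE (m + 2) (by omega)
    obtain ⟨S, hS, hHS⟩ := hH (m + 2)
    refine ⟨fun p => p.2 ^ (m + 4) * (r p +
        Real.exp (p.2 * g p) ^ (2 * (m + 2)) *
          S ((axisMap f g p).1, (axisMap f g p).2 ^ 2) - S (p.1, p.2 ^ 2)), ?_, fun p hp => ?_⟩
    · refine (contDiffOn_snd.pow _).mul ((hr.add (ContDiffOn.mul ?_ ?_)).sub ?_)
      · exact (contDiffOn_snd.mul h.smooth_g).exp.pow _
      · exact hS.comp (h.smooth_map_fst.prodMk (h.smooth_map_snd.pow 2))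
          fun p hp => ⟨hG p hp, mem_univ _⟩
      · exact hS.comp (contDiffOn_fst.prodMk (contDiffOn_snd.pow 2))
          fun p hp => ⟨h.fst_mem p hp, mem_univ _⟩
    · have e1 := hrE p hp
      have e2 := hHS ((axisMap f g p).1, (axisMap f g p).2 ^ 2) ⟨hG p hp, mem_univ _⟩
      have e3 := hHS (p.1, p.2 ^ 2) ⟨h.fst_mem p hp, mem_univ _⟩
      have e4 : ((axisMap f g p).2 ^ 2) ^ (m + 2) =
          p.2 ^ (2 * (m + 2)) * Real.exp (p.2 * g p) ^ (2 * (m + 2)) := by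
        rw [← pow_mul, ← mul_pow]; rfl
      simp only at e2 e3
      rw [e4] at e2
      simp only [axisIncr] at e1 ⊢
      rw [e2, e3]
      linear_combination e1

end Formal

section IteratedBounds

variable {D E F G : Type} [NormedAddCommGroup D] [NormedSpace ℝ D] [NormedAddCommGroup E]
  [NormedSpace ℝ E] [NormedAddCommGroup F] [NormedSpace ℝ F] [NormedAddCommGroup G]
  [NormedSpace ℝ G]

theorem ContinuousLinearMap.norm_iteratedFDeriv_le_of_bilinear_of_contDiffAt
    (B : E →L[ℝ] F →L[ℝ] G) {f : D → E} {g : D → F} {x : D} (hf : ContDiffAt ℝ ∞ f x)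
    (hg : ContDiffAt ℝ ∞ g x) (n : ℕ) :
    ‖iteratedFDeriv ℝ n (fun y => B (f y) (g y)) x‖ ≤
      ‖B‖ * ∑ i ∈ Finset.range (n + 1), (n.choose i : ℝ) * ‖iteratedFDeriv ℝ i f x‖ *
        ‖iteratedFDeriv ℝ (n - i) g x‖ := by
  obtain ⟨u, hu, hfu⟩ := hf.contDiffOn (m := n) (by exact_mod_cast le_top) (by simp)
  obtain ⟨v, hv, hgv⟩ := hg.contDiffOn (m := n) (by exact_mod_cast le_top) (by simp)
  obtain ⟨t, ht, hto, hxt⟩ := mem_nhds_iff.1 (Filter.inter_mem hu hv)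
  have := B.norm_iteratedFDerivWithin_le_of_bilinear (hfu.mono (ht.trans inter_subset_left))
    (hgv.mono (ht.trans inter_subset_right)) hto.uniqueDiffOn hxt (n := n) le_rfl
  simpa only [iteratedFDerivWithin_of_isOpen _ hto hxt] using this

/-- The sum of the norms of the derivatives of order at most `k`. -/
noncomputable def jetNorm (k : ℕ) (v : E → F) (p : E) : ℝ :=
  ∑ i ∈ Finset.range (k + 1), ‖iteratedFDeriv ℝ i v p‖

theorem jetNorm_nonneg (k : ℕ) (v : E → F) (p : E) : 0 ≤ jetNorm k v p :=
  Finset.sum_nonneg fun _ _ => norm_nonneg _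

theorem norm_iteratedFDeriv_le_jetNorm {k j : ℕ} (h : j ≤ k) (v : E → F) (p : E) :
    ‖iteratedFDeriv ℝ j v p‖ ≤ jetNorm k v p :=
  Finset.single_le_sum (f := fun i => ‖iteratedFDeriv ℝ i v p‖) (fun _ _ => norm_nonneg _)
    (by simp; omega)

theorem jetNorm_fderiv_le (k : ℕ) (v : E → F) (p : E) :
    jetNorm k (fderiv ℝ v) p ≤ jetNorm (k + 1) v p := by
  simp only [jetNorm, norm_iteratedFDeriv_fderiv]
  rw [Finset.sum_range_succ' _ (k + 1)]
  simp

theorem exists_norm_iteratedFDeriv_comp_id_add_le (k : ℕ) {M : ℝ} (hM : 0 ≤ M) :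
    ∃ K : ℝ, 0 ≤ K ∧ ∀ {F : Type} [NormedAddCommGroup F] [NormedSpace ℝ F] (v : E → F)
      (R : E → E) (p : E) (ε : ℝ), 0 ≤ ε → ε ≤ M → ContDiffAt ℝ ∞ v (p + R p) →
      ContDiffAt ℝ ∞ R p → (∀ j ≤ k, ‖iteratedFDeriv ℝ j R p‖ ≤ ε) → ∀ j ≤ k,
      ‖iteratedFDeriv ℝ j (fun x => v (x + R x)) p‖ ≤
        ‖iteratedFDeriv ℝ j v (p + R p)‖ + K * ε * jetNorm k v (p + R p) := by
  induction k with
  | zero =>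
    refine ⟨0, le_rfl, fun v R p ε _ _ _ _ _ j hj => ?_⟩
    obtain rfl : j = 0 := by omega
    simp
  | succ k ih =>
    obtain ⟨K, hK, ih⟩ := ih
    refine ⟨K + 2 ^ k * (1 + K * M), by positivity, ?_⟩
    intro F _ _ v R p ε hε hεM hv hR hRb j hj
    have hJ : 0 ≤ jetNorm (k + 1) v (p + R p) := jetNorm_nonneg _ _ _
    match j with
    | 0 =>
      simp only [norm_iteratedFDeriv_zero]
      have : 0 ≤ (K + 2 ^ k * (1 + K * M)) * ε * jetNorm (k + 1) v (p + R p) := by positivity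
      linarith
    | j + 1 =>
      have hjk : j ≤ k := by omega
      have hvD : ContDiffAt ℝ ∞ (fderiv ℝ v) (p + R p) := hv.fderiv_right (by simp)
      have hRD : ContDiffAt ℝ ∞ (fderiv ℝ R) p := hR.fderiv_right (by simp)
      have hid : ContDiffAt ℝ ∞ (fun x => x + R x) p := contDiffAt_id.add hR
      have hcomp : ContDiffAt ℝ ∞ (fun x => fderiv ℝ v (x + R x)) p :=
        ContDiffAt.comp p (g := fderiv ℝ v) (f := fun x => x + R x) hvD hid
      have hev : fderiv ℝ (fun x => v (x + R x)) =ᶠ[𝓝 p] fun x =>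
          fderiv ℝ v (x + R x) + ContinuousLinearMap.compL ℝ E E F (fderiv ℝ v (x + R x))
            (fderiv ℝ R x) := by
        have h1 : ∀ᶠ y in 𝓝 (p + R p), ContDiffAt ℝ 1 v y :=
          (hv.of_le (by exact_mod_cast le_top)).eventually (by simp)
        have h2 : ∀ᶠ y in 𝓝 p, ContDiffAt ℝ 1 R y :=
          (hR.of_le (by exact_mod_cast le_top)).eventually (by simp)
        filter_upwards [hid.continuousAt.eventually h1, h2] with x hx1 hx2
        have e1 := (hx1.differentiableAt one_ne_zero).hasFDerivAt
        have e2 := (hx2.differentiableAt one_ne_zero).hasFDerivAt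
        have e3 : HasFDerivAt (fun x => v (x + R x)) _ x :=
          e1.comp x ((hasFDerivAt_id x).add e2)
        rw [e3.fderiv]
        ext y
        simp
      have hprod : ContDiffAt ℝ ∞ (fun x => ContinuousLinearMap.compL ℝ E E F
          (fderiv ℝ v (x + R x)) (fderiv ℝ R x)) p := hcomp.clm_comp hRD
      rw [← norm_iteratedFDeriv_fderiv, (hev.iteratedFDeriv ℝ j).eq_of_nhds,
        fun_iteratedFDeriv_add_apply (hcomp.of_le (by exact_mod_cast le_top))
          (hprod.of_le (by exact_mod_cast le_top))]
      have hRb' : ∀ i ≤ k, ‖iteratedFDeriv ℝ i R p‖ ≤ ε := fun i hi => hRb i (by omega)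
      have hIH := ih (fderiv ℝ v) R p ε hε hεM hvD hR hRb'
      have hΦ := jetNorm_fderiv_le k v (p + R p)
      have hΦ0 := jetNorm_nonneg k (fderiv ℝ v) (p + R p)
      have h1 := hIH j hjk
      rw [norm_iteratedFDeriv_fderiv] at h1
      have h2 := (ContinuousLinearMap.compL ℝ E E F).norm_iteratedFDeriv_le_of_bilinear_of_contDiffAt
        hcomp hRD j
      have h3 : ∑ i ∈ Finset.range (j + 1), (j.choose i : ℝ) *
          ‖iteratedFDeriv ℝ i (fun x => fderiv ℝ v (x + R x)) p‖ *
          ‖iteratedFDeriv ℝ (j - i) (fderiv ℝ R) p‖ ≤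
          ∑ i ∈ Finset.range (j + 1), (j.choose i : ℝ) *
            ((1 + K * M) * jetNorm (k + 1) v (p + R p) * ε) := by
        refine Finset.sum_le_sum fun i hi => ?_
        have hi' : i ≤ k := by simp at hi; omega
        rw [mul_assoc]
        refine mul_le_mul_of_nonneg_left ?_ (by positivity)
        refine mul_le_mul ?_ ?_ (norm_nonneg _) (by positivity)
        · refine (hIH i hi').trans ?_
          have e1 := norm_iteratedFDeriv_le_jetNorm hi' (fderiv ℝ v) (p + R p)
          have e2 : K * ε * jetNorm k (fderiv ℝ v) (p + R p) ≤
              K * M * jetNorm (k + 1) v (p + R p) := by gcongr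
          linarith
        · rw [norm_iteratedFDeriv_fderiv]
          exact hRb _ (by omega)
      rw [← Finset.sum_mul, ← Nat.cast_sum, Nat.sum_range_choose] at h3
      have h4 : ((2 ^ j : ℕ) : ℝ) * ((1 + K * M) * jetNorm (k + 1) v (p + R p) * ε) ≤
          2 ^ k * ((1 + K * M) * jetNorm (k + 1) v (p + R p) * ε) := by
        push_cast
        gcongr
        norm_num
      have h5 := ContinuousLinearMap.norm_compL_le ℝ E E F
      have h6 := h2.trans (mul_le_of_le_one_left (by positivity) h5)
      have h7 : K * ε * jetNorm k (fderiv ℝ v) (p + R p) ≤ K * ε * jetNorm (k + 1) v (p + R p) := by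
        gcongr
      refine (norm_add_le _ _).trans ?_
      have h8 := h6.trans (h3.trans h4)
      refine (add_le_add h1 h8).trans ?_
      linarith

theorem exists_jetNorm_comp_id_add_le (k : ℕ) {M : ℝ} (hM : 0 ≤ M) :
    ∃ K : ℝ, 0 ≤ K ∧ ∀ (v : E → F) (R : E → E) (p : E) (ε : ℝ), 0 ≤ ε → ε ≤ M →
      ContDiffAt ℝ ∞ v (p + R p) → ContDiffAt ℝ ∞ R p →
      (∀ j ≤ k, ‖iteratedFDeriv ℝ j R p‖ ≤ ε) →
      jetNorm k (fun x => v (x + R x)) p ≤ (1 + K * ε) * jetNorm k v (p + R p) := by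
  obtain ⟨K, hK, h⟩ := exists_norm_iteratedFDeriv_comp_id_add_le (E := E) k hM
  refine ⟨(k + 1 : ℕ) * K, by positivity, fun v R p ε h0 h1 h2 h3 h4 => ?_⟩
  have := Finset.sum_le_sum fun j (hj : j ∈ Finset.range (k + 1)) =>
    h v R p ε h0 h1 h2 h3 h4 j (by simp at hj; omega)
  rw [Finset.sum_add_distrib, Finset.sum_const, Finset.card_range, nsmul_eq_mul] at this
  refine this.trans (le_of_eq ?_)
  rw [← jetNorm]
  ring

end IteratedBounds

section LogBounds

variable {F G : Type} [NormedAddCommGroup F] [NormedSpace ℝ F] [NormedAddCommGroup G]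
  [NormedSpace ℝ G]

/-- Smooth functions on `U` all of whose derivatives are `O(exp (m ζ))`, `ζ` being the second
coordinate. -/
def LogBdd (m : ℝ) (U : Set (ℝ × ℝ)) (v : ℝ × ℝ → F) : Prop :=
  ContDiffOn ℝ ∞ v U ∧
    ∀ j : ℕ, ∃ C : ℝ, 0 ≤ C ∧ ∀ p ∈ U, ‖iteratedFDeriv ℝ j v p‖ ≤ C * Real.exp (m * p.2)

variable {U : Set (ℝ × ℝ)} {m n : ℝ} {v v' : ℝ × ℝ → F}

theorem LogBdd.mono_set {U' : Set (ℝ × ℝ)} (h : LogBdd m U v) (hU : U' ⊆ U) : LogBdd m U' v :=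
  ⟨h.1.mono hU, fun j => let ⟨C, hC, hb⟩ := h.2 j; ⟨C, hC, fun p hp => hb p (hU hp)⟩⟩

theorem LogBdd.fderiv (hU : IsOpen U) (h : LogBdd m U v) : LogBdd m U (fderiv ℝ v) :=
  ⟨h.1.fderiv_of_isOpen hU (by simp), fun j => by
    simpa only [norm_iteratedFDeriv_fderiv] using h.2 (j + 1)⟩

theorem LogBdd.clm (hU : IsOpen U) (L : F →L[ℝ] G) (h : LogBdd m U v) :
    LogBdd m U (fun p => L (v p)) := by
  refine ⟨L.contDiff.comp_contDiffOn h.1, fun j => ?_⟩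
  obtain ⟨C, hC, hb⟩ := h.2 j
  refine ⟨‖L‖ * C, by positivity, fun p hp => ?_⟩
  have := L.norm_iteratedFDeriv_comp_left (n := j) (h.1.contDiffAt (hU.mem_nhds hp))
    (by exact_mod_cast le_top)
  refine this.trans ?_
  rw [mul_assoc]
  exact mul_le_mul_of_nonneg_left (hb p hp) (norm_nonneg _)

theorem LogBdd.add (hU : IsOpen U) (h : LogBdd m U v) (h' : LogBdd m U v') :
    LogBdd m U (fun p => v p + v' p) := by
  refine ⟨h.1.add h'.1, fun j => ?_⟩
  obtain ⟨C, hC, hb⟩ := h.2 j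
  obtain ⟨C', hC', hb'⟩ := h'.2 j
  refine ⟨C + C', by positivity, fun p hp => ?_⟩
  rw [fun_iteratedFDeriv_add_apply
    ((h.1.contDiffAt (hU.mem_nhds hp)).of_le (by exact_mod_cast le_top))
    ((h'.1.contDiffAt (hU.mem_nhds hp)).of_le (by exact_mod_cast le_top)), add_mul]
  exact (norm_add_le _ _).trans (add_le_add (hb p hp) (hb' p hp))

theorem LogBdd.smul (hU : IsOpen U) {φ : ℝ × ℝ → ℝ} (hφ : LogBdd m U φ) (h : LogBdd n U v) :
    LogBdd (m + n) U (fun p => φ p • v p) := by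
  refine ⟨hφ.1.smul h.1, fun j => ?_⟩
  choose C hC hb using hφ.2
  choose C' hC' hb' using h.2
  refine ⟨‖ContinuousLinearMap.lsmul ℝ ℝ (E := F)‖ *
    ∑ i ∈ Finset.range (j + 1), (j.choose i : ℝ) * C i * C' (j - i),
    mul_nonneg (norm_nonneg _) (Finset.sum_nonneg fun i _ =>
      mul_nonneg (mul_nonneg (by positivity) (hC _)) (hC' _)), fun p hp => ?_⟩
  have := (ContinuousLinearMap.lsmul ℝ ℝ (E := F)).norm_iteratedFDeriv_le_of_bilinear_of_contDiffAt
    (hφ.1.contDiffAt (hU.mem_nhds hp)) (h.1.contDiffAt (hU.mem_nhds hp)) j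
  refine this.trans ?_
  rw [mul_assoc, Finset.sum_mul]
  refine mul_le_mul_of_nonneg_left (Finset.sum_le_sum fun i _ => ?_) (by positivity)
  have e : Real.exp ((m + n) * p.2) = Real.exp (m * p.2) * Real.exp (n * p.2) := by
    rw [← Real.exp_add]; ring_nf
  calc _ ≤ (j.choose i : ℝ) * (C i * Real.exp (m * p.2)) * (C' (j - i) * Real.exp (n * p.2)) := by
        gcongr
        · exact mul_nonneg (by positivity) (mul_nonneg (hC i) (Real.exp_pos _).le)
        · exact hb i p hp
        · exact hb' _ p hp
    _ = _ := by rw [e]; ring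

theorem exists_norm_iteratedFDeriv_exp_smul_le (m : ℝ) (j : ℕ) :
    ∀ {F : Type} [NormedAddCommGroup F] [NormedSpace ℝ F] (c : F), ∃ C : ℝ, 0 ≤ C ∧
      ∀ p : ℝ × ℝ, ‖iteratedFDeriv ℝ j (fun p : ℝ × ℝ => Real.exp (m * p.2) • c) p‖ ≤
        C * Real.exp (m * p.2) := by
  induction j with
  | zero =>
    intro F _ _ c
    refine ⟨‖c‖, norm_nonneg _, fun p => ?_⟩
    rw [norm_iteratedFDeriv_zero, norm_smul, Real.norm_eq_abs, Real.abs_exp, mul_comm]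
  | succ j ih =>
    intro F _ _ c
    obtain ⟨C, hC, hb⟩ := ih ((m • ContinuousLinearMap.snd ℝ ℝ ℝ).smulRight c)
    refine ⟨C, hC, fun p => ?_⟩
    rw [← norm_iteratedFDeriv_fderiv]
    convert hb p using 4 with q
    have h1 : HasFDerivAt (fun p : ℝ × ℝ => m * p.2) (m • ContinuousLinearMap.snd ℝ ℝ ℝ) q :=
      (hasFDerivAt_snd (p := q)).const_mul m
    rw [(h1.exp.smul_const c).fderiv]
    ext <;> simp [mul_smul]

theorem LogBdd.exp_smul_const (m : ℝ) (U : Set (ℝ × ℝ)) (c : F) :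
    LogBdd m U (fun p => Real.exp (m * p.2) • c) := by
  refine ⟨ContDiff.contDiffOn (by fun_prop), fun j => ?_⟩
  obtain ⟨C, hC, hb⟩ := exists_norm_iteratedFDeriv_exp_smul_le m j c
  exact ⟨C, hC, fun p _ => hb p⟩

theorem LogBdd.exp (m : ℝ) (U : Set (ℝ × ℝ)) : LogBdd m U (fun p => Real.exp (m * p.2)) := by
  simpa using LogBdd.exp_smul_const m U (1 : ℝ)

/-- The coordinate change `(s, ζ) ↦ (s, exp ζ)`. -/
noncomputable def expMap (p : ℝ × ℝ) : ℝ × ℝ := (p.1, Real.exp p.2)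

theorem contDiff_expMap : ContDiff ℝ ∞ expMap := by unfold expMap; fun_prop

theorem exists_norm_iteratedFDeriv_expMap_le (j : ℕ) :
    ∃ C : ℝ, 0 ≤ C ∧ ∀ p : ℝ × ℝ, p.2 ≤ 0 → ‖iteratedFDeriv ℝ (j + 1) expMap p‖ ≤ C := by
  obtain ⟨C, hC, hb⟩ := exists_norm_iteratedFDeriv_exp_smul_le 1 (j + 1) ((0, 1) : ℝ × ℝ)
  set L : ℝ × ℝ →L[ℝ] ℝ × ℝ :=
    (ContinuousLinearMap.inl ℝ ℝ ℝ).comp (ContinuousLinearMap.fst ℝ ℝ ℝ) with hL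
  have hE : expMap = fun p => L p + Real.exp (1 * p.2) • ((0, 1) : ℝ × ℝ) := by
    funext p
    simp [expMap, hL]
  refine ⟨‖L‖ + C, by positivity, fun p hp => ?_⟩
  rw [hE, fun_iteratedFDeriv_add_apply L.contDiff.contDiffAt
    (ContDiff.contDiffAt (by fun_prop))]
  refine (norm_add_le _ _).trans (add_le_add ?_ ?_)
  · rw [← norm_iteratedFDeriv_fderiv]
    have : fderiv ℝ (fun p => L p) = fun _ => L := by funext x; exact L.fderiv
    rw [this]
    cases j with
    | zero => simp
    | succ j => simp [iteratedFDeriv_succ_const]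
  · refine (hb p).trans (mul_le_of_le_one_right hC ?_)
    simpa using hp

theorem LogBdd.comp_expMap {N : Set (ℝ × ℝ)} (hN : IsOpen N) (hU : IsOpen U) {K : Set (ℝ × ℝ)}
    (hK : IsCompact K) (hKN : K ⊆ N) (hUK : ∀ p ∈ U, expMap p ∈ K) (hU0 : ∀ p ∈ U, p.2 ≤ 0)
    {q : ℝ × ℝ → F} (hq : ContDiffOn ℝ ∞ q N) : LogBdd 0 U (fun p => q (expMap p)) := by
  have hmaps : MapsTo expMap U N := fun p hp => hKN (hUK p hp)
  refine ⟨hq.comp contDiff_expMap.contDiffOn hmaps, fun j => ?_⟩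
  have hqb : ∀ i : ℕ, ∃ C : ℝ, 0 ≤ C ∧ ∀ p ∈ K, ‖iteratedFDerivWithin ℝ i q N p‖ ≤ C := by
    intro i
    obtain ⟨C, hC⟩ := hK.exists_bound_of_continuousOn
      ((hq.continuousOn_iteratedFDerivWithin (m := i) (by exact_mod_cast le_top)
        hN.uniqueDiffOn).mono hKN)
    exact ⟨max C 0, le_max_right _ _, fun p hp => (hC p hp).trans (le_max_left _ _)⟩
  choose Q hQ hQb using hqb
  choose D hD hDb using exists_norm_iteratedFDeriv_expMap_le
  set C := ∑ i ∈ Finset.range (j + 1), Q i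
  set M := 1 + ∑ i ∈ Finset.range j, D i with hM
  have hM1 : 1 ≤ M := le_add_of_nonneg_right (Finset.sum_nonneg fun i _ => hD i)
  have hC0 : 0 ≤ C := Finset.sum_nonneg fun i _ => hQ i
  refine ⟨j.factorial * C * M ^ j, by positivity, fun p hp => ?_⟩
  rw [zero_mul, Real.exp_zero, mul_one, ← iteratedFDerivWithin_of_isOpen _ hU hp]
  refine norm_iteratedFDerivWithin_comp_le (g := q) (f := expMap) (N := ∞) hq contDiff_expMap.contDiffOn
    (by exact_mod_cast le_top) hN.uniqueDiffOn hU.uniqueDiffOn hmaps hp (fun i hi => ?_)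
    (fun i hi1 hi => ?_)
  · exact (hQb i _ (hUK p hp)).trans
      (Finset.single_le_sum (f := Q) (fun i _ => hQ i) (by simp; omega))
  · obtain ⟨k, rfl⟩ := Nat.exists_eq_add_of_le' hi1
    rw [iteratedFDerivWithin_of_isOpen _ hU hp]
    refine (hDb k p (hU0 p hp)).trans ?_
    have h1 : D k ≤ M := by
      have := Finset.single_le_sum (f := D) (fun i _ => hD i)
        (show k ∈ Finset.range j by simp; omega)
      linarith
    exact h1.trans (le_self_pow₀ hM1 (by omega))

end LogBounds

section LogDrift

theorem LogBdd.exists_jetNorm_le {F : Type} [NormedAddCommGroup F] [NormedSpace ℝ F] {m : ℝ}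
    {U : Set (ℝ × ℝ)} {v : ℝ × ℝ → F} (h : LogBdd m U v) (k : ℕ) :
    ∃ C : ℝ, 0 ≤ C ∧ ∀ p ∈ U, jetNorm k v p ≤ C * Real.exp (m * p.2) := by
  choose C hC hb using h.2
  refine ⟨∑ i ∈ Finset.range (k + 1), C i, Finset.sum_nonneg fun i _ => hC i, fun p hp => ?_⟩
  rw [Finset.sum_mul]
  exact Finset.sum_le_sum fun i _ => hb i p hp

/-- A displacement `R` of size comparable to `exp ζ`, moving points in the positive direction,
on the half-strip `(α, β) × (-∞, ζ₀)`. -/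
structure IsLogDrift (α c β ζ₀ c₁ C₀ : ℝ) (R : ℝ × ℝ → ℝ × ℝ) : Prop where
  left_lt : α < c
  lt_right : c < β
  nonpos : ζ₀ ≤ 0
  bdd : LogBdd 1 (Ioo α β ×ˢ Iio ζ₀) R
  pos : 0 < c₁
  drift : ∀ p ∈ Ioo α β ×ˢ Iio ζ₀, c₁ * Real.exp p.2 ≤ (R p).1
  norm_le : ∀ p ∈ Ioo α β ×ˢ Iio ζ₀, ‖R p‖ ≤ C₀ * Real.exp p.2
  nonneg : 0 ≤ C₀
  small : C₀ * Real.exp ζ₀ ≤ β - c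

/-- The region on which orbits of a drift are controlled. -/
def driftRegion (α β ζ₀ κ : ℝ) : Set (ℝ × ℝ) := {p | p.1 ∈ Ioo α β ∧ p.2 + κ * (β - p.1) < ζ₀}

theorem isOpen_driftRegion (α β ζ₀ κ : ℝ) : IsOpen (driftRegion α β ζ₀ κ) :=
  (isOpen_Ioo.preimage continuous_fst).inter (isOpen_lt
    (by fun_prop : Continuous fun p : ℝ × ℝ => p.2 + κ * (β - p.1)) continuous_const)

/-- One step of a drift, frozen to the right of `c`. -/
noncomputable def driftStep (c : ℝ) (R : ℝ × ℝ → ℝ × ℝ) (p : ℝ × ℝ) : ℝ × ℝ :=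
  if c < p.1 then p else p + R p

/-- The sum of `ψ` along the orbit of a drift, up to the passage to the right of `c`. -/
noncomputable def driftSum (c : ℝ) (R : ℝ × ℝ → ℝ × ℝ) (ψ : ℝ × ℝ → ℝ) (p : ℝ × ℝ) : ℝ :=
  ∑' n : ℕ, if c < ((driftStep c R)^[n] p).1 then 0 else ψ ((driftStep c R)^[n] p)

variable {α c β ζ₀ c₁ C₀ : ℝ} {R : ℝ × ℝ → ℝ × ℝ} {ψ : ℝ × ℝ → ℝ}

theorem iterate_driftStep_of_lt {p : ℝ × ℝ} (hp : c < p.1) (n : ℕ) :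
    (driftStep c R)^[n] p = p :=
  Function.iterate_fixed (by simp [driftStep, hp]) n

theorem driftSum_of_lt {p : ℝ × ℝ} (hp : c < p.1) : driftSum c R ψ p = 0 := by
  simp [driftSum, iterate_driftStep_of_lt hp, hp]

namespace IsLogDrift

theorem driftRegion_subset (h : IsLogDrift α c β ζ₀ c₁ C₀ R) :
    driftRegion α β ζ₀ (C₀ / c₁) ⊆ Ioo α β ×ˢ Iio ζ₀ := by
  rintro p ⟨hp1, hp2⟩
  refine ⟨hp1, ?_⟩
  have : 0 ≤ C₀ / c₁ * (β - p.1) :=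
    mul_nonneg (div_nonneg h.nonneg h.pos.le) (by linarith [hp1.2])
  simp only [mem_Iio]
  linarith

theorem abs_le (h : IsLogDrift α c β ζ₀ c₁ C₀ R) {p : ℝ × ℝ}
    (hp : p ∈ driftRegion α β ζ₀ (C₀ / c₁)) :
    |(R p).1| ≤ C₀ * Real.exp p.2 ∧ |(R p).2| ≤ C₀ * Real.exp p.2 :=
  ⟨(norm_fst_le (R p)).trans (h.norm_le p (h.driftRegion_subset hp)),
    (norm_snd_le (R p)).trans (h.norm_le p (h.driftRegion_subset hp))⟩

theorem step_weight (h : IsLogDrift α c β ζ₀ c₁ C₀ R) {p : ℝ × ℝ}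
    (hp : p ∈ driftRegion α β ζ₀ (C₀ / c₁)) :
    |(R p).2| ≤ C₀ / c₁ * (R p).1 := by
  have h1 := (h.abs_le hp).2
  have h2 := h.drift p (h.driftRegion_subset hp)
  have h3 : C₀ / c₁ * (c₁ * Real.exp p.2) ≤ C₀ / c₁ * (R p).1 :=
    mul_le_mul_of_nonneg_left h2 (div_nonneg h.nonneg h.pos.le)
  have h4 : C₀ / c₁ * (c₁ * Real.exp p.2) = C₀ * Real.exp p.2 := by
    have := h.pos.ne'
    field_simp
  linarith

theorem add_mem (h : IsLogDrift α c β ζ₀ c₁ C₀ R) {p : ℝ × ℝ}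
    (hp : p ∈ driftRegion α β ζ₀ (C₀ / c₁)) (hpc : p.1 ≤ c) :
    p + R p ∈ driftRegion α β ζ₀ (C₀ / c₁) := by
  have hU := h.driftRegion_subset hp
  have h1 := h.drift p hU
  have h2 := h.abs_le hp
  have h3 := h.step_weight hp
  have h4 : 0 < c₁ * Real.exp p.2 := mul_pos h.pos (Real.exp_pos _)
  have h5 : C₀ * Real.exp p.2 ≤ C₀ * Real.exp ζ₀ :=
    mul_le_mul_of_nonneg_left (Real.exp_le_exp.2 hU.2.le) h.nonneg
  have h6 : (R p).1 < β - p.1 := by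
    rcases h.nonneg.eq_or_lt with h0 | h0
    · have := (_root_.abs_le.1 h2.1).2
      rw [← h0, zero_mul] at this
      linarith [h.lt_right]
    · have h7 : C₀ * Real.exp p.2 < C₀ * Real.exp ζ₀ :=
        mul_lt_mul_of_pos_left (Real.exp_lt_exp.2 hU.2) h0
      linarith [(_root_.abs_le.1 h2.1).2, h.small]
  have h7 := (_root_.abs_le.1 h3).2
  refine ⟨⟨?_, ?_⟩, ?_⟩
  · simp only [Prod.fst_add]; linarith [hU.1.1]
  · simp only [Prod.fst_add]; linarith
  · have := hp.2
    simp only [Prod.fst_add, Prod.snd_add]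
    linear_combination this + h7

/-- Properties propagate backwards along the orbits, which all pass to the right of `c`. -/
theorem orbit_induction (h : IsLogDrift α c β ζ₀ c₁ C₀ R) {Q : ℝ × ℝ → Prop}
    (hQ : ∀ p ∈ driftRegion α β ζ₀ (C₀ / c₁),
      (p.1 ≤ c → p + R p ∈ driftRegion α β ζ₀ (C₀ / c₁) → Q (p + R p)) → Q p) :
    ∀ p ∈ driftRegion α β ζ₀ (C₀ / c₁), Q p := by
  set δ : ℝ × ℝ → ℝ := fun p => c₁ * Real.exp (p.2 + C₀ / c₁ * (p.1 - β)) with hδ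
  have hδpos : ∀ p, 0 < δ p := fun p => mul_pos h.pos (Real.exp_pos _)
  have key : ∀ n : ℕ, ∀ p ∈ driftRegion α β ζ₀ (C₀ / c₁), c - p.1 < n * δ p → Q p := by
    intro n
    induction n with
    | zero =>
      intro p hp hn
      refine hQ p hp fun hpc => ?_
      simp only [Nat.cast_zero, zero_mul] at hn
      linarith
    | succ n ih =>
      intro p hp hn
      refine hQ p hp fun hpc hq => ih _ hq ?_
      have h1 := h.drift p (h.driftRegion_subset hp)
      have h2 := (_root_.abs_le.1 (h.step_weight hp)).1
      have h3 : δ p ≤ c₁ * Real.exp p.2 := by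
        refine mul_le_mul_of_nonneg_left (Real.exp_le_exp.2 ?_) h.pos.le
        have : 0 ≤ C₀ / c₁ * (β - p.1) :=
          mul_nonneg (div_nonneg h.nonneg h.pos.le) (by linarith [hp.1.2])
        linarith
      have h4 : δ p ≤ δ (p + R p) := by
        refine mul_le_mul_of_nonneg_left (Real.exp_le_exp.2 ?_) h.pos.le
        simp only [Prod.fst_add, Prod.snd_add]
        linear_combination h2
      have h5 : (n : ℝ) * δ p ≤ n * δ (p + R p) := mul_le_mul_of_nonneg_left h4 (by positivity)
      push_cast at hn
      simp only [Prod.fst_add]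
      linarith
  intro p hp
  obtain ⟨n, hn⟩ := exists_nat_gt ((c - p.1) / δ p)
  exact key n p hp ((div_lt_iff₀ (hδpos p)).1 hn)

theorem driftSum_eq (h : IsLogDrift α c β ζ₀ c₁ C₀ R)
    (hψ : ∀ p ∈ Ioo α β ×ˢ Iio ζ₀, c < p.1 → ψ p = 0) {p : ℝ × ℝ}
    (hp : p ∈ driftRegion α β ζ₀ (C₀ / c₁)) :
    driftSum c R ψ p = ψ p + driftSum c R ψ (p + R p) := by
  set T := driftStep c R with hT
  set s : ℝ × ℝ → ℕ → ℝ := fun p n => if c < (T^[n] p).1 then 0 else ψ (T^[n] p) with hs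
  have hsucc : ∀ p n, s p (n + 1) = s (T p) n := fun p n => rfl
  have hsum : ∀ p ∈ driftRegion α β ζ₀ (C₀ / c₁), Summable (s p) := by
    refine h.orbit_induction fun p hp ih => ?_
    rcases lt_or_ge c p.1 with hpc | hpc
    · have : s p = fun _ => 0 := by
        funext n
        simp [hs, hT, iterate_driftStep_of_lt hpc, hpc]
      rw [this]
      exact summable_zero
    · rw [← summable_nat_add_iff 1]
      have : T p = p + R p := by simp [hT, driftStep, not_lt.2 hpc]
      simp only [hsucc, this]
      exact ih hpc (h.add_mem hp hpc)
  rcases lt_or_ge c p.1 with hpc | hpc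
  · have h1 := h.drift p (h.driftRegion_subset hp)
    have h2 : c < (p + R p).1 := by
      simp only [Prod.fst_add]
      have := mul_pos h.pos (Real.exp_pos p.2)
      linarith
    rw [driftSum_of_lt hpc, driftSum_of_lt h2, hψ p (h.driftRegion_subset hp) hpc, add_zero]
  · have hTp : T p = p + R p := by simp [hT, driftStep, not_lt.2 hpc]
    have e1 : driftSum c R ψ p = ∑' n, s p n := rfl
    have e2 : driftSum c R ψ (p + R p) = ∑' n, s (p + R p) n := rfl
    rw [e1, e2, (hsum p hp).tsum_eq_zero_add]
    simp only [hsucc, hTp]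
    congr 1
    simp [hs, not_lt.2 hpc]

theorem one_add_mul_exp_le {K x : ℝ} (hx0 : 0 ≤ x) (hx1 : x ≤ 1) :
    (1 + K * x) * Real.exp (-(K + 1) * x) ≤ 1 - x / 2 := by
  have h1 : 1 + K * x ≤ Real.exp (K * x) := by linarith [Real.add_one_le_exp (K * x)]
  have h2 : (1 + K * x) * Real.exp (-(K + 1) * x) ≤ Real.exp (-x) := by
    refine (mul_le_mul_of_nonneg_right h1 (Real.exp_pos _).le).trans (le_of_eq ?_)
    rw [← Real.exp_add]
    ring_nf
  have h3 : Real.exp (-x) ≤ 1 / (1 + x) := by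
    rw [Real.exp_neg, ← one_div]
    exact one_div_le_one_div_of_le (by linarith) (by linarith [Real.add_one_le_exp x])
  have h4 : 1 / (1 + x) ≤ 1 - x / 2 := by
    rw [div_le_iff₀ (by linarith)]
    nlinarith
  linarith

theorem contDiffAt_driftSum (h : IsLogDrift α c β ζ₀ c₁ C₀ R)
    (hψs : ContDiffOn ℝ ∞ ψ (Ioo α β ×ˢ Iio ζ₀))
    (hψ : ∀ p ∈ Ioo α β ×ˢ Iio ζ₀, c < p.1 → ψ p = 0) :
    ∀ p ∈ driftRegion α β ζ₀ (C₀ / c₁), ContDiffAt ℝ ∞ (driftSum c R ψ) p := by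
  have hUo : IsOpen (Ioo α β ×ˢ Iio ζ₀) := isOpen_Ioo.prod isOpen_Iio
  refine h.orbit_induction fun p hp ih => ?_
  have hpU := hUo.mem_nhds (h.driftRegion_subset hp)
  rcases lt_or_ge c p.1 with hpc | hpc
  · have : driftSum c R ψ =ᶠ[𝓝 p] fun _ => 0 := by
      filter_upwards [(isOpen_lt continuous_const continuous_fst).mem_nhds hpc] with q hq
      exact driftSum_of_lt hq
    exact contDiffAt_const.congr_of_eventuallyEq this
  · have : driftSum c R ψ =ᶠ[𝓝 p] fun q => ψ q + driftSum c R ψ (q + R q) := by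
      filter_upwards [(isOpen_driftRegion _ _ _ _).mem_nhds hp] with q hq
      exact h.driftSum_eq hψ hq
    refine ContDiffAt.congr_of_eventuallyEq ?_ this
    exact (hψs.contDiffAt hpU).add (ContDiffAt.comp p (g := driftSum c R ψ) (f := fun q => q + R q)
      (ih hpc (h.add_mem hp hpc)) (contDiffAt_id.add (h.bdd.1.contDiffAt hpU)))

theorem logBdd_driftSum (h : IsLogDrift α c β ζ₀ c₁ C₀ R)
    (hψb : ∀ m : ℝ, LogBdd m (Ioo α β ×ˢ Iio ζ₀) ψ)
    (hψ : ∀ p ∈ Ioo α β ×ˢ Iio ζ₀, c < p.1 → ψ p = 0) (m : ℝ) :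
    LogBdd m (driftRegion α β ζ₀ (C₀ / c₁)) (driftSum c R ψ) := by
  have hUo : IsOpen (Ioo α β ×ˢ Iio ζ₀) := isOpen_Ioo.prod isOpen_Iio
  have hsm := h.contDiffAt_driftSum (hψb 0).1 hψ
  refine ⟨fun p hp => (hsm p hp).contDiffWithinAt, fun k => ?_⟩
  obtain ⟨A₀, hA₀, hA₀b⟩ := (hψb (m + 1)).exists_jetNorm_le k
  obtain ⟨C, hC, hCb⟩ := h.bdd.exists_jetNorm_le k
  obtain ⟨K', hK', hKb⟩ := exists_jetNorm_comp_id_add_le (E := ℝ × ℝ) (F := ℝ) k hC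
  set K := K' * C with hK
  have hK0 : 0 ≤ K := mul_nonneg hK' hC
  set l := (|m| * C₀ + K + 1) / c₁ with hl
  have hl0 : 0 ≤ l := div_nonneg (by have := mul_nonneg (abs_nonneg m) h.nonneg; linarith) h.pos.le
  have hlc : l * c₁ = |m| * C₀ + K + 1 := div_mul_cancel₀ _ h.pos.ne'
  have key : ∀ p ∈ driftRegion α β ζ₀ (C₀ / c₁), jetNorm k (driftSum c R ψ) p ≤
      2 * A₀ * Real.exp (m * p.2 + l * (β - p.1)) := by
    refine h.orbit_induction fun p hp ih => ?_
    have hpU := h.driftRegion_subset hp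
    rcases lt_or_ge c p.1 with hpc | hpc
    · have : driftSum c R ψ =ᶠ[𝓝 p] fun _ => 0 := by
        filter_upwards [(isOpen_lt continuous_const continuous_fst).mem_nhds hpc] with q hq
        exact driftSum_of_lt hq
      have h0 : jetNorm k (driftSum c R ψ) p = 0 := by
        refine Finset.sum_eq_zero fun i _ => ?_
        rw [(this.iteratedFDeriv ℝ i).eq_of_nhds]
        simp
      rw [h0]
      positivity
    · have hev : driftSum c R ψ =ᶠ[𝓝 p] fun q => ψ q + driftSum c R ψ (q + R q) := by
        filter_upwards [(isOpen_driftRegion _ _ _ _).mem_nhds hp] with q hq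
        exact h.driftSum_eq hψ hq
      have hq := h.add_mem hp hpc
      have hRs := h.bdd.1.contDiffAt (hUo.mem_nhds hpU)
      have hψs := (hψb 0).1.contDiffAt (hUo.mem_nhds hpU)
      have hcs : ContDiffAt ℝ ∞ (fun q => driftSum c R ψ (q + R q)) p :=
        ContDiffAt.comp p (g := driftSum c R ψ) (f := fun q => q + R q) (hsm _ hq)
          (contDiffAt_id.add hRs)
      set x := Real.exp p.2 with hx
      have hx0 : 0 < x := Real.exp_pos _
      have hx1 : x ≤ 1 := Real.exp_le_one_iff.2 (hpU.2.le.trans h.nonpos)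
      have h1 : jetNorm k (driftSum c R ψ) p ≤ jetNorm k ψ p +
          jetNorm k (fun q => driftSum c R ψ (q + R q)) p := by
        rw [jetNorm, jetNorm, jetNorm, ← Finset.sum_add_distrib]
        refine Finset.sum_le_sum fun i _ => ?_
        rw [(hev.iteratedFDeriv ℝ i).eq_of_nhds, fun_iteratedFDeriv_add_apply
          (hψs.of_le (by exact_mod_cast le_top)) (hcs.of_le (by exact_mod_cast le_top))]
        exact norm_add_le _ _
      have hCp := hCb p hpU
      rw [one_mul, ← hx] at hCp
      have h2 : jetNorm k (fun q => driftSum c R ψ (q + R q)) p ≤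
          (1 + K * x) * jetNorm k (driftSum c R ψ) (p + R p) := by
        refine (hKb _ R p (C * x) (by positivity) (mul_le_of_le_one_right hC hx1) (hsm _ hq) hRs
          fun j hj => (norm_iteratedFDeriv_le_jetNorm hj R p).trans hCp).trans (le_of_eq ?_)
        rw [hK]; ring
      have h3 := ih hpc hq
      set P := Real.exp (m * p.2 + l * (β - p.1)) with hP
      have hPpos : 0 < P := Real.exp_pos _
      have h4 : Real.exp (m * (p + R p).2 + l * (β - (p + R p).1)) ≤
          P * Real.exp (-(K + 1) * x) := by
        rw [hP, ← Real.exp_add]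
        refine Real.exp_le_exp.2 ?_
        simp only [Prod.fst_add, Prod.snd_add]
        have e1 : m * (R p).2 ≤ |m| * (C₀ * x) := by
          refine (le_abs_self _).trans ?_
          rw [abs_mul]
          exact mul_le_mul_of_nonneg_left (h.abs_le hp).2 (abs_nonneg m)
        have e2 : l * (c₁ * x) ≤ l * (R p).1 := mul_le_mul_of_nonneg_left (h.drift p hpU) hl0
        have e3 : l * (c₁ * x) = |m| * (C₀ * x) + (K + 1) * x := by
          rw [← mul_assoc, hlc]; ring
        linarith
      have h5 : jetNorm k ψ p ≤ A₀ * (x * P) := by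
        refine (hA₀b p hpU).trans (mul_le_mul_of_nonneg_left ?_ hA₀)
        rw [hx, hP, ← Real.exp_add]
        refine Real.exp_le_exp.2 ?_
        have := mul_nonneg hl0 (by linarith [hp.1.2] : 0 ≤ β - p.1)
        linarith
      have h6 : (1 + K * x) * jetNorm k (driftSum c R ψ) (p + R p) ≤
          (1 + K * x) * (2 * A₀ * (P * Real.exp (-(K + 1) * x))) := by
        refine mul_le_mul_of_nonneg_left (h3.trans ?_) (by positivity)
        exact mul_le_mul_of_nonneg_left h4 (by positivity)
      have h7 := mul_le_mul_of_nonneg_left (one_add_mul_exp_le (K := K) hx0.le hx1)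
        (by positivity : 0 ≤ 2 * A₀ * P)
      linear_combination h1 + h2 + h5 + h6 + h7
  refine ⟨2 * A₀ * Real.exp (l * (β - α)), by positivity, fun p hp => ?_⟩
  refine (norm_iteratedFDeriv_le_jetNorm le_rfl _ p).trans ((key p hp).trans ?_)
  rw [mul_assoc (2 * A₀), ← Real.exp_add]
  refine mul_le_mul_of_nonneg_left (Real.exp_le_exp.2 ?_) (by positivity)
  have := mul_le_mul_of_nonneg_left (by linarith [hp.1.1] : β - p.1 ≤ β - α) hl0
  linarith

end IsLogDrift

end LogDrift

section FlatExtension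

variable {F : Type} [NormedAddCommGroup F] [NormedSpace ℝ F]

theorem LogBdd.congr {m : ℝ} {U : Set (ℝ × ℝ)} {v v' : ℝ × ℝ → F} (hU : IsOpen U)
    (h : LogBdd m U v) (hv : ∀ p ∈ U, v' p = v p) : LogBdd m U v' := by
  refine ⟨h.1.congr hv, fun j => ?_⟩
  obtain ⟨C, hC, hb⟩ := h.2 j
  refine ⟨C, hC, fun p hp => ?_⟩
  have : v' =ᶠ[𝓝 p] v := by
    filter_upwards [hU.mem_nhds hp] with q hq using hv q hq
  rw [(this.iteratedFDeriv ℝ j).eq_of_nhds]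
  exact hb p hp

theorem LogBdd.mono_exponent {m n : ℝ} {U : Set (ℝ × ℝ)} {v : ℝ × ℝ → F} (h : LogBdd n U v)
    (hmn : m ≤ n) (hU : ∀ p ∈ U, p.2 ≤ 0) : LogBdd m U v := by
  refine ⟨h.1, fun j => ?_⟩
  obtain ⟨C, hC, hb⟩ := h.2 j
  refine ⟨C, hC, fun p hp => (hb p hp).trans (mul_le_mul_of_nonneg_left ?_ hC)⟩
  exact Real.exp_le_exp.2 (mul_le_mul_of_nonpos_right hmn (hU p hp))

/-- The function `v` in the coordinates `(s, y)`, `y = exp (2 ζ)`, extended by zero. -/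
noncomputable def flatExt (v : ℝ × ℝ → F) (p : ℝ × ℝ) : F :=
  if p.2 ≤ 0 then 0 else v (p.1, Real.log p.2 / 2)

/-- The derivative of `v` with respect to the coordinates `(s, y)`, `y = exp (2 ζ)`. -/
noncomputable def flatDeriv (v : ℝ × ℝ → F) (q : ℝ × ℝ) : ℝ × ℝ →L[ℝ] F :=
  (ContinuousLinearMap.compL ℝ (ℝ × ℝ) (ℝ × ℝ) F).flip
      ((ContinuousLinearMap.inl ℝ ℝ ℝ).comp (ContinuousLinearMap.fst ℝ ℝ ℝ)) (fderiv ℝ v q) +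
    Real.exp (-2 * q.2) • (ContinuousLinearMap.compL ℝ (ℝ × ℝ) (ℝ × ℝ) F).flip
      ((ContinuousLinearMap.inr ℝ ℝ ℝ).comp ((1 / 2 : ℝ) • ContinuousLinearMap.snd ℝ ℝ ℝ))
      (fderiv ℝ v q)

theorem LogBdd.flatDeriv {U : Set (ℝ × ℝ)} (hU : IsOpen U) {v : ℝ × ℝ → F}
    (h : ∀ m : ℝ, LogBdd m U v) (m : ℝ) : LogBdd m U (flatDeriv v) := by
  refine (((h m).fderiv hU).clm hU _).add hU ?_
  have := (LogBdd.exp (-2) U).smul hU (((h (m + 2)).fderiv hU).clm hU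
    ((ContinuousLinearMap.compL ℝ (ℝ × ℝ) (ℝ × ℝ) F).flip
      ((ContinuousLinearMap.inr ℝ ℝ ℝ).comp ((1 / 2 : ℝ) • ContinuousLinearMap.snd ℝ ℝ ℝ))))
  have e : (-2 : ℝ) + (m + 2) = m := by ring
  rw [e] at this
  exact this

theorem log_half_lt {y ζ : ℝ} (hy : 0 < y) (h : y < Real.exp (2 * ζ)) : Real.log y / 2 < ζ := by
  have := (Real.log_lt_iff_lt_exp hy).2 h
  linarith

theorem hasFDerivAt_flatExt {α β ζ : ℝ} {v : ℝ × ℝ → F}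
    (h : ∀ m : ℝ, LogBdd m (Ioo α β ×ˢ Iio ζ) v) {p : ℝ × ℝ}
    (hp : p ∈ Ioo α β ×ˢ Iio (Real.exp (2 * ζ))) :
    HasFDerivAt (flatExt v) (flatExt (flatDeriv v) p) p := by
  have hUo : IsOpen (Ioo α β ×ˢ Iio ζ) := isOpen_Ioo.prod isOpen_Iio
  rcases lt_trichotomy p.2 0 with hy | hy | hy
  · have h0 : flatExt (flatDeriv v) p = 0 := by simp [flatExt, hy.le]
    rw [h0]
    have : flatExt v =ᶠ[𝓝 p] fun _ => 0 := by
      filter_upwards [(isOpen_lt continuous_snd continuous_const).mem_nhds hy] with q hq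
      simp [flatExt, (show q.2 < 0 from hq).le]
    exact (hasFDerivAt_const 0 p).congr_of_eventuallyEq this
  · have h0 : flatExt (flatDeriv v) p = 0 := by simp [flatExt, hy.le]
    rw [h0]
    obtain ⟨C, hC, hb⟩ := (h 4).2 0
    refine Asymptotics.IsBigO.hasFDerivAt (n := 2) (Asymptotics.IsBigO.of_bound C ?_) one_lt_two
    filter_upwards [(isOpen_Ioo.prod isOpen_Iio).mem_nhds hp] with q hq
    by_cases hq0 : q.2 ≤ 0
    · simp only [flatExt, hq0, if_true, norm_zero]
      positivity
    · have hq0' := not_le.1 hq0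
      simp only [flatExt, hq0, if_false]
      have := hb (q.1, Real.log q.2 / 2) ⟨hq.1, log_half_lt hq0' hq.2⟩
      rw [norm_iteratedFDeriv_zero] at this
      refine this.trans (mul_le_mul_of_nonneg_left ?_ hC)
      have e : Real.exp (4 * (Real.log q.2 / 2)) = q.2 ^ 2 := by
        rw [show 4 * (Real.log q.2 / 2) = Real.log q.2 + Real.log q.2 by ring, Real.exp_add,
          Real.exp_log hq0', sq]
      have e2 : q.2 ≤ ‖q - p‖ := by
        have := norm_snd_le (q - p)
        rw [Prod.snd_sub, hy, sub_zero, Real.norm_eq_abs] at this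
        exact (le_abs_self _).trans this
      rw [e, norm_pow, norm_norm]
      exact pow_le_pow_left₀ hq0'.le e2 2
  · have hq : (p.1, Real.log p.2 / 2) ∈ Ioo α β ×ˢ Iio ζ := ⟨hp.1, log_half_lt hy hp.2⟩
    have hev : flatExt v =ᶠ[𝓝 p] fun q => v (q.1, Real.log q.2 / 2) := by
      filter_upwards [(isOpen_lt continuous_const continuous_snd).mem_nhds hy] with q hq
      simp [flatExt, not_le.2 (show 0 < q.2 from hq)]
    have h1 : HasFDerivAt v (fderiv ℝ v (p.1, Real.log p.2 / 2)) (p.1, Real.log p.2 / 2) :=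
      (((h 0).1.contDiffAt (hUo.mem_nhds hq)).differentiableAt (by simp)).hasFDerivAt
    have h2 : HasFDerivAt (fun q : ℝ × ℝ => Real.log q.2 / 2)
        ((1 / 2 : ℝ) • (p.2⁻¹ • ContinuousLinearMap.snd ℝ ℝ ℝ)) p := by
      have := ((hasFDerivAt_snd (p := p) (𝕜 := ℝ) (E := ℝ) (F := ℝ)).log hy.ne').const_mul (1 / 2)
      refine this.congr_of_eventuallyEq (Filter.Eventually.of_forall fun q => ?_)
      exact div_eq_inv_mul _ _ |>.trans (by rw [one_div])
    have h3 : HasFDerivAt (fun q : ℝ × ℝ => v (q.1, Real.log q.2 / 2)) _ p :=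
      h1.comp p ((hasFDerivAt_fst (p := p) (𝕜 := ℝ) (E := ℝ) (F := ℝ)).prodMk h2)
    refine (h3.congr_of_eventuallyEq hev).congr_fderiv ?_
    have e : Real.exp (-2 * (Real.log p.2 / 2)) = p.2⁻¹ := by
      rw [show -2 * (Real.log p.2 / 2) = -Real.log p.2 by ring, Real.exp_neg, Real.exp_log hy]
    simp only [flatExt, not_le.2 hy, if_false, flatDeriv, e]
    set A := fderiv ℝ v (p.1, Real.log p.2 / 2)
    refine ContinuousLinearMap.ext fun x => ?_
    have e1 : ((x.1, (1 / 2 : ℝ) * (p.2⁻¹ * x.2)) : ℝ × ℝ) =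
      (x.1, (0 : ℝ)) + p.2⁻¹ • ((0 : ℝ), (1 / 2 : ℝ) * x.2) := by ext <;> simp; ring
    change A (x.1, (1 / 2 : ℝ) * (p.2⁻¹ * x.2)) =
      A (x.1, (0 : ℝ)) + p.2⁻¹ • A ((0 : ℝ), (1 / 2 : ℝ) * x.2)
    rw [e1, map_add, map_smul]

theorem contDiffOn_nat_flatExt {α β ζ : ℝ} (n : ℕ) :
    ∀ {F : Type} [NormedAddCommGroup F] [NormedSpace ℝ F] {v : ℝ × ℝ → F},
      (∀ m : ℝ, LogBdd m (Ioo α β ×ˢ Iio ζ) v) →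
      ContDiffOn ℝ n (flatExt v) (Ioo α β ×ˢ Iio (Real.exp (2 * ζ))) := by
  have hΩ : IsOpen (Ioo α β ×ˢ Iio (Real.exp (2 * ζ))) := isOpen_Ioo.prod isOpen_Iio
  induction n with
  | zero =>
    intro F _ _ v h
    rw [Nat.cast_zero, contDiffOn_zero]
    exact fun p hp => (hasFDerivAt_flatExt h hp).continuousAt.continuousWithinAt
  | succ n ih =>
    intro F _ _ v h
    rw [Nat.cast_succ, contDiffOn_succ_iff_fderiv_of_isOpen hΩ]
    refine ⟨fun p hp => (hasFDerivAt_flatExt h hp).differentiableAt.differentiableWithinAt,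
      by simp, (ih (LogBdd.flatDeriv (isOpen_Ioo.prod isOpen_Iio) h)).congr fun p hp => ?_⟩
    exact (hasFDerivAt_flatExt h hp).fderiv

theorem contDiffOn_flatExt {α β ζ : ℝ} {v : ℝ × ℝ → F}
    (h : ∀ m : ℝ, LogBdd m (Ioo α β ×ˢ Iio ζ) v) :
    ContDiffOn ℝ ∞ (flatExt v) (Ioo α β ×ˢ Iio (Real.exp (2 * ζ))) :=
  contDiffOn_infty.2 fun n => contDiffOn_nat_flatExt n h

end FlatExtension

section FlatEquation

variable {a b c : ℝ} {N : Set (ℝ × ℝ)} {f g ψ : ℝ × ℝ → ℝ}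

/-- The displacement of the axis map in the coordinates `(s, ζ)`, `z = exp ζ`. -/
noncomputable def logDrift (f g : ℝ × ℝ → ℝ) (p : ℝ × ℝ) : ℝ × ℝ :=
  Real.exp (1 * p.2) • (f (expMap p), g (expMap p))

theorem IsAxisData.exists_isLogDrift (h : IsAxisData a b N f g) (hc : c ∈ Ioo a b) {s : ℝ}
    (hs : s ∈ Ioo a b) (hψ : ∀ m : ℕ, ∃ S : ℝ × ℝ → ℝ, ContDiffOn ℝ ∞ S N ∧
      ∀ p ∈ N, ψ p = p.2 ^ m * S p) :
    ∃ α β ζ₀ c₁ C₀ : ℝ, s ∈ Ioo α β ∧ IsLogDrift α c β ζ₀ c₁ C₀ (logDrift f g) ∧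
      (∀ p ∈ Ioo α β ×ˢ Iio ζ₀, expMap p ∈ N) ∧
      ∀ m : ℝ, LogBdd m (Ioo α β ×ˢ Iio ζ₀) (fun p => ψ (expMap p)) := by
  obtain ⟨α, haα, hα⟩ := exists_between (lt_min hs.1 hc.1)
  obtain ⟨β, hβ, hβb⟩ := exists_between (max_lt hs.2 hc.2)
  obtain ⟨hαs, hαc⟩ := lt_min_iff.1 hα
  obtain ⟨hsβ, hcβ⟩ := max_lt_iff.1 hβ
  have hN' : IsOpen (N ∩ f ⁻¹' Ioi 0) :=
    h.smooth_f.continuousOn.isOpen_inter_preimage h.isOpen isOpen_Ioi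
  obtain ⟨u, v, -, hv, hu, h0v, huv⟩ := generalized_tube_lemma (isCompact_Icc (a := α) (b := β))
    (isCompact_singleton (x := (0 : ℝ))) hN' (by
      rintro ⟨t, z⟩ ⟨ht, hz⟩
      obtain rfl : z = 0 := hz
      have ht' : t ∈ Ioo a b := ⟨haα.trans_le ht.1, ht.2.trans_lt hβb⟩
      exact ⟨h.axis t ht', h.pos t ht'⟩)
  obtain ⟨ρ, hρ, hρv⟩ := Metric.isOpen_iff.1 hv 0 (h0v rfl)
  set K : Set (ℝ × ℝ) := Icc α β ×ˢ Icc 0 (ρ / 2) with hKdef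
  have hK : IsCompact K := isCompact_Icc.prod isCompact_Icc
  have hKN' : K ⊆ N ∩ f ⁻¹' Ioi 0 := by
    refine (prod_mono hu fun z hz => hρv ?_).trans huv
    rw [Metric.mem_ball, Real.dist_eq, sub_zero, abs_of_nonneg hz.1]
    linarith [hz.2]
  have hKN : K ⊆ N := hKN'.trans inter_subset_left
  obtain ⟨c₁, hc₁, hc₁f⟩ := hK.exists_forall_le' (h.smooth_f.continuousOn.mono hKN)
    (fun p hp => (hKN' hp).2)
  have hfg : ContDiffOn ℝ ∞ (fun p => (f p, g p)) N := h.smooth_f.prodMk h.smooth_g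
  obtain ⟨C, hC⟩ := hK.exists_bound_of_continuousOn (hfg.continuousOn.mono hKN)
  set C₀ := max C 0 with hC₀
  have hC₀0 : 0 ≤ C₀ := le_max_right _ _
  obtain ⟨r, hr0, hr⟩ := exists_between
    (show 0 < min (ρ / 2) (min 1 ((β - c) / (C₀ + 1))) from
      lt_min (by positivity) (lt_min one_pos (div_pos (by linarith) (by positivity))))
  obtain ⟨hrρ, hr⟩ := lt_min_iff.1 hr
  obtain ⟨hr1, hrβ⟩ := lt_min_iff.1 hr
  have hrβ' := (lt_div_iff₀ (by positivity)).1 hrβ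
  have hUo : IsOpen (Ioo α β ×ˢ Iio (Real.log r)) := isOpen_Ioo.prod isOpen_Iio
  have hUK : ∀ p ∈ Ioo α β ×ˢ Iio (Real.log r), expMap p ∈ K := fun p hp =>
    ⟨⟨hp.1.1.le, hp.1.2.le⟩, (Real.exp_pos _).le,
      ((Real.lt_log_iff_exp_lt hr0).1 hp.2).le.trans hrρ.le⟩
  have hlogr : Real.log r ≤ 0 := Real.log_nonpos hr0.le hr1.le
  have hU0 : ∀ p ∈ Ioo α β ×ˢ Iio (Real.log r), p.2 ≤ 0 := fun p hp => hp.2.le.trans hlogr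
  refine ⟨α, β, Real.log r, c₁, C₀, ⟨hαs, hsβ⟩, ⟨hαc, hcβ, hlogr, ?_, hc₁, fun p hp => ?_,
    fun p hp => ?_, hC₀0, ?_⟩, fun p hp => hKN (hUK p hp), fun m => ?_⟩
  · have := (LogBdd.exp 1 (Ioo α β ×ˢ Iio (Real.log r))).smul hUo
      (LogBdd.comp_expMap h.isOpen hUo hK hKN hUK hU0 hfg)
    rwa [add_zero] at this
  · have := mul_le_mul_of_nonneg_right (hc₁f _ (hUK p hp)) (Real.exp_pos p.2).le
    simpa [logDrift, mul_comm] using this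
  · have := mul_le_mul_of_nonneg_right ((hC _ (hUK p hp)).trans (le_max_left C 0))
      (Real.exp_pos p.2).le
    rw [logDrift, norm_smul, Real.norm_eq_abs, Real.abs_exp, one_mul, mul_comm]
    exact this
  · rw [Real.exp_log hr0]
    nlinarith
  · obtain ⟨M, hM⟩ := exists_nat_ge m
    obtain ⟨S, hS, hψS⟩ := hψ M
    have h1 := (LogBdd.exp M (Ioo α β ×ˢ Iio (Real.log r))).smul hUo
      (LogBdd.comp_expMap h.isOpen hUo hK hKN hUK hU0 hS)
    rw [add_zero] at h1
    refine (h1.congr hUo fun p hp => ?_).mono_exponent hM hU0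
    rw [hψS _ (hKN (hUK p hp)), smul_eq_mul, Real.exp_nat_mul]
    rfl

/-- Solution of the cohomological equation of the axis map with a flat right-hand side vanishing
to the right of `c`. -/
theorem IsAxisData.exists_flat_solution (h : IsAxisData a b N f g) (hc : c ∈ Ioo a b)
    (hψ : ∀ m : ℕ, ∃ S : ℝ × ℝ → ℝ, ContDiffOn ℝ ∞ S N ∧ ∀ p ∈ N, ψ p = p.2 ^ m * S p)
    (hψ0 : ∀ p ∈ N, 0 < p.2 → c < p.1 → ψ p = 0) :
    ∃ U : ℝ × ℝ → ℝ, (∀ s, U (s, 0) = 0) ∧ ∀ s ∈ Ioo a b, HasFDerivAt U (0 : ℝ × ℝ →L[ℝ] ℝ) (s, (0 : ℝ)) ∧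
      ∃ ε > 0, ContDiffOn ℝ ∞ U (Ioo (s - ε) (s + ε) ×ˢ Iio ε) ∧
        ∀ p ∈ Ioo (s - ε) (s + ε) ×ˢ Ioo 0 ε,
          U (p.1, p.2 ^ 2) - U ((axisMap f g p).1, (axisMap f g p).2 ^ 2) = ψ p := by
  refine ⟨flatExt (driftSum c (logDrift f g) fun p => ψ (expMap p)), fun s => by simp [flatExt],
    fun s hs => ?_⟩
  obtain ⟨α, β, ζ₀, c₁, C₀, hsαβ, hd, hUN, hψb⟩ := h.exists_isLogDrift hc hs hψ
  have hψ0' : ∀ p ∈ Ioo α β ×ˢ Iio ζ₀, c < p.1 → ψ (expMap p) = 0 := fun p hp hpc =>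
    hψ0 _ (hUN p hp) (Real.exp_pos _) hpc
  have hb := hd.logBdd_driftSum hψb hψ0'
  set κ := C₀ / c₁ with hκ
  have hκ0 : 0 ≤ κ := div_nonneg hd.nonneg hd.pos.le
  set ζ₁ := ζ₀ - κ * (β - α) with hζ₁
  have hsub : Ioo α β ×ˢ Iio ζ₁ ⊆ driftRegion α β ζ₀ κ := by
    rintro p ⟨hp1, hp2⟩
    refine ⟨hp1, ?_⟩
    have := mul_le_mul_of_nonneg_left (by linarith [hp1.1] : β - p.1 ≤ β - α) hκ0
    simp only [mem_Iio] at hp2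
    linarith
  have hb1 := fun m => (hb m).mono_set hsub
  have hs0 : (s, (0 : ℝ)) ∈ Ioo α β ×ˢ Iio (Real.exp (2 * ζ₁)) := ⟨hsαβ, Real.exp_pos _⟩
  refine ⟨?_, ?_⟩
  · have := hasFDerivAt_flatExt hb1 hs0
    simpa [flatExt] using this
  · obtain ⟨ε, hε, hεlt⟩ := exists_between
      (show 0 < min (min (s - α) (β - s)) (min (Real.exp (2 * ζ₁)) (Real.exp ζ₁)) from
        lt_min (lt_min (by linarith [hsαβ.1]) (by linarith [hsαβ.2]))
          (lt_min (Real.exp_pos _) (Real.exp_pos _)))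
    obtain ⟨hε1, hε2⟩ := lt_min_iff.1 hεlt
    obtain ⟨hεα, hεβ⟩ := lt_min_iff.1 hε1
    obtain ⟨hεe, hεe'⟩ := lt_min_iff.1 hε2
    have hI : Ioo (s - ε) (s + ε) ⊆ Ioo α β := Ioo_subset_Ioo (by linarith) (by linarith)
    refine ⟨ε, hε, (contDiffOn_flatExt hb1).mono (prod_mono hI (Iio_subset_Iio hεe.le)),
      fun p hp => ?_⟩
    have hz : 0 < p.2 := hp.2.1
    have hq : (p.1, Real.log p.2) ∈ Ioo α β ×ˢ Iio ζ₁ :=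
      ⟨hI hp.1, (Real.log_lt_iff_lt_exp hz).2 (hp.2.2.trans hεe')⟩
    have e := hd.driftSum_eq hψ0' (hsub hq)
    have e1 : expMap (p.1, Real.log p.2) = p := by simp [expMap, Real.exp_log hz]
    have e2 : (p.1, Real.log p.2) + logDrift f g (p.1, Real.log p.2) =
        (p.1 + p.2 * f p, Real.log p.2 + p.2 * g p) := by
      simp [logDrift, e1, Real.exp_log hz]
    rw [e2, e1] at e
    have h1 : ¬ p.2 ^ 2 ≤ 0 := not_le.2 (by positivity)
    have h2 : ¬ (p.2 * Real.exp (p.2 * g p)) ^ 2 ≤ 0 := not_le.2 (by positivity)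
    have h3 : Real.log (p.2 ^ 2) / 2 = Real.log p.2 := by
      rw [Real.log_pow]; push_cast; ring
    have h4 : Real.log ((p.2 * Real.exp (p.2 * g p)) ^ 2) / 2 = Real.log p.2 + p.2 * g p := by
      rw [Real.log_pow, Real.log_mul hz.ne' (Real.exp_pos _).ne', Real.log_exp]; push_cast; ring
    simp only [flatExt, axisMap, h1, h2, if_false, h3, h4]
    linarith

end FlatEquation

section Invariant

variable {a b : ℝ} {N : Set (ℝ × ℝ)} {f g : ℝ × ℝ → ℝ}

theorem IsAxisData.neg (h : IsAxisData a b N f g) :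
    IsAxisData (-b) (-a) (Neg.neg ⁻¹' N) (fun p => f (-p)) (fun p => -g (-p)) where
  isOpen := h.isOpen.preimage continuous_neg
  axis s hs := by
    have := h.axis (-s) ⟨by linarith [hs.2], by linarith [hs.1]⟩
    simpa using this
  fst_mem p hp := by
    have := h.fst_mem _ hp
    simp only [Prod.fst_neg, mem_Ioo] at this
    exact ⟨by linarith [this.2], by linarith [this.1]⟩
  smooth_f := h.smooth_f.comp contDiff_neg.contDiffOn fun _ hp => hp
  smooth_g := (h.smooth_g.comp contDiff_neg.contDiffOn fun _ hp => hp).neg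
  pos s hs := by
    have := h.pos (-s) ⟨by linarith [hs.2], by linarith [hs.1]⟩
    simpa using this

theorem axisMap_neg (p : ℝ × ℝ) :
    axisMap (fun p => f (-p)) (fun p => -g (-p)) p = -axisMap f g (-p) := by
  ext
  · simp only [axisMap, Prod.fst_neg, Prod.snd_neg]
    ring
  · simp [axisMap]

/-- A smooth function equal to `1` on `(-∞, s₀]` and to `0` on `[s₁, ∞)`. -/
theorem exists_contDiff_step {s₀ s₁ : ℝ} (h : s₀ < s₁) :
    ∃ χ : ℝ → ℝ, ContDiff ℝ ∞ χ ∧ (∀ s ≤ s₀, χ s = 1) ∧ ∀ s, s₁ ≤ s → χ s = 0 := by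
  refine ⟨fun s => 1 - Real.smoothTransition ((s - s₀) / (s₁ - s₀)), ?_, fun s hs => ?_,
    fun s hs => ?_⟩
  · exact contDiff_const.sub (Real.smoothTransition.contDiff.comp (by fun_prop))
  · beta_reduce
    rw [Real.smoothTransition.zero_of_nonpos, sub_zero]
    exact div_nonpos_of_nonpos_of_nonneg (by linarith) (by linarith)
  · beta_reduce
    rw [Real.smoothTransition.one_of_one_le, sub_self]
    rw [le_div_iff₀ (by linarith)]
    linarith

/-- The flat part of the increment supported to the left of `c` is the increment of a function
which is smooth near the axis and flat on it. -/
theorem IsAxisData.eventually_flat_solution {c : ℝ} {ψ : ℝ × ℝ → ℝ} (h : IsAxisData a b N f g)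
    (hc : c ∈ Ioo a b)
    (hψ : ∀ m : ℕ, ∃ S : ℝ × ℝ → ℝ, ContDiffOn ℝ ∞ S N ∧ ∀ p ∈ N, ψ p = p.2 ^ m * S p)
    (hψ0 : ∀ p ∈ N, 0 < p.2 → c < p.1 → ψ p = 0) :
    ∃ U : ℝ × ℝ → ℝ, (∀ s, U (s, 0) = 0) ∧ ∀ s ∈ Ioo a b,
      HasFDerivAt U (0 : ℝ × ℝ →L[ℝ] ℝ) (s, (0 : ℝ)) ∧
      (∀ᶠ p in 𝓝 (s, (0 : ℝ)), ContDiffAt ℝ ∞ U p) ∧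
      ∀ᶠ p in 𝓝 (s, (0 : ℝ)), 0 < p.2 →
        U (p.1, p.2 ^ 2) - U ((axisMap f g p).1, (axisMap f g p).2 ^ 2) = ψ p := by
  obtain ⟨U, hU0, hU⟩ := h.exists_flat_solution hc hψ hψ0
  refine ⟨U, hU0, fun s hs => ?_⟩
  obtain ⟨hd, ε, hε, hsm, heq⟩ := hU s hs
  have ho : IsOpen (Ioo (s - ε) (s + ε) ×ˢ Iio ε) := isOpen_Ioo.prod isOpen_Iio
  have hmem : (s, (0 : ℝ)) ∈ Ioo (s - ε) (s + ε) ×ˢ Iio ε :=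
    ⟨⟨by linarith, by linarith⟩, hε⟩
  refine ⟨hd, ?_, ?_⟩
  · filter_upwards [ho.mem_nhds hmem] with p hp using hsm.contDiffAt (ho.mem_nhds hp)
  · filter_upwards [ho.mem_nhds hmem] with p hp hp0 using heq p ⟨hp.1, hp0, hp.2⟩

theorem IsAxisData.exists_invariant (hab : a < b) (h : IsAxisData a b N f g)
    (hf : ∀ p ∈ N, 0 < f p) (hG : ∀ p ∈ N, (axisMap f g p).1 ∈ Ioo a b)
    (hrev : ∀ p ∈ N, reflAxis (axisMap f g p) ∈ N →
      axisMap f g (reflAxis (axisMap f g p)) = reflAxis p) :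
    ∃ ht : ℝ × ℝ → ℝ, (∀ s ∈ Ioo a b, ht (s, 0) = 0) ∧ ∀ s ∈ Ioo a b,
      (∀ᶠ q in 𝓝 (s, (0 : ℝ)), ContDiffAt ℝ ∞ ht q ∧ 0 < fderiv ℝ ht q (0, 1)) ∧
      ∀ᶠ p in 𝓝 (s, (0 : ℝ)), 0 < p.2 →
        ht ((axisMap f g p).1, (axisMap f g p).2 ^ 2) = ht (p.1, p.2 ^ 2) := by
  obtain ⟨H, hHs, hH0, hHd, hHflat⟩ := h.exists_formal_integral hab hG hrev
  obtain ⟨s₀, has₀, hs₀b⟩ := exists_between hab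
  obtain ⟨s₁, hs₀₁, hs₁b⟩ := exists_between hs₀b
  obtain ⟨χ, hχ, hχ1, hχ0⟩ := exists_contDiff_step hs₀₁
  have h₁ : ∃ U : ℝ × ℝ → ℝ, _ := h.eventually_flat_solution (c := s₁)
    (ψ := fun p => axisIncr f g H p * χ p.1) ⟨has₀.trans hs₀₁, hs₁b⟩ (fun m => by
      obtain ⟨S, hS, hSe⟩ := hHflat m
      refine ⟨fun p => S p * χ p.1, hS.mul (hχ.comp contDiff_fst).contDiffOn, fun p hp => ?_⟩
      simp only [hSe p hp]
      ring) (fun p _ _ hp => by simp [hχ0 p.1 hp.le])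
  have h₂ : ∃ U : ℝ × ℝ → ℝ, _ := h.neg.eventually_flat_solution (c := -s₀)
    (ψ := fun p => -(axisIncr f g H (-p) * (1 - χ (axisMap f g (-p)).1)))
    ⟨by linarith, by linarith⟩ (fun m => by
      obtain ⟨S, hS, hSe⟩ := hHflat m
      refine ⟨fun p => -((-1) ^ m * (S (-p) * (1 - χ (axisMap f g (-p)).1))), ?_, fun p hp => ?_⟩
      · have hn : ContDiffOn ℝ ∞ (fun p : ℝ × ℝ => -p) (Neg.neg ⁻¹' N) :=
          contDiff_neg.contDiffOn
        have e1 := hS.comp hn fun _ hp => hp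
        have e2 := (hχ.comp_contDiffOn h.smooth_map_fst).comp hn fun _ hp => hp
        exact (contDiffOn_const.mul (e1.mul (contDiffOn_const.sub e2))).neg
      · simp only [hSe _ hp, Prod.snd_neg, neg_pow p.2 m]
        ring) (fun p hp hp0 hpc => by
      have : (axisMap f g (-p)).1 ≤ s₀ := by
        have := mul_pos hp0 (hf _ hp)
        simp only [axisMap, Prod.fst_neg, Prod.snd_neg]
        linarith
      simp [hχ1 _ this])
  obtain ⟨U, hU0, hU⟩ := h₁
  obtain ⟨U', hU'0, hU'⟩ := h₂
  set L : ℝ × ℝ → ℝ × ℝ := fun q => (-q.1, q.2) with hL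
  have hLs : ContDiff ℝ ∞ L := by fun_prop
  refine ⟨fun q => H q + U q - U' (L q), fun s hs => by simp [hL, hH0 s hs, hU0, hU'0],
    fun s hs => ?_⟩
  obtain ⟨hUd, hUs, hUe⟩ := hU s hs
  obtain ⟨hU'd, hU's, hU'e⟩ := hU' (-s) ⟨by linarith [hs.2], by linarith [hs.1]⟩
  have hIo : IsOpen (Ioo a b ×ˢ (univ : Set ℝ)) := isOpen_Ioo.prod isOpen_univ
  have hLt : Filter.Tendsto L (𝓝 (s, 0)) (𝓝 (-s, 0)) := hLs.continuous.tendsto (s, 0)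
  have hsm : ∀ᶠ q in 𝓝 (s, (0 : ℝ)), ContDiffAt ℝ ∞ (fun q => H q + U q - U' (L q)) q := by
    filter_upwards [hUs, hLt.eventually hU's, hIo.mem_nhds (x := (s, 0)) ⟨hs, trivial⟩]
      with q h1 h2 h3
    exact ((hHs.contDiffAt (hIo.mem_nhds h3)).add h1).sub (ContDiffAt.comp q h2 hLs.contDiffAt)
  refine ⟨hsm.and ?_, ?_⟩
  · have hc : ContinuousAt (fun q => fderiv ℝ (fun q => H q + U q - U' (L q)) q (0, 1)) (s, 0) :=
      ((hsm.self_of_nhds.fderiv_right (m := ∞) (by simp)).continuousAt).clm_apply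
        continuousAt_const
    refine hc.eventually (lt_mem_nhds ?_)
    obtain ⟨d, hd, hHd⟩ := hHd s hs
    have hHf : HasFDerivAt H (fderiv ℝ H (s, 0)) (s, 0) :=
      ((hHs.contDiffAt (hIo.mem_nhds ⟨hs, trivial⟩)).differentiableAt (by simp)).hasFDerivAt
    have hHv : fderiv ℝ H (s, 0) (0, 1) = d := by
      have := hHf.comp_hasDerivAt (0 : ℝ) ((hasDerivAt_const (0 : ℝ) s).prodMk (hasDerivAt_id 0))
      exact this.unique hHd
    have hUL : HasFDerivAt (fun q => U' (L q)) (0 : ℝ × ℝ →L[ℝ] ℝ) (s, 0) := by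
      have hLd : HasFDerivAt L (fderiv ℝ L (s, 0)) (s, 0) :=
        (hLs.contDiffAt.differentiableAt (by simp)).hasFDerivAt
      have := HasFDerivAt.comp (s, (0 : ℝ)) (g := U') (f := L) hU'd hLd
      rw [ContinuousLinearMap.zero_comp] at this
      exact this
    have := (hHf.add hUd).sub hUL
    have e : fderiv ℝ (fun q => H q + U q - U' (L q)) (s, 0) = fderiv ℝ H (s, 0) := by
      refine this.fderiv.trans ?_
      rw [add_zero, sub_zero]
    beta_reduce
    rw [e, hHv]
    exact hd
  · have hsN : (s, (0 : ℝ)) ∈ N := h.axis s hs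
    have hN := h.isOpen.mem_nhds hsN
    have hGc : ContinuousAt (fun p => axisMap f g p) (s, 0) :=
      (h.smooth_map_fst.continuousOn.continuousAt hN).prodMk
        (h.smooth_map_snd.continuousOn.continuousAt hN)
    have hGt : Filter.Tendsto (fun p => axisMap f g p) (𝓝 (s, 0)) (𝓝 (s, 0)) := by
      have := hGc.tendsto
      simpa [axisMap] using this
    have hRt : Filter.Tendsto reflAxis (𝓝 (s, 0)) (𝓝 (s, 0)) := by
      have : Continuous reflAxis := by unfold reflAxis; fun_prop
      have := this.tendsto (s, 0)
      simpa [reflAxis] using this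
    filter_upwards [hUe, (hLt.comp hGt).eventually hU'e, hN,
      (hRt.comp hGt).eventually hN] with p e1 e2 hpN hrN hp0
    have hr := hrev p hpN hrN
    have hG0 : 0 < (axisMap f g p).2 := mul_pos hp0 (Real.exp_pos _)
    have e3 := e2 hG0
    have e4 : -(L (axisMap f g p)) = reflAxis (axisMap f g p) := by
      simp [hL, reflAxis]
    simp only [Function.comp_apply, axisMap_neg, e4, hr] at e3
    have e5 : axisIncr f g H (reflAxis (axisMap f g p)) = -axisIncr f g H p := by
      rw [axisIncr, hr]
      simp [axisIncr, reflAxis]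
    rw [e5] at e3
    have e6 := e1 hp0
    have e7 : axisIncr f g H p =
      H ((axisMap f g p).1, (axisMap f g p).2 ^ 2) - H (p.1, p.2 ^ 2) := rfl
    simp only [hL, reflAxis, Prod.fst_neg, Prod.snd_neg, neg_neg] at e3 ⊢
    linear_combination (-1 : ℝ) * e6 - e3 - e7

end Invariant

theorem hasDerivAt_of_abs_sub_le {r : ℝ → ℝ} {k C δ : ℝ} (hδ : 0 < δ)
    (h : ∀ z, |z| < δ → |r z - k * z| ≤ C * z ^ 2) : HasDerivAt r k 0 := by
  have h1 : HasFDerivAt (fun z => r z - k * z) (0 : ℝ →L[ℝ] ℝ) 0 := by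
    refine Asymptotics.IsBigO.hasFDerivAt (n := 2) (Asymptotics.IsBigO.of_bound C ?_) one_lt_two
    filter_upwards [Metric.ball_mem_nhds (0 : ℝ) hδ] with z hz
    have hz' : |z| < δ := by simpa using hz
    simpa using h z hz'
  have h2 := h1.hasDerivAt.add ((hasDerivAt_id (0 : ℝ)).const_mul k)
  rw [zero_apply, zero_add, mul_one] at h2
  refine h2.congr_of_eventuallyEq (Filter.Eventually.of_forall fun z => ?_)
  simp

/-- An open neighborhood of `J` contains a domain adjacent to `J` which is the subgraph of a
function on the interval. -/
theorem exists_isAdjDomain {a b : ℝ} (hab : a < b) {O : Set (ℝ × ℝ)} (hO : IsOpen O)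
    (hJ : Jset a b ⊆ O) :
    ∃ W ⊆ O, IsAdjDomain a b W ∧ ∀ p ∈ W, p.1 ∈ Ioo a b ∧ ∀ y ∈ Ioc 0 p.2, (p.1, y) ∈ W := by
  set A : Set (ℝ × ℝ) := (O ∩ Ioo a b ×ˢ univ)ᶜ with hA
  have hAc : IsClosed A := (hO.inter (isOpen_Ioo.prod isOpen_univ)).isClosed_compl
  have hAne : A.Nonempty := ⟨(a, 0), fun h => lt_irrefl a h.2.1.1⟩
  set θ : ℝ → ℝ := fun s => Metric.infDist (s, (0 : ℝ)) A with hθ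
  have hθc : Continuous θ := (Metric.continuous_infDist_pt A).comp (by fun_prop)
  have hθpos : ∀ s ∈ Ioo a b, 0 < θ s := fun s hs =>
    (hAc.notMem_iff_infDist_pos hAne).1 fun h => h ⟨hJ ⟨hs, rfl⟩, hs, trivial⟩
  have hmem : ∀ s q, dist q (s, (0 : ℝ)) < θ s → q ∈ O ∩ Ioo a b ×ˢ univ := by
    intro s q hq
    by_contra hqA
    exact (Metric.infDist_le_dist_of_mem (x := (s, (0 : ℝ))) (s := A) hqA).not_gt
      (by rwa [dist_comm])
  set W : Set (ℝ × ℝ) := {p | p.1 ∈ Ioo a b ∧ 0 < p.2 ∧ p.2 < θ p.1} with hW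
  refine ⟨W, fun p hp => (hmem p.1 p ?_).1, ⟨?_, ?_, fun p hp => hp.2.1, fun s hs => ?_⟩,
    fun p hp => ⟨hp.1, fun y hy => ⟨hp.1, hy.1, hy.2.trans_lt hp.2.2⟩⟩⟩
  · rw [Prod.dist_eq, dist_self, Real.dist_eq, sub_zero, abs_of_pos hp.2.1]
    exact max_lt (hθpos _ hp.1) hp.2.2
  · exact (isOpen_Ioo.preimage continuous_fst).inter ((isOpen_lt continuous_const
      continuous_snd).inter (isOpen_lt continuous_snd (hθc.comp continuous_fst)))
  · have : W = (fun q : ℝ × ℝ => (q.1, q.2 * θ q.1)) '' (Ioo a b ×ˢ Ioo 0 1) := by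
      ext p
      constructor
      · intro hp
        have hθp := hθpos _ hp.1
        refine ⟨(p.1, p.2 / θ p.1), ⟨hp.1, div_pos hp.2.1 hθp, (div_lt_one hθp).2 hp.2.2⟩, ?_⟩
        simp [div_mul_cancel₀ _ hθp.ne']
      · rintro ⟨q, ⟨hq1, hq2⟩, rfl⟩
        have hθq := hθpos _ hq1
        exact ⟨hq1, mul_pos hq2.1 hθq, by
          simpa using mul_lt_mul_of_pos_right hq2.2 hθq⟩
    rw [this]
    exact ((isConnected_Ioo hab).prod (isConnected_Ioo one_pos)).image _
      (continuous_fst.prodMk (continuous_snd.mul (hθc.comp continuous_fst))).continuousOn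
  · have hθs := hθpos s hs
    refine ⟨θ s / 2, by positivity, fun p hp => ?_⟩
    have h1 : dist (p.1, (0 : ℝ)) (s, (0 : ℝ)) < θ s / 2 := by
      rw [Prod.dist_eq, dist_self, max_lt_iff, Real.dist_eq, abs_lt]
      exact ⟨⟨by linarith [hp.1.1], by linarith [hp.1.2]⟩, by positivity⟩
    have h2 : θ s ≤ θ p.1 + dist (s, (0 : ℝ)) (p.1, (0 : ℝ)) :=
      Metric.infDist_le_infDist_add_dist
    rw [dist_comm] at h2
    exact ⟨(hmem s _ (h1.trans (by linarith))).2.1, hp.2.1, by linarith [hp.2.2]⟩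

theorem IsAdjDomain.uniqueDiffWithinAt {a b : ℝ} {W : Set (ℝ × ℝ)} (h : IsAdjDomain a b W)
    {p : ℝ × ℝ} (hp : p ∈ W ∪ Jset a b) : UniqueDiffWithinAt ℝ (W ∪ Jset a b) p := by
  rcases hp with hp | ⟨hp1, hp2⟩
  · exact (h.1.uniqueDiffWithinAt hp).mono subset_union_left
  · obtain ⟨s, y⟩ := p
    obtain rfl : y = 0 := hp2
    obtain ⟨ε, hε, hsub⟩ := h.2.2.2 s hp1
    have h1 : UniqueDiffWithinAt ℝ ((Ioo (s - ε) (s + ε) ∩ Ioo a b) ×ˢ Ico 0 ε) (s, (0 : ℝ)) :=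
      ((isOpen_Ioo.inter isOpen_Ioo).uniqueDiffWithinAt
        ⟨⟨by linarith, by linarith⟩, hp1⟩).prod (uniqueDiffOn_Ico 0 ε 0 ⟨le_rfl, hε⟩)
    refine h1.mono fun q hq => ?_
    rcases hq.2.1.eq_or_lt with h0 | h0
    · exact Or.inr ⟨hq.1.2, h0.symm⟩
    · exact Or.inl (hsub ⟨hq.1.1, h0, hq.2.2⟩)

theorem IsBilliardLike.exists_isAxisData {a b : ℝ} {w : ℝ → ℝ} {V : Set (ℝ × ℝ)}
    {F : ℝ × ℝ → ℝ × ℝ} (hF : IsBilliardLike a b w V F) :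
    ∃ (N : Set (ℝ × ℝ)) (f g : ℝ × ℝ → ℝ), IsAxisData a b N f g ∧ (∀ p ∈ N, 0 < f p) ∧
      (∀ p ∈ N, (axisMap f g p).1 ∈ Ioo a b) ∧
      (∀ p ∈ N, reflAxis (axisMap f g p) ∈ N →
        axisMap f g (reflAxis (axisMap f g p)) = reflAxis p) ∧
      ∀ p ∈ N, 0 < p.2 → (p.1, p.2 ^ 2) ∈ V →
        F (p.1, p.2 ^ 2) = ((axisMap f g p).1, (axisMap f g p).2 ^ 2) := by
  obtain ⟨N₀, hN₀, hJN₀, β, hβs, hββ, hβ0, hβa, hFβ⟩ := hF.lifted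
  set N₁ : Set (ℝ × ℝ) := N₀ ∩ Ioo a b ×ˢ univ with hN₁
  have hN₁o : IsOpen N₁ := hN₀.inter (isOpen_Ioo.prod isOpen_univ)
  have hβs₁ : ContDiffOn ℝ ∞ β N₁ := hβs.mono inter_subset_left
  have hJN₁ : ∀ s ∈ Ioo a b, (s, (0 : ℝ)) ∈ N₁ := fun s hs => ⟨hJN₀ ⟨hs, rfl⟩, hs, trivial⟩
  obtain ⟨f, hfs, hf⟩ := exists_contDiffOn_div_snd (r := fun p => (β p).1 - p.1) hN₁o
    (hβs₁.fst.sub contDiffOn_fst) fun s hs => by simp [hβ0 s hs.2.1]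
  obtain ⟨κ, hκs, hκ⟩ := exists_contDiffOn_div_snd (r := fun p => -(β p).2) hN₁o
    hβs₁.snd.neg fun s hs => by simp [hβ0 s hs.2.1]
  have hline : ∀ s : ℝ, Continuous fun z : ℝ => (s, z) := fun s => by fun_prop
  have hasymp : ∀ s ∈ Ioo a b, ∃ C, ∃ δ > 0, ∀ z : ℝ, |z| < δ →
      |(β (s, z)).1 - s - w s * z| ≤ C * z ^ 2 ∧ |(β (s, z)).2 + z| ≤ C * z ^ 2 := by
    intro s hs
    obtain ⟨C, -, δ, hδ, hC⟩ := hβa {s} isCompact_singleton (singleton_subset_iff.2 hs)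
    obtain ⟨δ', hδ', hsub⟩ := Metric.isOpen_iff.1 (hN₀.preimage (hline s)) 0 (hJN₁ s hs).1
    refine ⟨C, min δ δ', lt_min hδ hδ', fun z hz => ?_⟩
    obtain ⟨hz1, hz2⟩ := lt_min_iff.1 hz
    exact hC (s, z) (hsub (by simpa using hz2)) rfl hz1
  have hf0 : ∀ s ∈ Ioo a b, f (s, 0) = w s := by
    intro s hs
    obtain ⟨C, δ, hδ, hC⟩ := hasymp s hs
    exact (hasDerivAt_of_eq_snd_mul hN₁o (hJN₁ s hs) hfs.continuousOn hf).unique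
      (hasDerivAt_of_abs_sub_le hδ fun z hz => (hC z hz).1)
  have hκ0 : ∀ s ∈ Ioo a b, κ (s, 0) = 1 := by
    intro s hs
    obtain ⟨C, δ, hδ, hC⟩ := hasymp s hs
    refine (hasDerivAt_of_eq_snd_mul hN₁o (hJN₁ s hs) hκs.continuousOn hκ).unique
      (hasDerivAt_of_abs_sub_le (C := C) hδ fun z hz => ?_)
    have := (hC z hz).2
    rw [← abs_neg] at this
    convert this using 2
    ring
  set N : Set (ℝ × ℝ) := N₁ ∩ (fun p => (f p, κ p, (β p).1)) ⁻¹'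
    (Ioi 0 ×ˢ Ioi 0 ×ˢ Ioo a b) with hN
  have hNo : IsOpen N :=
    (hfs.continuousOn.prodMk (hκs.continuousOn.prodMk hβs₁.fst.continuousOn)).isOpen_inter_preimage
      hN₁o (isOpen_Ioi.prod (isOpen_Ioi.prod isOpen_Ioo))
  have hNN₁ : N ⊆ N₁ := inter_subset_left
  obtain ⟨g, hgs, hg⟩ := exists_contDiffOn_div_snd (r := fun p => Real.log (κ p)) hNo
    ((hκs.mono hNN₁).log fun p hp => (hp.2.2.1 : 0 < κ p).ne')
    fun s hs => by simp [hκ0 s hs.1.2.1]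
  have hG : ∀ p ∈ N, axisMap f g p = reflAxis (β p) := by
    intro p hp
    have h1 := hf p (hNN₁ hp)
    have h2 := hκ p (hNN₁ hp)
    have h3 := hg p hp
    ext
    · simp only [axisMap, reflAxis, ← h1]
      ring
    · simp only [axisMap, reflAxis, ← h3, Real.exp_log (show 0 < κ p from hp.2.2.1), h2]
  refine ⟨N, f, g, ⟨hNo, fun s hs => ⟨hJN₁ s hs, ?_, ?_, ?_⟩, fun p hp => hp.1.2.1,
    hfs.mono hNN₁, hgs, fun s hs => ?_⟩, fun p hp => hp.2.1, fun p hp => ?_, fun p hp hp' => ?_,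
    fun p hp hp0 hpV => ?_⟩
  · simpa [hf0 s hs] using hF.wPos s hs
  · simp [hκ0 s hs]
  · simpa [hβ0 s hs] using hs
  · simpa [hf0 s hs] using hF.wPos s hs
  · rw [hG p hp]
    exact hp.2.2.2
  · have e : reflAxis (axisMap f g p) = β p := by simp [hG p hp, reflAxis]
    rw [e] at hp' ⊢
    rw [hG _ hp', (hββ p hp.1.1).2]
  · obtain ⟨h1, h2⟩ := hFβ p hp.1.1 hp0 hpV
    rw [hG p hp]
    ext
    · exact h1
    · simp only [reflAxis, ← h2]
      exact (Real.sq_sqrt (hF.mapsUpper _ (Or.inl hpV))).symm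

/-- For every `C^∞`-lifted strongly billiard-like map `F` there exist a
domain `W ⊆ V` adjacent to `J` and a `C^∞`-smooth `F`-invariant function
`h̃ : W ∪ J → ℝ_{≥0}` vanishing on `J` with `∂h̃/∂y > 0` on `W ∪ J`. -/
theorem statement3 (a b : ℝ) (hab : a < b) (w : ℝ → ℝ) (V : Set (ℝ × ℝ))
    (F : ℝ × ℝ → ℝ × ℝ) (hF : IsBilliardLike a b w V F) :
    ∃ W : Set (ℝ × ℝ), W ⊆ V ∧ IsAdjDomain a b W ∧
      ∃ ht : ℝ × ℝ → ℝ,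
        ContDiffOn ℝ (⊤ : ℕ∞) ht (W ∪ Jset a b) ∧
        (∀ p ∈ W ∪ Jset a b, 0 ≤ ht p) ∧
        (∀ s ∈ Set.Ioo a b, ht (s, 0) = 0) ∧
        (∀ p ∈ W ∪ Jset a b, F p ∈ W ∪ Jset a b → ht (F p) = ht p) ∧
        (∀ p ∈ W ∪ Jset a b,
          0 < fderivWithin ℝ ht (W ∪ Jset a b) p (0, 1)) := by
  obtain ⟨N, f, g, hfg, hf, hG, hrev, hFG⟩ := hF.exists_isAxisData
  obtain ⟨ht, ht0, hht⟩ := hfg.exists_invariant hab hf hG hrev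
  set P : Set (ℝ × ℝ) := {q | (ContDiffAt ℝ ∞ ht q ∧ 0 < fderiv ℝ ht q (0, 1)) ∧
    (0 < q.2 → q ∈ V ∧ ht (F q) = ht q)} with hP
  have hJP : Jset a b ⊆ interior P := by
    rintro ⟨s, y⟩ ⟨hs, hy⟩
    obtain rfl : y = 0 := hy
    obtain ⟨h1, h2⟩ := hht s hs
    obtain ⟨ε, hε, hεV⟩ := hF.adj.2.2.2 s hs
    have hroot : Filter.Tendsto (fun q : ℝ × ℝ => (q.1, √q.2)) (𝓝 (s, 0)) (𝓝 (s, 0)) := by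
      have : Continuous fun q : ℝ × ℝ => (q.1, √q.2) := by fun_prop
      simpa using this.tendsto (s, 0)
    rw [mem_interior_iff_mem_nhds]
    filter_upwards [h1, hroot.eventually h2, hroot.eventually (hfg.isOpen.mem_nhds (hfg.axis s hs)),
      (isOpen_Ioo.prod isOpen_Iio : IsOpen (Ioo (s - ε) (s + ε) ×ˢ Iio ε)).mem_nhds
        (x := (s, 0)) ⟨⟨by linarith, by linarith⟩, hε⟩] with q e1 e2 e3 e4
    refine ⟨e1, fun hq => ?_⟩
    have hqV : q ∈ V := hεV ⟨e4.1, hq, e4.2⟩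
    have hq' : (q.1, √q.2 ^ 2) = q := by rw [Real.sq_sqrt hq.le]
    have e5 := e2 (Real.sqrt_pos.2 hq)
    have e6 := hFG _ e3 (Real.sqrt_pos.2 hq) (by rwa [hq'])
    rw [hq'] at e5 e6
    exact ⟨hqV, by rw [e6, e5]⟩
  obtain ⟨W, hWP, hW, hWg⟩ := exists_isAdjDomain hab isOpen_interior hJP
  have hWJ : ∀ p ∈ W ∪ Jset a b, p ∈ P := fun p hp =>
    interior_subset (hp.elim (fun h => hWP h) fun h => hJP h)
  refine ⟨W, fun p hp => ((hWJ p (Or.inl hp)).2 (hW.2.2.1 p hp)).1, hW, ht,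
    fun p hp => (hWJ p hp).1.1.contDiffWithinAt, fun p hp => ?_, ht0, fun p hp _ => ?_,
    fun p hp => ?_⟩
  · rcases hp with hp | ⟨hp1, hp2⟩
    · obtain ⟨hp1, hpy⟩ := hWg p hp
      have hp0 := hW.2.2.1 p hp
      have hd : ∀ y ∈ Icc 0 p.2, HasDerivAt (fun y => ht (p.1, y))
          (fderiv ℝ ht (p.1, y) (0, 1)) y ∧ 0 < fderiv ℝ ht (p.1, y) (0, 1) := by
        intro y hy
        have hm : (p.1, y) ∈ P := by
          rcases hy.1.eq_or_lt with h0 | h0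
          · exact hWJ _ (Or.inr ⟨hp1, h0.symm⟩)
          · exact hWJ _ (Or.inl (hpy y ⟨h0, hy.2⟩))
        exact ⟨(hm.1.1.differentiableAt (by simp)).hasFDerivAt.comp_hasDerivAt y
          ((hasDerivAt_const y p.1).prodMk (hasDerivAt_id y)), hm.1.2⟩
      have hmono : MonotoneOn (fun y => ht (p.1, y)) (Icc 0 p.2) := by
        refine monotoneOn_of_deriv_nonneg (convex_Icc _ _)
          (fun y hy => (hd y hy).1.continuousAt.continuousWithinAt)
          (fun y hy => (hd y (interior_subset hy)).1.differentiableAt.differentiableWithinAt)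
          fun y hy => ?_
        rw [(hd y (interior_subset hy)).1.deriv]
        exact (hd y (interior_subset hy)).2.le
      have := hmono (left_mem_Icc.2 hp0.le) (right_mem_Icc.2 hp0.le) hp0.le
      simpa [ht0 p.1 hp1] using this
    · have e : p = (p.1, 0) := Prod.ext rfl hp2
      rw [e, ht0 _ hp1]
  · rcases hp with hp | ⟨hp1, hp2⟩
    · exact ((hWJ p (Or.inl hp)).2 (hW.2.2.1 p hp)).2
    · have e : p = (p.1, 0) := Prod.ext rfl hp2
      rw [e, hF.fixJ _ hp1]
  · rw [((hWJ p hp).1.1.differentiableAt (by simp)).fderivWithin (hW.uniqueDiffWithinAt hp)]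
    exact (hWJ p hp).1.2
end

section
/- (Marvizi–Melrose.) Let F : V ∪ J → ℝ×ℝ_{≥0} be a C^∞-lifted strongly billiard-like map. Then there exist a domain W ⊆ V adjacent to J and a C^∞-smooth function h : W ∪ J → ℝ_{≥0} with h ≡ 0 on J and ∂h/∂y > 0 on J, such that the difference h∘F − h is C^∞-smooth on W ∪ J and y-flat. -/
open Set

section

open Filter Topology
open scoped ContDiff

theorem ContDiff.integral_zero_one {E : Type} [NormedAddCommGroup E] [NormedSpace ℝ E]
    [ProperSpace E] (n : ℕ) :
    ∀ {G : Type} [NormedAddCommGroup G] [NormedSpace ℝ G] [CompleteSpace G] {f : E × ℝ → G},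
      ContDiff ℝ n f → ContDiff ℝ n (fun x => ∫ t in (0 : ℝ)..1, f (x, t)) := by
  induction n with
  | zero =>
    intro G _ _ _ f hf
    have hf' : Continuous f := hf.continuous
    exact contDiff_zero.2 (intervalIntegral.continuous_parametric_intervalIntegral_of_continuous'
      (f := fun x t => f (x, t)) hf' 0 1)
  | succ n ih =>
    intro G _ _ _ f hf
    have hf' : Continuous f := hf.continuous
    have hd : ContDiff ℝ n (fun p : E × ℝ => (fderiv ℝ f p).comp (.inl ℝ E ℝ)) :=
      (hf.fderiv_right (m := n) (by norm_cast)).clm_comp contDiff_const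
    have hdiff : Differentiable ℝ f := hf.differentiable (by simp)
    rw [show ((n + 1 : ℕ) : ℕ∞ω) = n + 1 by norm_cast]
    refine contDiff_succ_iff_hasFDerivAt.2 ⟨_, ih hd, fun x => ?_⟩
    obtain ⟨C, hC⟩ := ((isCompact_closedBall x 1).prod
      (isCompact_Icc (a := (0 : ℝ)) (b := 1))).exists_bound_of_continuousOn
        hd.continuous.continuousOn
    have hi : ∀ y, Continuous fun t => f (y, t) := fun y => by fun_prop
    refine intervalIntegral.hasFDerivAt_integral_of_dominated_of_fderiv_le
      (𝕜 := ℝ) (F := fun x t => f (x, t))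
      (F' := fun x t => (fderiv ℝ f (x, t)).comp (.inl ℝ E ℝ)) (bound := fun _ => C)
      (Metric.ball_mem_nhds x one_pos) ?_ ?_ ?_ ?_ ?_ ?_
    · exact Eventually.of_forall fun y => (hi y).aestronglyMeasurable
    · exact (hi x).intervalIntegrable _ _
    · exact (hd.continuous.comp (by fun_prop : Continuous fun t : ℝ => (x, t))).aestronglyMeasurable
    · refine Eventually.of_forall fun t ht y hy => hC (y, t) ⟨Metric.ball_subset_closedBall hy, ?_⟩
      rw [uIoc_of_le zero_le_one] at ht
      exact Ioc_subset_Icc_self ht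
    · exact intervalIntegrable_const
    · refine Eventually.of_forall fun t _ y _ => ?_
      exact (hdiff (y, t)).hasFDerivAt.comp y (hasFDerivAt_prodMk_left y t)

/-- **Hadamard's lemma.** -/
theorem exists_contDiffOn_snd_mul {N : Set (ℝ × ℝ)} (hN : IsOpen N) {u : ℝ × ℝ → ℝ}
    (hu : ContDiffOn ℝ ∞ u N) (h0 : ∀ s, (s, (0 : ℝ)) ∈ N → u (s, 0) = 0) :
    ∃ v : ℝ × ℝ → ℝ, ContDiffOn ℝ ∞ v N ∧ ∀ p ∈ N, u p = p.2 * v p := by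
  refine ⟨fun p => if p.2 = 0 then deriv (fun z => u (p.1, z)) 0 else u p / p.2,
    fun p hp => ?_, fun p hp => ?_⟩
  · apply ContDiffAt.contDiffWithinAt
    by_cases hz : p.2 = 0
    · obtain ⟨s₀, z₀⟩ := p
      obtain rfl : z₀ = 0 := hz
      obtain ⟨ψ, hψt, hψc, hψ, hψr, hψ1⟩ :
          ∃ ψ : ℝ × ℝ → ℝ, tsupport ψ ⊆ N ∧ HasCompactSupport ψ ∧ ContDiff ℝ ∞ ψ ∧
            range ψ ⊆ Icc 0 1 ∧ ψ =ᶠ[𝓝 (s₀, 0)] 1 := by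
        obtain ⟨ε, hε, hεN⟩ := Metric.isOpen_iff.1 hN _ hp
        let B : ContDiffBump (s₀, (0 : ℝ)) := ⟨ε / 4, ε / 2, by positivity, by linarith⟩
        refine ⟨B, ?_, B.hasCompactSupport, B.contDiff, ?_, B.eventuallyEq_one⟩
        · rw [B.tsupport_eq]
          exact (Metric.closedBall_subset_ball (by simp [B]; linarith)).trans hεN
        · rintro _ ⟨x, rfl⟩
          exact ⟨B.nonneg, B.le_one⟩
      set u₁ : ℝ × ℝ → ℝ := fun q => ψ q * u q with hu₁
      have hu₁s : ContDiff ℝ ∞ u₁ := by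
        rw [contDiff_iff_contDiffAt]
        intro q
        by_cases hq : q ∈ tsupport ψ
        · exact hψ.contDiffAt.mul (hu.contDiffAt (hN.mem_nhds (hψt hq)))
        · have : u₁ =ᶠ[𝓝 q] fun _ => 0 := by
            filter_upwards [(isClosed_tsupport ψ).isOpen_compl.mem_nhds hq] with y hy
            simp [hu₁, image_eq_zero_of_notMem_tsupport hy]
          exact contDiffAt_const.congr_of_eventuallyEq this
      have hd : ContDiff ℝ ∞ (fun p : (ℝ × ℝ) × ℝ => fderiv ℝ u₁ (p.1.1, p.2 * p.1.2) (0, 1)) := by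
        have := (hu₁s.fderiv_right (m := ∞) (by simp))
        exact (this.comp (by fun_prop)).clm_apply contDiff_const
      have hint : ContDiff ℝ ∞
          (fun p : ℝ × ℝ => ∫ t in (0 : ℝ)..1, fderiv ℝ u₁ (p.1, t * p.2) (0, 1)) :=
        contDiff_infty.2 fun n => ContDiff.integral_zero_one n (hd.of_le (by exact_mod_cast le_top))
      refine hint.contDiffAt.congr_of_eventuallyEq ?_
      obtain ⟨ε, hε, hεψ⟩ := Metric.eventually_nhds_iff_ball.1 hψ1
      filter_upwards [Metric.ball_mem_nhds _ hε, hN.mem_nhds hp] with q hq hqN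
      rw [← ball_prod_same, mem_prod] at hq
      have hzero : u (q.1, 0) = 0 ∨ ψ (q.1, 0) = 0 := by
        by_cases h : (q.1, (0 : ℝ)) ∈ N
        · exact .inl (h0 _ h)
        · exact .inr (image_eq_zero_of_notMem_tsupport fun h' => h (hψt h'))
      have hone : ∀ z ∈ Metric.ball (0 : ℝ) ε, ψ (q.1, z) = 1 := fun z hz =>
        hεψ _ (by rw [← ball_prod_same]; exact ⟨hq.1, hz⟩)
      have hu0 : u (q.1, 0) = 0 := by
        rcases hzero with h | h
        · exact h
        · simp [hone 0 (Metric.mem_ball_self hε)] at h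
      have hline : ∀ z, HasDerivAt (fun z => u₁ (q.1, z)) (fderiv ℝ u₁ (q.1, z) (0, 1)) z := by
        intro z
        have h1 := ((hu₁s.differentiable (by simp)) (q.1, z)).hasFDerivAt
        exact h1.comp_hasDerivAt z ((hasDerivAt_const z q.1).prodMk (hasDerivAt_id z))
      by_cases hz : q.2 = 0
      · rw [if_pos hz, hz]
        simp only [mul_zero, intervalIntegral.integral_const, sub_zero, one_smul]
        rw [← (hline 0).deriv]
        refine Filter.EventuallyEq.deriv_eq ?_
        filter_upwards [Metric.ball_mem_nhds (0 : ℝ) hε] with z hz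
        simp [hu₁, hone z hz]
      · rw [if_neg hz]
        have hftc : ∫ t in (0 : ℝ)..1, (fderiv ℝ u₁ (q.1, t * q.2) (0, 1)) * q.2
            = u₁ (q.1, 1 * q.2) - u₁ (q.1, 0 * q.2) := by
          refine intervalIntegral.integral_eq_sub_of_hasDerivAt
            (f := fun t => u₁ (q.1, t * q.2)) (fun t _ => ?_) ?_
          · have := (hline (t * q.2)).comp t ((hasDerivAt_id t).mul_const q.2)
            simpa [Function.comp_def] using this
          · refine Continuous.intervalIntegrable ?_ _ _
            have := hd.continuous
            have h2 : Continuous fun t : ℝ => ((q, t) : (ℝ × ℝ) × ℝ) := by fun_prop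
            exact (this.comp h2).mul continuous_const
        rw [intervalIntegral.integral_mul_const] at hftc
        rw [div_eq_iff hz, hftc]
        simp [hu₁, hone q.2 hq.2, hu0]
    · have h1 : ContDiffAt ℝ ∞ (fun q => u q / q.2) p :=
        (hu.contDiffAt (hN.mem_nhds hp)).div contDiffAt_snd hz
      refine h1.congr_of_eventuallyEq ?_
      filter_upwards [continuous_snd.continuousAt.eventually_ne hz] with q hq
      rw [if_neg hq]
  · by_cases hz : p.2 = 0
    · rw [hz, zero_mul, ← h0 p.1 (by rw [← hz]; exact hp), ← hz]
    · simp only [if_neg hz]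
      field_simp

theorem isOpen_setOf_sqrt_mem {N : Set (ℝ × ℝ)} (hN : IsOpen N) :
    IsOpen {p : ℝ × ℝ | (p.1, √p.2) ∈ N} :=
  hN.preimage (by fun_prop)

theorem hasFDerivAt_sqrt_pow_mul {N : Set (ℝ × ℝ)} (hN : IsOpen N) {v : ℝ × ℝ → ℝ}
    (hv : ContDiffOn ℝ ∞ v N) (m : ℕ) {p : ℝ × ℝ} (hp : (p.1, √p.2) ∈ N) :
    HasFDerivAt (fun p : ℝ × ℝ => √p.2 ^ (m + 3) * v (p.1, √p.2))
      ((√p.2 ^ (m + 3) * fderiv ℝ v (p.1, √p.2) (1, 0)) • ContinuousLinearMap.fst ℝ ℝ ℝ +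
        (√p.2 ^ (m + 1) * (((m + 3) * v (p.1, √p.2) +
          √p.2 * fderiv ℝ v (p.1, √p.2) (0, 1)) / 2)) • ContinuousLinearMap.snd ℝ ℝ ℝ) p := by
  rcases lt_trichotomy p.2 0 with hy | hy | hy
  · have h0 : √p.2 = 0 := Real.sqrt_eq_zero_of_nonpos hy.le
    simp only [h0, ne_eq, Nat.add_eq_zero_iff, OfNat.ofNat_ne_zero, one_ne_zero, and_false,
      not_false_eq_true, zero_pow, zero_mul, zero_smul, add_zero]
    refine (hasFDerivAt_const (0 : ℝ) p).congr_of_eventuallyEq ?_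
    filter_upwards [continuous_snd.continuousAt.eventually_lt continuousAt_const hy] with q hq
    simp [Real.sqrt_eq_zero_of_nonpos (le_of_lt hq)]
  · have h0 : √p.2 = 0 := by simp [hy]
    have hk : ContinuousAt (fun q : ℝ × ℝ => √q.2 ^ (m + 1) * v (q.1, √q.2)) p := by
      have h1 : ContinuousAt v (p.1, √p.2) := (hv.contDiffAt (hN.mem_nhds hp)).continuousAt
      have h2 : ContinuousAt (fun q : ℝ × ℝ => (q.1, √q.2)) p := by fun_prop
      have h3 : ContinuousAt (fun q : ℝ × ℝ => v (q.1, √q.2)) p :=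
        ContinuousAt.comp (f := fun q : ℝ × ℝ => (q.1, √q.2)) h1 h2
      fun_prop
    have hk0 : (fun q : ℝ × ℝ => √q.2 ^ (m + 1) * v (q.1, √q.2)) =o[𝓝 p] fun _ => (1 : ℝ) := by
      rw [Asymptotics.isLittleO_one_iff]
      have := hk.tendsto
      simpa [h0] using this
    have hO : (fun q : ℝ × ℝ => q.2) =O[𝓝 p] fun q => q - p := by
      refine Asymptotics.IsBigO.of_bound 1 (Eventually.of_forall fun q => ?_)
      have := norm_snd_le (q - p)
      simpa [hy] using this
    simp only [h0, ne_eq, Nat.add_eq_zero_iff, OfNat.ofNat_ne_zero, one_ne_zero, and_false,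
      not_false_eq_true, zero_pow, zero_mul, zero_smul, add_zero]
    refine HasFDerivAt.of_isLittleO ?_
    have := hO.norm_right.mul_isLittleO hk0
    refine (this.congr' ?_ ?_).of_norm_right
    · refine Eventually.of_forall fun q => ?_
      simp only [h0, ne_eq, Nat.add_eq_zero_iff, OfNat.ofNat_ne_zero, and_false,
        not_false_eq_true, zero_pow, zero_mul, sub_zero, zero_apply]
      rcases le_total q.2 0 with hq | hq
      · simp [Real.sqrt_eq_zero_of_nonpos hq]
      · have h4 := Real.mul_self_sqrt hq
        calc q.2 * (√q.2 ^ (m + 1) * v (q.1, √q.2))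
            = (√q.2 * √q.2) * (√q.2 ^ (m + 1) * v (q.1, √q.2)) := by rw [h4]
          _ = _ := by ring
    · exact Eventually.of_forall fun q => by simp
  · have hs : √p.2 ≠ 0 := (Real.sqrt_pos.2 hy).ne'
    have h1 : HasFDerivAt (fun q : ℝ × ℝ => √q.2)
        ((1 / (2 * √p.2)) • ContinuousLinearMap.snd ℝ ℝ ℝ) p :=
      (Real.hasDerivAt_sqrt hy.ne').comp_hasFDerivAt p hasFDerivAt_snd
    have h2 := (hv.contDiffAt (hN.mem_nhds hp)).differentiableAt (by simp) |>.hasFDerivAt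
    have h3 := h2.comp p ((hasFDerivAt_fst (p := p)).prodMk h1)
    have h4 := (h1.pow (m + 3)).mul h3
    refine h4.congr_fderiv ?_
    ext
    · simp
    · simp only [ContinuousLinearMap.coe_comp, Function.comp_apply,
        ContinuousLinearMap.inr_apply, add_apply,
        smul_apply, ContinuousLinearMap.prod_apply,
        ContinuousLinearMap.coe_fst', ContinuousLinearMap.coe_snd', smul_eq_mul, mul_one, mul_zero,
        zero_add]
      rw [show ((0 : ℝ), 1 / (2 * √p.2)) = (1 / (2 * √p.2)) • ((0 : ℝ), (1 : ℝ)) by simp, map_smul]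
      simp
      field_simp
      ring

theorem contDiffOn_sqrt_pow_mul {N : Set (ℝ × ℝ)} (hN : IsOpen N) (n : ℕ) :
    ∀ (m : ℕ) {v : ℝ × ℝ → ℝ}, ContDiffOn ℝ ∞ v N →
    ContDiffOn ℝ n (fun p : ℝ × ℝ => √p.2 ^ (m + 2 * n + 1) * v (p.1, √p.2))
      {p | (p.1, √p.2) ∈ N} := by
  induction n with
  | zero =>
    intro m v hv
    have h3 : ContinuousOn (fun q : ℝ × ℝ => v (q.1, √q.2)) {p | (p.1, √p.2) ∈ N} :=
      hv.continuousOn.comp (by fun_prop) fun p hp => hp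
    have h4 : Continuous fun p : ℝ × ℝ => √p.2 ^ (m + 2 * 0 + 1) := by fun_prop
    exact contDiffOn_zero.2 (h4.continuousOn.mul h3)
  | succ n ih =>
    intro m v hv
    have hdv : ContDiffOn ℝ ∞ (fderiv ℝ v) N := hv.fderiv_of_isOpen hN (by simp)
    have hd := fun p (hp : p ∈ {p : ℝ × ℝ | (p.1, √p.2) ∈ N}) =>
      hasFDerivAt_sqrt_pow_mul hN hv (m + 2 * n) hp
    rw [show ((n + 1 : ℕ) : ℕ∞ω) = n + 1 by norm_cast,
      contDiffOn_succ_iff_fderiv_of_isOpen (isOpen_setOf_sqrt_mem hN),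
      show m + 2 * (n + 1) + 1 = m + 2 * n + 3 by ring]
    refine ⟨fun p hp => (hd p hp).differentiableAt.differentiableWithinAt, by simp, ?_⟩
    have h1 := ih (m + 2) (v := fun q => fderiv ℝ v q (1, 0)) (hdv.clm_apply contDiffOn_const)
    have h2 := ih m (v := fun q => (((m + 2 * n : ℕ) + 3) * v q + q.2 * fderiv ℝ v q (0, 1)) / 2)
      (((contDiffOn_const.mul hv).add
        (contDiffOn_snd.mul (hdv.clm_apply contDiffOn_const))).div_const _)
    refine ((h1.smul (contDiffOn_const (c := ContinuousLinearMap.fst ℝ ℝ ℝ))).add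
      (h2.smul (contDiffOn_const (c := ContinuousLinearMap.snd ℝ ℝ ℝ)))).congr fun p hp => ?_
    rw [(hd p hp).fderiv]
    simp only [Pi.smul_apply']
    ring_nf

/-- A function of `(s, z)` which is flat along `z = 0` is smooth as a function of `(s, z ^ 2)`. -/
theorem contDiffOn_comp_sqrt {N : Set (ℝ × ℝ)} (hN : IsOpen N) {u : ℝ × ℝ → ℝ}
    (hu : ∀ n : ℕ, ∃ v : ℝ × ℝ → ℝ, ContDiffOn ℝ ∞ v N ∧ ∀ p ∈ N, u p = p.2 ^ n * v p) :
    ContDiffOn ℝ ∞ (fun p : ℝ × ℝ => u (p.1, √p.2)) {p | (p.1, √p.2) ∈ N} := by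
  refine contDiffOn_infty.2 fun n => ?_
  obtain ⟨v, hv, huv⟩ := hu (0 + 2 * n + 1)
  exact (contDiffOn_sqrt_pow_mul hN n 0 hv).congr fun p hp => huv _ hp

theorem iteratedFDeriv_comp_sqrt_eq_zero {N : Set (ℝ × ℝ)} (hN : IsOpen N) {u : ℝ × ℝ → ℝ}
    (hu : ∀ n : ℕ, ∃ v : ℝ × ℝ → ℝ, ContDiffOn ℝ ∞ v N ∧ ∀ p ∈ N, u p = p.2 ^ n * v p)
    (n : ℕ) {s : ℝ} (hs : (s, (0 : ℝ)) ∈ N) :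
    iteratedFDeriv ℝ n (fun p : ℝ × ℝ => u (p.1, √p.2)) (s, 0) = 0 := by
  have hO := isOpen_setOf_sqrt_mem hN
  have hsO : (s, (0 : ℝ)) ∈ {p : ℝ × ℝ | (p.1, √p.2) ∈ N} := by simpa using hs
  have hcont : ContinuousAt (iteratedFDeriv ℝ n fun p : ℝ × ℝ => u (p.1, √p.2)) (s, 0) :=
    ((contDiffOn_comp_sqrt hN hu).contDiffAt (hO.mem_nhds hsO)).continuousAt_iteratedFDeriv
      (by exact_mod_cast le_top)
  have hline : Tendsto (fun t : ℝ => (s, t)) (𝓝[<] 0) (𝓝 (s, 0)) :=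
    ((by fun_prop : Continuous fun t : ℝ => (s, t)).tendsto 0).mono_left nhdsWithin_le_nhds
  refine tendsto_nhds_unique (hcont.tendsto.comp hline) (tendsto_const_nhds.congr' ?_)
  filter_upwards [hline (hO.mem_nhds hsO), self_mem_nhdsWithin] with t ht ht0
  have : (fun p : ℝ × ℝ => u (p.1, √p.2)) =ᶠ[𝓝 (s, t)] fun _ => 0 := by
    filter_upwards [hO.mem_nhds ht, continuous_snd.continuousAt.eventually_lt
      (continuousAt_const (y := (0 : ℝ))) ht0] with q hq hq0
    obtain ⟨v, -, huv⟩ := hu 1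
    rw [huv _ hq]
    simp [Real.sqrt_eq_zero_of_nonpos (le_of_lt hq0)]
  rw [Function.comp_apply, (this.iteratedFDeriv ℝ n).eq_of_nhds]
  simp

theorem eventually_norm_iteratedFDeriv_mul_pow_mul_le {e χ : ℝ → ℝ} (he : ContDiff ℝ ∞ e)
    (hec : HasCompactSupport e) (hχ : ContDiff ℝ ∞ χ) (hχc : HasCompactSupport χ)
    {m l : ℕ} (hml : m < l) {ε : ℝ} (hε : 0 < ε) :
    ∀ᶠ r : ℝ in atTop, ∀ p : ℝ × ℝ,
      ‖iteratedFDeriv ℝ m (fun p : ℝ × ℝ => e p.1 * (p.2 ^ l * χ (r * p.2))) p‖ ≤ ε := by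
  set Φ : ℝ × ℝ → ℝ := fun p => e p.1 * (p.2 ^ l * χ p.2) with hΦ
  have hΦs : ContDiff ℝ ∞ Φ := by fun_prop
  have hΦc : HasCompactSupport Φ := by
    refine HasCompactSupport.intro (hec.prod hχc) fun p hp => ?_
    rw [mem_prod, not_and_or] at hp
    rcases hp with hp | hp
    · simp [hΦ, image_eq_zero_of_notMem_tsupport hp]
    · simp [hΦ, image_eq_zero_of_notMem_tsupport hp]
  obtain ⟨C, hC⟩ := (hΦs.continuous_iteratedFDeriv (m := m)
    (by exact_mod_cast le_top)).bounded_above_of_compact_support (hΦc.iteratedFDeriv m)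
  filter_upwards [eventually_ge_atTop (1 : ℝ), eventually_ge_atTop (C / ε)] with r hr1 hrC p
  have hr0 : 0 < r := one_pos.trans_le hr1
  let L : ℝ × ℝ →L[ℝ] ℝ × ℝ :=
    (ContinuousLinearMap.fst ℝ ℝ ℝ).prod (r • ContinuousLinearMap.snd ℝ ℝ ℝ)
  have hL : ‖L‖ ≤ r := by
    refine ContinuousLinearMap.opNorm_le_bound _ hr0.le fun q => ?_
    simp only [L, ContinuousLinearMap.prod_apply, ContinuousLinearMap.coe_fst', smul_apply,
      ContinuousLinearMap.coe_snd', Prod.norm_def, smul_eq_mul, norm_mul, Real.norm_of_nonneg hr0.le]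
    refine max_le ?_ ?_
    · exact (le_max_left _ _).trans (le_mul_of_one_le_left (by positivity) hr1)
    · gcongr
      exact le_max_right _ _
  have heq : (fun p : ℝ × ℝ => e p.1 * (p.2 ^ l * χ (r * p.2))) = (r ^ l)⁻¹ • (Φ ∘ L) := by
    ext q
    simp only [hΦ, L, Pi.smul_apply, Function.comp_apply, ContinuousLinearMap.prod_apply,
      ContinuousLinearMap.coe_fst', smul_apply, ContinuousLinearMap.coe_snd', smul_eq_mul]
    field_simp
    ring
  have hC0 : 0 ≤ C := (norm_nonneg _).trans (hC 0)
  rw [heq, iteratedFDeriv_const_smul_apply (by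
      exact ((hΦs.comp L.contDiff).of_le (by exact_mod_cast le_top)).contDiffAt),
    norm_smul, L.iteratedFDeriv_comp_right hΦs p (by exact_mod_cast le_top)]
  have h1 : ‖(iteratedFDeriv ℝ m Φ (L p)).compContinuousLinearMap fun _ => L‖ ≤ C * r ^ m := by
    refine (ContinuousMultilinearMap.norm_compContinuousLinearMap_le _ _).trans ?_
    rw [Finset.prod_const, Finset.card_univ, Fintype.card_fin]
    gcongr
    exact hC _
  calc ‖(r ^ l)⁻¹‖ * ‖(iteratedFDeriv ℝ m Φ (L p)).compContinuousLinearMap fun _ => L‖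
      ≤ (r ^ l)⁻¹ * (C * r ^ m) := by
        rw [Real.norm_of_nonneg (by positivity)]
        gcongr
    _ ≤ (r ^ (m + 1))⁻¹ * (C * r ^ m) := by
        gcongr
        exact hml
    _ = C / r := by
        field_simp
        ring
    _ ≤ ε := by
        rw [div_le_iff₀ hε] at hrC
        rw [div_le_iff₀ hr0]
        linarith

theorem exists_contDiff_cutoff_Ioo (a b : ℝ) :
    ∃ φ : ℕ → ℝ → ℝ, (∀ k, ContDiff ℝ ∞ (φ k)) ∧ (∀ k, HasCompactSupport (φ k)) ∧
      (∀ k, tsupport (φ k) ⊆ Ioo a b) ∧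
      ∀ s ∈ Ioo a b, ∃ j, ∀ᶠ s' in 𝓝 s, ∀ k ≥ j, φ k s' = 1 := by
  rcases le_or_gt b a with hab | hab
  · refine ⟨fun _ _ => 0, fun _ => contDiff_const, fun _ => HasCompactSupport.zero, fun _ => ?_, ?_⟩
    · simp [tsupport]
    · simp [Ioo_eq_empty_of_le hab]
  set d := (b - a) / 2 with hd
  have hd0 : 0 < d := by simp only [hd]; linarith
  let B : ℕ → ContDiffBump ((a + b) / 2) := fun k =>
    ⟨d * ((k + 1) / (k + 2)), d * ((k + 2) / (k + 3)), by positivity, by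
      gcongr ?_ * ?_
      rw [div_lt_div_iff₀ (by positivity) (by positivity)]
      nlinarith⟩
  refine ⟨fun k => B k, fun k => (B k).contDiff, fun k => (B k).hasCompactSupport, fun k => ?_,
    fun s hs => ?_⟩
  · rw [(B k).tsupport_eq, Real.closedBall_eq_Icc]
    have h1 : ((k : ℝ) + 2) / (k + 3) < 1 := by
      rw [div_lt_one (by positivity)]
      linarith
    have h2 : (B k).rOut < d := by
      have := mul_lt_mul_of_pos_left h1 hd0
      simpa [B] using this
    exact Icc_subset_Ioo (by linarith) (by linarith)
  · have hsd : dist s ((a + b) / 2) < d := by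
      rw [Real.dist_eq, abs_lt]
      constructor <;> linarith [hs.1, hs.2]
    have hlim : Tendsto (fun k : ℕ => d * (((k : ℝ) + 1) / (k + 2))) atTop (𝓝 (d * 1)) := by
      refine tendsto_const_nhds.mul ?_
      refine ((tendsto_natCast_div_add_atTop (1 : ℝ)).comp (tendsto_add_atTop_nat 1)).congr
        fun k => ?_
      simp only [Function.comp_apply, Nat.cast_add, Nat.cast_one]
      ring_nf
    rw [mul_one] at hlim
    obtain ⟨ρ, hρ1, hρ2⟩ := exists_between hsd
    obtain ⟨j, hj⟩ := (hlim.eventually_const_lt hρ2).exists_forall_of_atTop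
    refine ⟨j, ?_⟩
    filter_upwards [(continuous_id.dist continuous_const).continuousAt.eventually_lt
      continuousAt_const hρ1] with s' hs' k hk
    exact (B k).one_of_mem_closedBall (hs'.le.trans (hj k hk).le)

/-- **Borel's lemma** with a parameter. -/
theorem exists_borel_sum (a b : ℝ) {c : ℕ → ℝ → ℝ} (hc : ∀ k, ContDiffOn ℝ ∞ (c k) (Ioo a b)) :
    ∃ H : ℝ × ℝ → ℝ, ∀ n, ∃ R : ℝ × ℝ → ℝ, ContDiffOn ℝ ∞ R (Ioo a b ×ˢ univ) ∧
      ∀ p : ℝ × ℝ, H p = ∑ k ∈ Finset.range n, c k p.1 * p.2 ^ k + p.2 ^ n * R p := by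
  obtain ⟨φ, hφ, hφc, hφs, hφ1⟩ := exists_contDiff_cutoff_Ioo a b
  let χ : ContDiffBump (0 : ℝ) := ⟨1, 2, one_pos, one_lt_two⟩
  have he : ∀ k, ContDiff ℝ ∞ (fun s => φ k s * c k s) := by
    intro k
    rw [contDiff_iff_contDiffAt]
    intro s
    by_cases hs : s ∈ tsupport (φ k)
    · exact (hφ k).contDiffAt.mul ((hc k).contDiffAt (isOpen_Ioo.mem_nhds (hφs k hs)))
    · have : (fun s => φ k s * c k s) =ᶠ[𝓝 s] fun _ => 0 := by
        filter_upwards [(isClosed_tsupport (φ k)).isOpen_compl.mem_nhds hs] with y hy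
        simp [image_eq_zero_of_notMem_tsupport hy]
      exact contDiffAt_const.congr_of_eventuallyEq this
  have hr : ∀ k : ℕ, ∃ r : ℝ, k ≤ r ∧ 1 ≤ r ∧ ∀ l ∈ Finset.range (k + 1), ∀ m ∈ Finset.range l,
      ∀ p : ℝ × ℝ, ‖iteratedFDeriv ℝ m
        (fun p : ℝ × ℝ => φ k p.1 * c k p.1 * (p.2 ^ l * χ (r * p.2))) p‖ ≤ (1 / 2) ^ k := by
    intro k
    refine ((eventually_ge_atTop (k : ℝ)).and ((eventually_ge_atTop (1 : ℝ)).and ?_)).exists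
    refine (Filter.eventually_all_finset _).2 fun l _ => (Filter.eventually_all_finset _).2
      fun m hm => ?_
    exact eventually_norm_iteratedFDeriv_mul_pow_mul_le (he k) (hφc k).mul_right χ.contDiff
      χ.hasCompactSupport (Finset.mem_range.1 hm) (by positivity)
  choose r hrk hr1 hr using hr
  have hχ0 : ∀ y : ℝ, y ≠ 0 → ∃ K, ∀ k ≥ K, χ (r k * y) = 0 := by
    intro y hy
    obtain ⟨K, hK⟩ := exists_nat_ge (2 / |y|)
    refine ⟨K, fun k hk => χ.zero_of_le_dist ?_⟩
    have h1 : (2 : ℝ) / |y| ≤ r k := hK.trans ((Nat.cast_le.2 hk).trans (hrk k))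
    rw [div_le_iff₀ (abs_pos.2 hy)] at h1
    rw [Real.dist_eq, sub_zero, abs_mul, abs_of_pos (one_pos.trans_le (hr1 k))]
    exact h1
  have hsum : ∀ (n : ℕ) (p : ℝ × ℝ),
      Summable fun k => c (k + n) p.1 * (p.2 ^ k * χ (r (k + n) * p.2)) := by
    intro n p
    by_cases hp : p.2 = 0
    · refine summable_of_ne_finset_zero (s := {0}) fun k hk => ?_
      have : k ≠ 0 := by simpa using hk
      simp [hp, this]
    · obtain ⟨K, hK⟩ := hχ0 p.2 hp
      refine summable_of_ne_finset_zero (s := Finset.range K) fun k hk => ?_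
      have : K ≤ k := by simpa using hk
      simp [hK (k + n) (by omega)]
  have htail : ∀ n : ℕ, ContDiffOn ℝ ∞
      (fun p : ℝ × ℝ => ∑' k, c (k + n) p.1 * (p.2 ^ k * χ (r (k + n) * p.2)))
      (Ioo a b ×ˢ univ) := by
    intro n p hp
    apply ContDiffAt.contDiffWithinAt
    obtain ⟨j, hj⟩ := hφ1 p.1 hp.1
    have hglob : ContDiff ℝ ∞ fun p : ℝ × ℝ => ∑' k, φ (k + j + n) p.1 * c (k + j + n) p.1 *
        (p.2 ^ (k + j) * χ (r (k + j + n) * p.2)) := by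
      refine contDiff_tsum_of_eventually (v := fun _ k => (1 / 2) ^ k) (fun k => ?_)
        (fun _ _ => summable_geometric_two) fun m _ => ?_
      · exact ((he _).comp contDiff_fst).mul ((contDiff_snd.pow _).mul
          (χ.contDiff.comp (contDiff_const.mul contDiff_snd)))
      · rw [Nat.cofinite_eq_atTop]
        filter_upwards [eventually_gt_atTop m] with k hk q
        refine (hr (k + j + n) (k + j) ?_ m ?_ q).trans ?_
        · simp
        · simp only [Finset.mem_range]
          omega
        · exact pow_le_pow_of_le_one (by norm_num) (by norm_num) (by omega)
    have hfin : ContDiffAt ℝ ∞ (fun p : ℝ × ℝ => ∑ k ∈ Finset.range j,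
        c (k + n) p.1 * (p.2 ^ k * χ (r (k + n) * p.2))) p := by
      refine ContDiffAt.sum fun k _ => ?_
      exact (((hc _).contDiffAt (isOpen_Ioo.mem_nhds hp.1)).comp p contDiffAt_fst).mul
        ((contDiff_snd.pow _).mul
          (χ.contDiff.comp (contDiff_const.mul contDiff_snd))).contDiffAt
    refine (hfin.add hglob.contDiffAt).congr_of_eventuallyEq ?_
    filter_upwards [continuous_fst.continuousAt.eventually hj] with q hq
    rw [← (hsum n q).sum_add_tsum_nat_add j]
    congr 1
    refine tsum_congr fun k => ?_
    rw [hq (k + j + n) (by omega), one_mul]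
  have hψ : ∀ k n : ℕ, ContDiff ℝ ∞ fun y : ℝ => (χ (r k * y) - 1) / y ^ n := by
    intro k n
    rw [contDiff_iff_contDiffAt]
    intro y
    by_cases hy : y = 0
    · subst hy
      have h1 : Tendsto (fun y : ℝ => r k * y) (𝓝 0) (𝓝 0) := by
        simpa using (by fun_prop : Continuous fun y : ℝ => r k * y).tendsto 0
      have : (fun y : ℝ => (χ (r k * y) - 1) / y ^ n) =ᶠ[𝓝 0] fun _ => 0 := by
        filter_upwards [h1.eventually χ.eventuallyEq_one] with y hy
        simp [hy]
      exact contDiffAt_const.congr_of_eventuallyEq this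
    · exact ((χ.contDiff.comp (contDiff_const.mul contDiff_id)).sub contDiff_const).contDiffAt.div
        (contDiff_id.pow n).contDiffAt (pow_ne_zero n hy)
  refine ⟨fun p => ∑' k, c k p.1 * (p.2 ^ k * χ (r k * p.2)), fun n => ⟨fun p =>
    ∑ k ∈ Finset.range n, c k p.1 * (p.2 ^ k * ((χ (r k * p.2) - 1) / p.2 ^ n)) +
      ∑' k, c (k + n) p.1 * (p.2 ^ k * χ (r (k + n) * p.2)), ?_, fun p => ?_⟩⟩
  · refine ContDiffOn.add (ContDiffOn.sum fun k _ => ?_) (htail n)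
    exact ((hc k).comp contDiffOn_fst fun p hp => hp.1).mul
      ((contDiff_snd.pow _).mul ((hψ k n).comp contDiff_snd)).contDiffOn
  · have h0 := hsum 0 p
    simp only [add_zero] at h0
    beta_reduce
    rw [← h0.sum_add_tsum_nat_add n, mul_add, ← add_assoc, Finset.mul_sum,
      ← Finset.sum_add_distrib, ← tsum_mul_left]
    congr 1
    · refine Finset.sum_congr rfl fun k hk => ?_
      by_cases hp : p.2 = 0
      · have hn : n ≠ 0 := by
          rintro rfl
          simp at hk
        have h1 : χ 0 = 1 := χ.eventuallyEq_one.eq_of_nhds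
        simp [hp, hn, h1]
      · field_simp
        ring
    · exact tsum_congr fun k => by ring

theorem exists_contDiffOn_primitive {a b : ℝ} {f : ℝ → ℝ} (hf : ContDiffOn ℝ ∞ f (Ioo a b)) :
    ∃ Φ : ℝ → ℝ, ContDiffOn ℝ ∞ Φ (Ioo a b) ∧ ∀ s ∈ Ioo a b, HasDerivAt Φ (f s) s := by
  have hd : ∀ s ∈ Ioo a b, HasDerivAt (fun s => ∫ x in ((a + b) / 2)..s, f x) (f s) s := by
    intro s hs
    have hm : (a + b) / 2 ∈ Ioo a b := by
      have := hs.1.trans hs.2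
      constructor <;> linarith
    have hsub : uIcc ((a + b) / 2) s ⊆ Ioo a b := ordConnected_Ioo.uIcc_subset hm hs
    exact intervalIntegral.integral_hasDerivAt_right
      (hf.continuousOn.mono hsub).intervalIntegrable
      (hf.continuousOn.stronglyMeasurableAtFilter isOpen_Ioo s hs)
      (hf.continuousOn.continuousAt (isOpen_Ioo.mem_nhds hs))
  refine ⟨_, ?_, hd⟩
  rw [contDiffOn_infty_iff_deriv_of_isOpen isOpen_Ioo]
  exact ⟨fun s hs => (hd s hs).differentiableAt.differentiableWithinAt,
    hf.congr fun s hs => (hd s hs).deriv⟩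

theorem hasDerivAt_mul_slice {N : Set (ℝ × ℝ)} (hN : IsOpen N) {g : ℝ × ℝ → ℝ}
    (hg : ContDiffOn ℝ ∞ g N) {s : ℝ} (hs : (s, (0 : ℝ)) ∈ N) :
    HasDerivAt (fun z => z * g (s, z)) (g (s, 0)) 0 := by
  have h1 : DifferentiableAt ℝ g (s, 0) :=
    (hg.contDiffAt (hN.mem_nhds hs)).differentiableAt (by simp)
  have h2 := h1.hasFDerivAt.comp_hasDerivAt 0 ((hasDerivAt_const 0 s).prodMk (hasDerivAt_id 0))
  exact ((hasDerivAt_id (0 : ℝ)).mul h2).congr_deriv (by simp)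

/-- An involution `β` of a neighbourhood `N` of `(a, b) × {0}`, written as
`β (s, z) = (s + z A (s, z), -z (1 + z Q (s, z)))`. -/
structure IsFoldInvolution (a b : ℝ) (N : Set (ℝ × ℝ)) (β : ℝ × ℝ → ℝ × ℝ)
    (A Q : ℝ × ℝ → ℝ) : Prop where
  isOpen : IsOpen N
  fst_mem : ∀ p ∈ N, p.1 ∈ Ioo a b
  mem : ∀ s ∈ Ioo a b, (s, (0 : ℝ)) ∈ N
  mapsTo : ∀ p ∈ N, β p ∈ N
  involutive : ∀ p ∈ N, β (β p) = p
  contDiffOn_A : ContDiffOn ℝ ∞ A N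
  contDiffOn_Q : ContDiffOn ℝ ∞ Q N
  fst_eq : ∀ p ∈ N, (β p).1 = p.1 + p.2 * A p
  snd_eq : ∀ p ∈ N, (β p).2 = -(p.2 * (1 + p.2 * Q p))
  A_ne_zero : ∀ s ∈ Ioo a b, A (s, 0) ≠ 0

namespace IsFoldInvolution

variable {a b : ℝ} {N : Set (ℝ × ℝ)} {β : ℝ × ℝ → ℝ × ℝ} {A Q : ℝ × ℝ → ℝ}

theorem contDiffOn_slice (h : IsFoldInvolution a b N β A Q) {f : ℝ × ℝ → ℝ}
    (hf : ContDiffOn ℝ ∞ f N) : ContDiffOn ℝ ∞ (fun s => f (s, 0)) (Ioo a b) :=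
  hf.comp (by fun_prop) fun s hs => h.mem s hs

theorem contDiffOn_apply_fst (h : IsFoldInvolution a b N β A Q) :
    ContDiffOn ℝ ∞ (fun p => (β p).1) N :=
  (contDiffOn_fst.add (contDiffOn_snd.mul h.contDiffOn_A)).congr h.fst_eq

theorem contDiffOn_apply_snd (h : IsFoldInvolution a b N β A Q) :
    ContDiffOn ℝ ∞ (fun p => (β p).2) N :=
  (contDiffOn_snd.mul (contDiffOn_const.add (contDiffOn_snd.mul h.contDiffOn_Q))).neg.congr h.snd_eq

theorem apply_zero (h : IsFoldInvolution a b N β A Q) {s : ℝ} (hs : (s, (0 : ℝ)) ∈ N) :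
    β (s, 0) = (s, 0) :=
  Prod.ext (by simp [h.fst_eq _ hs]) (by simp [h.snd_eq _ hs])

/-- The anti-invariance under the involution forces even order terms to vanish. -/
theorem apply_zero_of_even (h : IsFoldInvolution a b N β A Q) {u r : ℝ × ℝ → ℝ} (m : ℕ)
    (hr : ContDiffOn ℝ ∞ r N) (hu : ∀ p ∈ N, u p = p.2 ^ (2 * m) * r p)
    (hanti : ∀ p ∈ N, u (β p) = -u p) {s : ℝ} (hs : (s, (0 : ℝ)) ∈ N) : r (s, 0) = 0 := by
  have hβ : ContDiffOn ℝ ∞ β N := h.contDiffOn_apply_fst.prodMk h.contDiffOn_apply_snd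
  have hcont : ContinuousAt
      (fun z => (1 + z * Q (s, z)) ^ (2 * m) * r (β (s, z)) + r (s, z)) 0 := by
    have h1 : ContDiffOn ℝ ∞ (fun p => (1 + p.2 * Q p) ^ (2 * m) * r (β p) + r p) N :=
      (((contDiffOn_const.add (contDiffOn_snd.mul h.contDiffOn_Q)).pow _).mul
        (hr.comp hβ h.mapsTo)).add hr
    have h2 : ContinuousAt (fun z : ℝ => (s, z)) 0 := by fun_prop
    exact ContinuousAt.comp (f := fun z : ℝ => (s, z))
      (h1.contDiffAt (h.isOpen.mem_nhds hs)).continuousAt h2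
  have hev : ∀ᶠ z in 𝓝[≠] (0 : ℝ), (s, z) ∈ N := by
    have h2 : ContinuousAt (fun z : ℝ => (s, z)) 0 := by fun_prop
    exact (h2.eventually (h.isOpen.mem_nhds hs)).filter_mono nhdsWithin_le_nhds
  have h0 : (1 + 0 * Q (s, 0)) ^ (2 * m) * r (β (s, 0)) + r (s, 0) = 0 := by
    refine tendsto_nhds_unique (hcont.tendsto.mono_left (nhdsWithin_le_nhds (s := {0}ᶜ)))
      (tendsto_const_nhds.congr' ?_)
    filter_upwards [hev, self_mem_nhdsWithin] with z hz hz0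
    have h1 := hanti _ hz
    rw [hu _ hz, hu _ (h.mapsTo _ hz), h.snd_eq _ hz, Even.neg_pow (even_two_mul m), mul_pow] at h1
    have h2 : z ^ (2 * m) ≠ 0 := pow_ne_zero _ hz0
    refine (mul_left_cancel₀ h2 ?_).symm
    simp only at h1
    linear_combination h1
  rw [h.apply_zero hs] at h0
  simp only [zero_mul, add_zero, one_pow, one_mul] at h0
  linarith

theorem exists_step (h : IsFoldInvolution a b N β A Q) (n : ℕ) {u r : ℝ × ℝ → ℝ}
    (hr : ContDiffOn ℝ ∞ r N) (hu : ∀ p ∈ N, u p = p.2 ^ (2 * n + 3) * r p)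
    (hanti : ∀ p ∈ N, u (β p) = -u p) {d d' : ℝ → ℝ} (hd : ContDiffOn ℝ ∞ d (Ioo a b))
    (hd' : ∀ s ∈ Ioo a b, HasDerivAt d (d' s) s)
    (hode : ∀ s ∈ Ioo a b, d' s * A (s, 0) + (2 * n + 2) * d s * Q (s, 0) = -r (s, 0)) :
    ∃ r' : ℝ × ℝ → ℝ, ContDiffOn ℝ ∞ r' N ∧
      ∀ p ∈ N, u p + (d (β p).1 * (β p).2 ^ (2 * n + 2) - d p.1 * p.2 ^ (2 * n + 2)) =
        p.2 ^ (2 * (n + 1) + 3) * r' p := by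
  have hβ1 := h.contDiffOn_apply_fst
  set K : ℝ × ℝ → ℝ := fun p => d (β p).1 * (1 + p.2 * Q p) ^ (2 * n + 2) - d p.1 with hK
  have hKs : ContDiffOn ℝ ∞ K N :=
    ((hd.comp hβ1 fun p hp => h.fst_mem _ (h.mapsTo p hp)).mul
      ((contDiffOn_const.add (contDiffOn_snd.mul h.contDiffOn_Q)).pow _)).sub
      (hd.comp contDiffOn_fst fun p hp => h.fst_mem _ hp)
  obtain ⟨K₁, hK₁s, hK₁⟩ := exists_contDiffOn_snd_mul h.isOpen hKs fun s hs => by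
    simp [hK, h.apply_zero hs]
  have hK₁0 : ∀ s ∈ Ioo a b, K₁ (s, 0) = d' s * A (s, 0) + (2 * n + 2) * d s * Q (s, 0) := by
    intro s hs
    have hsN := h.mem s hs
    have hev : ∀ᶠ z in 𝓝 (0 : ℝ), (s, z) ∈ N := by
      have h2 : ContinuousAt (fun z : ℝ => (s, z)) 0 := by fun_prop
      exact h2.eventually (h.isOpen.mem_nhds hsN)
    have h1 := hasDerivAt_mul_slice h.isOpen hK₁s hsN
    have h2 : HasDerivAt (fun z => s + z * A (s, z)) (A (s, 0)) 0 :=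
      (hasDerivAt_mul_slice h.isOpen h.contDiffOn_A hsN).const_add s
    have h3 : HasDerivAt (fun z => 1 + z * Q (s, z)) (Q (s, 0)) 0 :=
      (hasDerivAt_mul_slice h.isOpen h.contDiffOn_Q hsN).const_add 1
    have h4 : HasDerivAt (fun z => d (s + z * A (s, z))) (d' s * A (s, 0)) 0 :=
      HasDerivAt.comp (h₂ := d) 0 (by simpa using hd' s hs) h2
    have h5 := (h4.mul (h3.pow (2 * n + 2))).sub_const (d s)
    have h6 : HasDerivAt (fun z => z * K₁ (s, z)) _ 0 := h5.congr_of_eventuallyEq (by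
      filter_upwards [hev] with z hz
      have := hK₁ _ hz
      simp only at this
      rw [← this]
      simp [hK, h.fst_eq _ hz])
    rw [h1.unique h6]
    simp
    ring
  obtain ⟨r₁, hr₁s, hr₁⟩ := exists_contDiffOn_snd_mul h.isOpen (hr.add hK₁s) fun s hs => by
    have hs' := h.fst_mem _ hs
    rw [hK₁0 s hs', hode s hs']
    ring
  have hu' : ∀ p ∈ N, u p + (d (β p).1 * (β p).2 ^ (2 * n + 2) - d p.1 * p.2 ^ (2 * n + 2)) =
        p.2 ^ (2 * (n + 2)) * r₁ p := by
    intro p hp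
    have e1 := hK₁ p hp
    have e2 := hr₁ p hp
    rw [hu p hp, h.snd_eq p hp, Even.neg_pow ⟨n + 1, by ring⟩, mul_pow]
    have : p.2 ^ (2 * (n + 2)) * r₁ p = p.2 ^ (2 * n + 3) * (r p + K₁ p) := by rw [e2]; ring
    rw [this]
    have : p.2 ^ (2 * n + 3) * (r p + K₁ p) =
      p.2 ^ (2 * n + 3) * r p + p.2 ^ (2 * n + 2) * (p.2 * K₁ p) := by ring
    rw [this, ← e1]
    simp only [hK]
    ring
  obtain ⟨r₂, hr₂s, hr₂⟩ := exists_contDiffOn_snd_mul h.isOpen hr₁s fun s hs =>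
    h.apply_zero_of_even (n + 2) hr₁s hu' (fun p hp => by
      rw [h.involutive p hp, hanti p hp]
      ring) hs
  exact ⟨r₂, hr₂s, fun p hp => by rw [hu' p hp, hr₂ p hp]; ring⟩

theorem exists_formal_integral (h : IsFoldInvolution a b N β A Q) :
    ∃ c : ℕ → ℝ → ℝ, (∀ k, ContDiffOn ℝ ∞ (c k) (Ioo a b)) ∧ (∀ s ∈ Ioo a b, 0 < c 0 s) ∧
      ∀ n, ∃ r : ℝ × ℝ → ℝ, ContDiffOn ℝ ∞ r N ∧ ∀ p ∈ N,
        ∑ k ∈ Finset.range n, (c k (β p).1 * (β p).2 ^ (2 * k + 2) - c k p.1 * p.2 ^ (2 * k + 2)) =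
          p.2 ^ (2 * n + 3) * r p := by
  have hA := h.contDiffOn_slice h.contDiffOn_A
  have hQ := h.contDiffOn_slice h.contDiffOn_Q
  obtain ⟨Φ, hΦ, hΦ'⟩ := exists_contDiffOn_primitive
    (((contDiffOn_const (c := (-2 : ℝ))).mul hQ).div hA h.A_ne_zero)
  let P : ℕ → (ℝ × ℝ → ℝ) → Prop := fun n u =>
    (∃ r : ℝ × ℝ → ℝ, ContDiffOn ℝ ∞ r N ∧ ∀ p ∈ N, u p = p.2 ^ (2 * n + 3) * r p) ∧
      ∀ p ∈ N, u (β p) = -u p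
  let T : ℕ → (ℝ → ℝ) → ℝ × ℝ → ℝ := fun n d p =>
    d (β p).1 * (β p).2 ^ (2 * n + 2) - d p.1 * p.2 ^ (2 * n + 2)
  have hT : ∀ n d, ∀ p ∈ N, T n d (β p) = -T n d p := by
    intro n d p hp
    simp only [T]
    rw [h.involutive p hp]
    ring
  have key : ∀ (n : ℕ) (u : ℝ × ℝ → ℝ), ∃ d : ℝ → ℝ, ContDiffOn ℝ ∞ d (Ioo a b) ∧
      (P n u → P (n + 1) (u + T n d)) ∧ (n = 0 → u = 0 → ∀ s ∈ Ioo a b, 0 < d s) := by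
    intro n u
    by_cases hn : n = 0 ∧ u = 0
    · obtain ⟨rfl, rfl⟩ := hn
      refine ⟨fun s => Real.exp (Φ s), hΦ.exp, fun hP => ⟨?_, ?_⟩, fun _ _ s _ => Real.exp_pos _⟩
      · refine h.exists_step 0 (u := 0) (r := 0) contDiffOn_const (by simp) (by simp) hΦ.exp
          (fun s hs => (hΦ' s hs).exp) fun s hs => ?_
        have := h.A_ne_zero s hs
        simp
        field_simp
        ring
      · intro p hp
        simp [hT 0 _ p hp]
    · by_cases hP : P n u
      · obtain ⟨⟨r, hr, hur⟩, hanti⟩ := hP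
        have hE : ContDiffOn ℝ ∞ (fun s => Real.exp ((n + 1) * Φ s)) (Ioo a b) :=
          (contDiffOn_const.mul hΦ).exp
        obtain ⟨e, he, he'⟩ := exists_contDiffOn_primitive
          ((h.contDiffOn_slice hr).neg.div (hA.mul hE) fun s hs =>
            mul_ne_zero (h.A_ne_zero s hs) (Real.exp_pos _).ne')
        refine ⟨fun s => Real.exp ((n + 1) * Φ s) * e s, hE.mul he, fun _ => ⟨?_, ?_⟩, fun h1 h2 =>
          absurd ⟨h1, h2⟩ hn⟩
        · refine h.exists_step n hr hur hanti (hE.mul he)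
            (fun s hs => (((hΦ' s hs).const_mul _).exp.mul (he' s hs))) fun s hs => ?_
          have := h.A_ne_zero s hs
          have h3 := (Real.exp_pos ((n + 1) * Φ s)).ne'
          simp
          field_simp
          ring
        · intro p hp
          simp only [Pi.add_apply, hT n _ p hp, hanti p hp]
          ring
      · exact ⟨0, contDiffOn_const, fun h1 => absurd h1 hP, fun h1 h2 => absurd ⟨h1, h2⟩ hn⟩
  choose d hd hdP hd0 using key
  let U : ℕ → ℝ × ℝ → ℝ := fun n => Nat.rec 0 (fun n u => u + T n (d n u)) n
  have hU : ∀ n, P n (U n) := by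
    intro n
    induction n with
    | zero => exact ⟨⟨0, contDiffOn_const, by simp [U]⟩, by simp [U]⟩
    | succ n ih => exact hdP n (U n) ih
  have hUsum : ∀ n p, U n p = ∑ k ∈ Finset.range n, T k (d k (U k)) p := by
    intro n p
    induction n with
    | zero => simp [U]
    | succ n ih => rw [Finset.sum_range_succ, ← ih]; rfl
  refine ⟨fun k => d k (U k), fun k => hd _ _, hd0 0 _ rfl rfl, fun n => ?_⟩
  obtain ⟨⟨r, hr, hur⟩, -⟩ := hU n
  exact ⟨r, hr, fun p hp => by rw [← hur p hp, hUsum]⟩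

end IsFoldInvolution

theorem exists_isAdjDomain_subset {a b : ℝ} (hab : a < b) {V U : Set (ℝ × ℝ)}
    (hV : IsAdjDomain a b V) (hU : IsOpen U) (hJU : Jset a b ⊆ U) :
    ∃ W ⊆ V, W ⊆ U ∧ IsAdjDomain a b W := by
  let t : Ioo a b → Set ℝ := fun s =>
    {e | 0 < e ∧ ∀ y, 0 < y → y < e → ((s : ℝ), y) ∈ V ∩ U}
  have htc : ∀ s, Convex ℝ (t s) := by
    intro s
    refine OrdConnected.convex ⟨fun x hx y hy z hz => ⟨hx.1.trans_le hz.1, fun w hw hwz => ?_⟩⟩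
    exact hy.2 w hw (hwz.trans_le hz.2)
  have htl : ∀ s, ∃ e, ∀ᶠ s' in 𝓝 s, e ∈ t s' := by
    intro s
    obtain ⟨ε, hε, hεV⟩ := hV.2.2.2 s s.2
    obtain ⟨δ, hδ, hδU⟩ := Metric.isOpen_iff.1 hU (s, 0) (hJU ⟨s.2, rfl⟩)
    refine ⟨min ε δ, ?_⟩
    have h1 : ∀ᶠ s' : Ioo a b in 𝓝 s, dist (s' : ℝ) s < min ε δ :=
      continuous_subtype_val.continuousAt.eventually
        (Metric.ball_mem_nhds _ (lt_min hε hδ))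
    filter_upwards [h1] with s' hs'
    refine ⟨lt_min hε hδ, fun y hy hye => ⟨hεV ⟨?_, hy, hye.trans_le (min_le_left _ _)⟩, hδU ?_⟩⟩
    · have := hs'.trans_le (min_le_left _ _)
      rwa [← Real.ball_eq_Ioo]
    · rw [← ball_prod_same]
      refine ⟨hs'.trans_le (min_le_right _ _), ?_⟩
      rw [Metric.mem_ball, Real.dist_eq, sub_zero, abs_of_pos hy]
      exact hye.trans_le (min_le_right _ _)
  obtain ⟨f, hf⟩ := exists_continuous_forall_mem_convex_of_local_const htc htl
  let g : ℝ → ℝ := fun s => if h : s ∈ Ioo a b then f ⟨s, h⟩ else 0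
  have hg : ContinuousOn g (Ioo a b) := by
    rw [continuousOn_iff_continuous_domRestrict]
    convert! f.continuous using 1
    ext s
    simp [g, s.2.1, s.2.2]
  have hgt : ∀ s (hs : s ∈ Ioo a b), g s ∈ t ⟨s, hs⟩ := by
    intro s hs
    simpa [g, hs.1, hs.2] using hf ⟨s, hs⟩
  have hlow : IsOpen {p : ℝ × ℝ | p.1 ∈ Ioo a b ∧ 0 < g p.1 - p.2} := by
    have h1 : ContinuousOn (fun p : ℝ × ℝ => g p.1 - p.2) (Ioo a b ×ˢ univ) :=
      (hg.comp continuousOn_fst fun p hp => hp.1).sub continuousOn_snd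
    convert! h1.isOpen_inter_preimage (isOpen_Ioo.prod isOpen_univ)
      (isOpen_Ioi (a := (0 : ℝ))) using 1
    ext p
    simp
  let W : Set (ℝ × ℝ) := {p | p.1 ∈ Ioo a b ∧ 0 < g p.1 - p.2} ∩ {p | 0 < p.2}
  have hWVU : ∀ p ∈ W, p ∈ V ∩ U := fun p hp =>
    (hgt p.1 hp.1.1).2 p.2 hp.2 (sub_pos.1 hp.1.2)
  refine ⟨W, fun p hp => (hWVU p hp).1, fun p hp => (hWVU p hp).2,
    hlow.inter (isOpen_lt continuous_const continuous_snd), ?_, fun p hp => hp.2, ?_⟩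
  · have himg : W = (fun q : ℝ × ℝ => (q.1, q.2 * g q.1)) '' (Ioo a b ×ˢ Ioo 0 1) := by
      ext p
      constructor
      · rintro ⟨⟨hp1, hp2⟩, hp3⟩
        have h0 := (hgt p.1 hp1).1
        refine ⟨(p.1, p.2 / g p.1), ⟨hp1, div_pos hp3 h0, ?_⟩, ?_⟩
        · rw [div_lt_one h0]
          exact sub_pos.1 hp2
        · simp [div_mul_cancel₀ _ h0.ne']
      · rintro ⟨q, ⟨hq1, hq2, hq3⟩, rfl⟩
        have h0 := (hgt q.1 hq1).1
        exact ⟨⟨hq1, sub_pos.2 (mul_lt_of_lt_one_left h0 hq3)⟩, mul_pos hq2 h0⟩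
    rw [himg]
    refine ((isConnected_Ioo hab).prod (isConnected_Ioo one_pos)).image _ ?_
    exact continuousOn_fst.prodMk
      (continuousOn_snd.mul (hg.comp continuousOn_fst fun p hp => hp.1))
  · intro s hs
    have hs0 : (s, (0 : ℝ)) ∈ {p : ℝ × ℝ | p.1 ∈ Ioo a b ∧ 0 < g p.1 - p.2} :=
      ⟨hs, by simpa using (hgt s hs).1⟩
    obtain ⟨ε, hε, hεW⟩ := Metric.isOpen_iff.1 hlow _ hs0
    refine ⟨ε, hε, fun p hp => ⟨hεW ?_, hp.2.1⟩⟩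
    rw [← ball_prod_same]
    refine ⟨by rw [Real.ball_eq_Ioo]; exact hp.1, ?_⟩
    rw [Metric.mem_ball, Real.dist_eq, sub_zero, abs_of_pos hp.2.1]
    exact hp.2.2

theorem IsAdjDomain.uniqueDiffOn {a b : ℝ} {W : Set (ℝ × ℝ)} (hW : IsAdjDomain a b W) :
    UniqueDiffOn ℝ (W ∪ Jset a b) := by
  rintro p (hp | ⟨hp, hp0⟩)
  · exact (hW.1.uniqueDiffWithinAt hp).mono subset_union_left
  · obtain ⟨s, y⟩ := p
    obtain rfl : y = 0 := hp0
    obtain ⟨ε, hε, hεW⟩ := hW.2.2.2 s hp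
    have h1 : UniqueDiffWithinAt ℝ ((Ioo (s - ε) (s + ε) ∩ Ioo a b) ×ˢ Ico 0 ε) (s, (0 : ℝ)) := by
      refine UniqueDiffWithinAt.prod ?_ ?_
      · exact (isOpen_Ioo.inter isOpen_Ioo).uniqueDiffWithinAt
          ⟨⟨by linarith, by linarith⟩, hp⟩
      · exact uniqueDiffOn_Ico 0 ε 0 ⟨le_rfl, hε⟩
    refine h1.mono fun q hq => ?_
    rcases hq.2.1.eq_or_lt with h0 | h0
    · exact .inr ⟨hq.1.2, h0.symm⟩
    · exact .inl (hεW ⟨hq.1.1, h0, hq.2.2⟩)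

theorem IsAdjDomain.flatOn {a b : ℝ} {W O : Set (ℝ × ℝ)} (hW : IsAdjDomain a b W)
    (hO : IsOpen O) (hWO : W ∪ Jset a b ⊆ O) {f G : ℝ × ℝ → ℝ} (hG : ContDiffOn ℝ ∞ G O)
    (hfG : EqOn f G (W ∪ Jset a b)) (h0 : ∀ n, ∀ s ∈ Ioo a b, iteratedFDeriv ℝ n G (s, 0) = 0) :
    FlatOn a b (W ∪ Jset a b) f := by
  refine ⟨fun s hs => ?_, fun n K hK hKab ε hε => ?_⟩
  · rw [hfG (show (s, (0 : ℝ)) ∈ W ∪ Jset a b from .inr ⟨hs, rfl⟩), ← norm_eq_zero,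
      ← norm_iteratedFDeriv_zero (𝕜 := ℝ), h0 0 s hs, norm_zero]
  · have hcont : ContinuousOn (fun p => ‖iteratedFDeriv ℝ n G p‖) O := fun p hp =>
      ((hG.contDiffAt (hO.mem_nhds hp)).continuousAt_iteratedFDeriv
        (by exact_mod_cast le_top)).norm.continuousWithinAt
    have hopen := hcont.isOpen_inter_preimage hO (isOpen_Iio (a := ε))
    obtain ⟨A, B, hA, hB, hKA, h0B, hAB⟩ := generalized_tube_lemma hK
      (isCompact_singleton (x := (0 : ℝ))) hopen (by
        rintro ⟨s, y⟩ ⟨hs, hy⟩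
        obtain rfl : y = 0 := hy
        exact ⟨hWO (.inr ⟨hKab hs, rfl⟩), by simpa [h0 n s (hKab hs)] using hε⟩)
    obtain ⟨δ, hδ, hδB⟩ := Metric.isOpen_iff.1 hB 0 (h0B rfl)
    refine ⟨δ, hδ, fun p hp hpK hpδ => ?_⟩
    have hp0 : 0 ≤ p.2 := by
      rcases hp with hp | hp
      · exact (hW.2.2.1 p hp).le
      · exact hp.2.ge
    have hpO := hAB ⟨hKA hpK, hδB (by
      rwa [Metric.mem_ball, Real.dist_eq, sub_zero, abs_of_nonneg hp0])⟩
    rw [iteratedFDerivWithin_congr hfG hp, iteratedFDerivWithin_eq_iteratedFDeriv hW.uniqueDiffOn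
      ((hG.contDiffAt (hO.mem_nhds hpO.1)).of_le (by exact_mod_cast le_top)) hp]
    exact hpO.2

theorem IsBilliardLike.exists_isFoldInvolution {a b : ℝ} {w : ℝ → ℝ} {V : Set (ℝ × ℝ)}
    {F : ℝ × ℝ → ℝ × ℝ} (hF : IsBilliardLike a b w V F) :
    ∃ N β A Q, IsFoldInvolution a b N β A Q ∧
      ∀ p ∈ N, 0 < p.2 → (p.1, p.2 ^ 2) ∈ V → F (p.1, p.2 ^ 2) = ((β p).1, (β p).2 ^ 2) := by
  obtain ⟨N, hN, hJN, β, hβ, hβN, hβ0, hasy, hFβ⟩ := hF.lifted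
  let N₀ : Set (ℝ × ℝ) := N ∩ {p | p.1 ∈ Ioo a b} ∩ (N ∩ {p | (β p).1 ∈ Ioo a b})
  have hN₀ : IsOpen N₀ :=
    (hN.inter (isOpen_Ioo.preimage continuous_fst)).inter
      ((continuous_fst.comp_continuousOn hβ.continuousOn).isOpen_inter_preimage hN isOpen_Ioo)
  have hmem : ∀ s ∈ Ioo a b, (s, (0 : ℝ)) ∈ N₀ := fun s hs =>
    ⟨⟨hJN ⟨hs, rfl⟩, hs⟩, hJN ⟨hs, rfl⟩, by simpa [hβ0 s hs] using hs⟩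
  have hβ' : ContDiffOn ℝ ∞ β N₀ := hβ.mono fun p hp => hp.1.1
  obtain ⟨A, hA, hAe⟩ := exists_contDiffOn_snd_mul hN₀ (u := fun p => (β p).1 - p.1)
    ((contDiff_fst.comp_contDiffOn hβ').sub contDiff_fst.contDiffOn)
    fun s hs => by simp [hβ0 s hs.1.2]
  obtain ⟨B, hB, hBe⟩ := exists_contDiffOn_snd_mul hN₀ (u := fun p => -(β p).2)
    (contDiff_snd.comp_contDiffOn hβ').neg
    fun s hs => by simp [hβ0 s hs.1.2]
  have key : ∀ (f : ℝ × ℝ → ℝ) (c : ℝ) (s : ℝ), s ∈ Ioo a b → ContDiffOn ℝ ∞ f N₀ →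
      (∃ C > 0, ∃ δ > 0, ∀ p ∈ N, p.1 ∈ ({s} : Set ℝ) → |p.2| < δ → p ∈ N₀ →
        |p.2 * f p - c * p.2| ≤ C * p.2 ^ 2) → f (s, 0) = c := by
    rintro f c s hs hf ⟨C, hC, δ, hδ, h⟩
    have hc : ContinuousAt (fun z : ℝ => f (s, z)) 0 :=
      (hf.continuousOn.continuousAt (hN₀.mem_nhds (hmem s hs))).comp
        (f := fun z : ℝ => (s, z)) (by fun_prop)
    have h1 : Tendsto (fun z : ℝ => |f (s, z) - c|) (𝓝[>] 0) (𝓝 |f (s, 0) - c|) :=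
      ((hc.tendsto.sub_const c).abs).mono_left nhdsWithin_le_nhds
    have h2 : Tendsto (fun z : ℝ => C * z) (𝓝[>] 0) (𝓝 0) := by
      have : Continuous fun z : ℝ => C * z := by fun_prop
      simpa using (this.tendsto 0).mono_left nhdsWithin_le_nhds
    have h3 : ∀ᶠ z : ℝ in 𝓝 0, (s, z) ∈ N₀ :=
      (by fun_prop : ContinuousAt (fun z : ℝ => (s, z)) 0).eventually
        (hN₀.mem_nhds (hmem s hs))
    have h4 : |f (s, 0) - c| ≤ 0 := by
      refine le_of_tendsto_of_tendsto h1 h2 ?_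
      filter_upwards [nhdsWithin_le_nhds h3, Ioo_mem_nhdsGT hδ] with z hz hzδ
      have h5 := h (s, z) hz.1.1 rfl (by simpa [abs_of_pos hzδ.1] using hzδ.2) hz
      rw [show z * f (s, z) - c * z = z * (f (s, z) - c) by ring, abs_mul, abs_of_pos hzδ.1,
        show C * z ^ 2 = z * (C * z) by ring] at h5
      exact le_of_mul_le_mul_left h5 hzδ.1
    exact sub_eq_zero.1 (abs_nonpos_iff.1 h4)
  have hA0 : ∀ s ∈ Ioo a b, A (s, 0) = w s := by
    intro s hs
    obtain ⟨C, hC, δ, hδ, h⟩ := hasy {s} isCompact_singleton (singleton_subset_iff.2 hs)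
    refine key A (w s) s hs hA ⟨C, hC, δ, hδ, fun p hp hps hpδ hp₀ => ?_⟩
    rw [← hAe p hp₀, ← show p.1 = s from hps]
    exact (h p hp hps hpδ).1
  have hB0 : ∀ s ∈ Ioo a b, B (s, 0) = 1 := by
    intro s hs
    obtain ⟨C, hC, δ, hδ, h⟩ := hasy {s} isCompact_singleton (singleton_subset_iff.2 hs)
    refine key B 1 s hs hB ⟨C, hC, δ, hδ, fun p hp hps hpδ hp₀ => ?_⟩
    rw [← hBe p hp₀, one_mul, ← abs_neg, neg_sub, sub_neg_eq_add, add_comm]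
    exact (h p hp hps hpδ).2
  obtain ⟨Q, hQ, hQe⟩ := exists_contDiffOn_snd_mul hN₀ (u := fun p => B p - 1)
    (hB.sub contDiffOn_const) fun s hs => by simp [hB0 s hs.1.2]
  refine ⟨N₀, β, A, Q, ⟨hN₀, fun p hp => hp.1.2, hmem, fun p hp => ?_, fun p hp => (hβN p hp.1.1).2,
    hA, hQ, fun p hp => ?_, fun p hp => ?_, fun s hs => ?_⟩, fun p hp hp0 hpV => ?_⟩
  · obtain ⟨h1, h2⟩ := hβN p hp.1.1
    exact ⟨⟨h1, hp.2.2⟩, h1, by simpa [h2] using hp.1.2⟩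
  · linarith [hAe p hp]
  · rw [← hQe p hp, add_sub_cancel, ← hBe p hp, neg_neg]
  · rw [hA0 s hs]
    exact (hF.wPos s hs).ne'
  · obtain ⟨h1, h2⟩ := hFβ p hp.1.1 hp0 hpV
    refine Prod.ext h1 ?_
    rw [← neg_sq (β p).2, ← h2, Real.sq_sqrt (hF.mapsUpper _ (.inl hpV))]

theorem IsFoldInvolution.exists_flat_integral {a b : ℝ} {N : Set (ℝ × ℝ)} {β : ℝ × ℝ → ℝ × ℝ}
    {A Q : ℝ × ℝ → ℝ} (h : IsFoldInvolution a b N β A Q) :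
    ∃ H : ℝ × ℝ → ℝ, ContDiffOn ℝ ∞ H (Ioo a b ×ˢ univ) ∧ (∀ s ∈ Ioo a b, 0 < H (s, 0)) ∧
      ∀ n, ∃ v, ContDiffOn ℝ ∞ v N ∧ ∀ p ∈ N,
        (β p).2 ^ 2 * H ((β p).1, (β p).2 ^ 2) - p.2 ^ 2 * H (p.1, p.2 ^ 2) = p.2 ^ n * v p := by
  obtain ⟨c, hc, hc0, hcr⟩ := h.exists_formal_integral
  obtain ⟨H, hH⟩ := exists_borel_sum a b hc
  refine ⟨H, ?_, fun s hs => ?_, fun n => ?_⟩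
  · obtain ⟨R, hR, hHR⟩ := hH 0
    exact hR.congr fun p _ => by simp [hHR p]
  · obtain ⟨R, hR, hHR⟩ := hH 1
    simpa [hHR] using hc0 s hs
  · obtain ⟨R, hR, hHR⟩ := hH n
    obtain ⟨r, hr, hre⟩ := hcr n
    have hQ := h.contDiffOn_Q
    have h1 : ContDiffOn ℝ ∞ (fun p => R ((β p).1, (β p).2 ^ 2)) N :=
      hR.comp (h.contDiffOn_apply_fst.prodMk (h.contDiffOn_apply_snd.pow 2))
        fun p hp => ⟨h.fst_mem (β p) (h.mapsTo p hp), trivial⟩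
    have h2 : ContDiffOn ℝ ∞ (fun p : ℝ × ℝ => R (p.1, p.2 ^ 2)) N :=
      hR.comp (by fun_prop) fun p hp => ⟨h.fst_mem p hp, trivial⟩
    refine ⟨fun p => p.2 ^ (n + 3) * r p + p.2 ^ (n + 2) *
      ((1 + p.2 * Q p) ^ (2 * n + 2) * R ((β p).1, (β p).2 ^ 2) - R (p.1, p.2 ^ 2)), ?_,
      fun p hp => ?_⟩
    · exact ((contDiffOn_snd.pow _).mul hr).add ((contDiffOn_snd.pow _).mul
        ((((contDiffOn_const.add (contDiffOn_snd.mul hQ)).pow _).mul h1).sub h2))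
    have h3 : ∀ x y : ℝ, y ^ 2 * ∑ k ∈ Finset.range n, c k x * (y ^ 2) ^ k =
        ∑ k ∈ Finset.range n, c k x * y ^ (2 * k + 2) := by
      intro x y
      rw [Finset.mul_sum]
      exact Finset.sum_congr rfl fun k _ => by ring
    have h4 : (β p).2 ^ (2 * n + 2) = p.2 ^ (2 * n + 2) * (1 + p.2 * Q p) ^ (2 * n + 2) := by
      rw [h.snd_eq p hp, Even.neg_pow ⟨n + 1, by ring⟩, mul_pow]
    have h5 := hre p hp
    rw [Finset.sum_sub_distrib] at h5
    rw [hHR, hHR, mul_add, mul_add, h3, h3]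
    linear_combination h5 + R ((β p).1, (β p).2 ^ 2) * h4

end

/-- **Marvizi–Melrose.** For every `C^∞`-lifted strongly billiard-like map `F`
there exist a domain `W ⊆ V` adjacent to `J` and a `C^∞`-smooth function
`h : W ∪ J → ℝ_{≥0}` with `h ≡ 0` on `J` and `∂h/∂y > 0` on `J`, such that `h ∘ F − h`
is `C^∞`-smooth on `W ∪ J` and `y`-flat. -/
theorem statement5 (a b : ℝ) (hab : a < b) (w : ℝ → ℝ) (V : Set (ℝ × ℝ))
    (F : ℝ × ℝ → ℝ × ℝ) (hF : IsBilliardLike a b w V F) :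
    ∃ W : Set (ℝ × ℝ), W ⊆ V ∧ IsAdjDomain a b W ∧
      ∃ h : ℝ × ℝ → ℝ,
        ContDiffOn ℝ (⊤ : ℕ∞) h (W ∪ Jset a b) ∧
        (∀ p ∈ W ∪ Jset a b, 0 ≤ h p) ∧
        (∀ s ∈ Set.Ioo a b, h (s, 0) = 0) ∧
        (∀ s ∈ Set.Ioo a b,
          0 < fderivWithin ℝ h (W ∪ Jset a b) (s, 0) (0, 1)) ∧
        ContDiffOn ℝ (⊤ : ℕ∞) (fun p => h (F p) - h p) (W ∪ Jset a b) ∧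
        FlatOn a b (W ∪ Jset a b) (fun p => h (F p) - h p) := by
  obtain ⟨N, β, A, Q, hβ, hFβ⟩ := hF.exists_isFoldInvolution
  obtain ⟨H, hH, hH0, hv⟩ := hβ.exists_flat_integral
  have hIoo : IsOpen (Ioo a b ×ˢ (univ : Set ℝ)) := isOpen_Ioo.prod isOpen_univ
  let u : ℝ × ℝ → ℝ := fun p =>
    (β p).2 ^ 2 * H ((β p).1, (β p).2 ^ 2) - p.2 ^ 2 * H (p.1, p.2 ^ 2)
  let O : Set (ℝ × ℝ) := {p | (p.1, √p.2) ∈ N}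
  have hO : IsOpen O := isOpen_setOf_sqrt_mem hβ.isOpen
  have hpos : IsOpen ((Ioo a b ×ˢ (univ : Set ℝ)) ∩ H ⁻¹' Ioi 0) :=
    hH.continuousOn.isOpen_inter_preimage hIoo isOpen_Ioi
  have hJU : Jset a b ⊆ O ∩ ((Ioo a b ×ˢ univ) ∩ H ⁻¹' Ioi 0) := by
    rintro ⟨s, y⟩ ⟨hs, hy⟩
    obtain rfl : y = 0 := hy
    exact ⟨by simpa [O] using hβ.mem s hs, ⟨hs, trivial⟩, hH0 s hs⟩
  obtain ⟨W, hWV, hWU, hW⟩ := exists_isAdjDomain_subset hab hF.adj (hO.inter hpos) hJU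
  have hSU := union_subset hWU hJU
  have hh : ContDiffOn ℝ (⊤ : ℕ∞) (fun p => p.2 * H p) (Ioo a b ×ˢ univ) := contDiffOn_snd.mul hH
  have hG : ContDiffOn ℝ (⊤ : ℕ∞) (fun p => u (p.1, √p.2)) O := contDiffOn_comp_sqrt hβ.isOpen hv
  have heq : EqOn (fun p => (F p).2 * H (F p) - p.2 * H p) (fun p => u (p.1, √p.2))
      (W ∪ Jset a b) := by
    rintro ⟨s, y⟩ (hp | ⟨hs, hy⟩)
    · have hy : 0 < y := hW.2.2.1 _ hp
      have h1 := hFβ (s, √y) (hWU hp).1 (Real.sqrt_pos.2 hy)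
        (by simpa [Real.sq_sqrt hy.le] using hWV hp)
      simp only [Real.sq_sqrt hy.le] at h1
      simp [u, h1, Real.sq_sqrt hy.le]
    · obtain rfl : y = 0 := hy
      simp [u, hF.fixJ s hs, hβ.apply_zero (hβ.mem s hs)]
  refine ⟨W, hWV, hW, fun p => p.2 * H p, hh.mono fun p hp => (hSU hp).2.1, fun p hp => ?_,
    fun s _ => by simp, fun s hs => ?_, ?_, ?_⟩
  · refine mul_nonneg ?_ (le_of_lt (hSU hp).2.2)
    rcases hp with hp | hp
    · exact (hW.2.2.1 p hp).le
    · exact hp.2.ge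
  · have hmem : (s, (0 : ℝ)) ∈ Ioo a b ×ˢ (univ : Set ℝ) := ⟨hs, trivial⟩
    have hd : DifferentiableAt ℝ (fun p : ℝ × ℝ => p.2 * H p) (s, 0) :=
      (hh.contDiffAt (hIoo.mem_nhds hmem)).differentiableAt (by simp)
    have h1 : HasDerivAt (fun z : ℝ => z * H (s, z)) (H (s, 0)) 0 :=
      hasDerivAt_mul_slice hIoo hH hmem
    have h2 : HasDerivAt (fun z : ℝ => (s, z)) ((0 : ℝ), (1 : ℝ)) 0 :=
      (hasDerivAt_const _ _).prodMk (hasDerivAt_id _)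
    rw [hd.fderivWithin (hW.uniqueDiffOn _ (.inr ⟨hs, rfl⟩)),
      (hd.hasFDerivAt.comp_hasDerivAt (0 : ℝ) h2).unique h1]
    exact hH0 s hs
  · exact (hG.mono fun p hp => (hSU hp).1).congr heq
  · exact hW.flatOn hO (fun p hp => (hSU hp).1) hG heq fun n s hs =>
      iteratedFDeriv_comp_sqrt_eq_zero hβ.isOpen hv n (hβ.mem s hs)
end
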